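/- Let p be an odd prime and let K_0 ⊆ K_1 ⊆ K_2 ⊆ ⋯ be a ℤ_p-tower of number fields, i.e., an increasing chain of number fields inside a fixed algebraic closure of ℚ such that for every n ≥ 0 the extension K_n/K_0 is Galois with Galois group isomorphic to ℤ/p^nℤ. Let d_n denote the absolute value of the discriminant of K_n over ℚ. Then there exist rational constants a, b, c with a > 0, depending only on the tower, such that for all sufficiently large n one has v_p(d_n) = a·n·p^n + b·p^n + c, where v_p is the p-adic valuation on ℤ normalized so that v_p(p) = 1. -/

import Mathlib

set_option linter.unusedSectionVars false
set_option linter.style.haveILetI false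

namespace ZpTower

open Module

theorem _root_.AddValuation.map_sum_le_of_pairwise_ne {L ι : Type*} [Field L]
    (v : AddValuation L (WithTop ℤ)) (s : Finset ι) (f : ι → L)
    (h : ∀ i ∈ s, ∀ j ∈ s, i ≠ j → f i ≠ 0 → v (f i) ≠ v (f j)) {i : ι} (hi : i ∈ s) :
    v (∑ j ∈ s, f j) ≤ v (f i) := by
  classical
  obtain ⟨i₀, hi₀, hmin⟩ := s.exists_min_image (fun j => v (f j)) ⟨i, hi⟩
  by_cases h0 : f i₀ = 0
  · have : f i = 0 := by
      have h1 := hmin i hi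
      rw [h0, AddValuation.map_zero, top_le_iff] at h1
      exact v.top_iff.1 h1
    rw [this, AddValuation.map_zero]
    exact le_top
  · refine le_trans (le_of_eq ?_) (hmin i hi)
    rw [← Finset.add_sum_erase s f hi₀]
    refine AddValuation.map_add_eq_of_lt_left v ?_
    refine AddValuation.map_lt_sum v (mt v.top_iff.1 h0) fun j hj => ?_
    rw [Finset.mem_erase] at hj
    exact lt_of_le_of_ne (hmin j hj.2) (h i₀ hi₀ j hj.2 hj.1.symm h0)

/-- The element `π` is a uniformizer for the `Gal(L/K)`-invariant valuation `v`, and `v` is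
totally ramified over `K`. -/
structure IsTotallyRamified (K : Type*) {L : Type*} [Field K] [Field L] [Algebra K L]
    (v : AddValuation L (WithTop ℤ)) (π : L) : Prop where
  map_uniformizer : v π = 1
  map_gal : ∀ (g : L ≃ₐ[K] L) (x : L), v (g x) = v x
  map_base : ∀ c : K, c ≠ 0 → ∃ m : ℤ, v (algebraMap K L c) = ((finrank K L * m : ℤ) : WithTop ℤ)

section Local

variable {K L : Type*} [Field K] [Field L] [Algebra K L] [FiniteDimensional K L]
  {v : AddValuation L (WithTop ℤ)} {π : L}

namespace IsTotallyRamified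

variable (H : IsTotallyRamified K v π)
include H

theorem ne_zero : π ≠ 0 := by
  rintro rfl
  have := H.map_uniformizer
  simp at this

theorem map_pow (i : ℕ) : v (π ^ i) = ((i : ℤ) : WithTop ℤ) := by
  rw [AddValuation.map_pow, H.map_uniformizer]
  simp

theorem map_smul_pow (c : K) (hc : c ≠ 0) (i : ℕ) :
    ∃ m : ℤ, v (c • π ^ i) = ((finrank K L * m + i : ℤ) : WithTop ℤ) := by
  obtain ⟨m, hm⟩ := H.map_base c hc
  refine ⟨m, ?_⟩
  rw [Algebra.smul_def, AddValuation.map_mul, hm, H.map_pow]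
  rfl

theorem map_sum_le (c : Fin (finrank K L) → K) (i : Fin (finrank K L)) :
    v (∑ j, c j • π ^ (j : ℕ)) ≤ v (c i • π ^ (i : ℕ)) := by
  refine AddValuation.map_sum_le_of_pairwise_ne v _ _ (fun i _ j _ hij h0 => ?_)
    (Finset.mem_univ i)
  have hi : c i ≠ 0 := by rintro h; simp [h] at h0
  obtain ⟨m, hm⟩ := H.map_smul_pow (c i) hi i
  by_cases hj : c j = 0
  · rw [hm]; simp only [hj, zero_smul, AddValuation.map_zero]; exact WithTop.coe_ne_top
  obtain ⟨m', hm'⟩ := H.map_smul_pow (c j) hj j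
  rw [hm, hm']
  intro h
  have h := WithTop.coe_injective h
  apply hij
  have hi := i.2
  have hj := j.2
  have : (i : ℤ) % (finrank K L : ℤ) = (j : ℤ) % (finrank K L : ℤ) := by
    have := congrArg (· % (finrank K L : ℤ)) h
    simpa [Int.add_emod] using this
  rw [Int.emod_eq_of_lt (by positivity) (by exact_mod_cast hi),
    Int.emod_eq_of_lt (by positivity) (by exact_mod_cast hj)] at this
  exact Fin.ext (by exact_mod_cast this)

theorem linearIndependent : LinearIndependent K fun i : Fin (finrank K L) => π ^ (i : ℕ) := by
  rw [Fintype.linearIndependent_iff]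
  intro c hc i
  have := H.map_sum_le c i
  rw [hc, AddValuation.map_zero, top_le_iff, v.top_iff, smul_eq_zero] at this
  exact this.resolve_right (pow_ne_zero _ H.ne_zero)

/-- The powers of a uniformizer form a power basis. -/
noncomputable def powerBasis : PowerBasis K L where
  gen := π
  dim := finrank K L
  basis :=
    haveI : Nonempty (Fin (finrank K L)) := ⟨⟨0, finrank_pos⟩⟩
    basisOfLinearIndependentOfCardEqFinrank H.linearIndependent (by simp)
  basis_eq_pow i := by simp

theorem powerBasis_gen : H.powerBasis.gen = π := rfl

theorem exists_expansion (x : L) : ∃ c : Fin (finrank K L) → K,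
    x = ∑ j, c j • π ^ (j : ℕ) ∧ ∀ i, v x ≤ v (c i • π ^ (i : ℕ)) := by
  refine ⟨fun i => H.powerBasis.basis.repr x i, ?_, ?_⟩
  · conv_lhs => rw [← H.powerBasis.basis.sum_repr x]
    simp only [PowerBasis.coe_basis]
    rfl
  · intro i
    have h : x = ∑ j : Fin (finrank K L), H.powerBasis.basis.repr x j • π ^ (j : ℕ) := by
      conv_lhs => rw [← H.powerBasis.basis.sum_repr x]
      simp only [PowerBasis.coe_basis]
      rfl
    conv_lhs => rw [h]
    exact H.map_sum_le (fun i => H.powerBasis.basis.repr x i) i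

theorem exists_map_eq (c : Fin (finrank K L) → K) (h : ∑ j, c j • π ^ (j : ℕ) ≠ 0) :
    ∃ i, c i ≠ 0 ∧ v (∑ j, c j • π ^ (j : ℕ)) = v (c i • π ^ (i : ℕ)) := by
  haveI : Nonempty (Fin (finrank K L)) := ⟨⟨0, finrank_pos⟩⟩
  obtain ⟨i₀, hi₀, hmin⟩ := Finset.univ.exists_min_image
    (fun j => v (c j • π ^ (j : ℕ))) Finset.univ_nonempty
  have h1 := H.map_sum_le c i₀
  have h2 : v (c i₀ • π ^ (i₀ : ℕ)) ≤ v (∑ j, c j • π ^ (j : ℕ)) :=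
    AddValuation.map_le_sum v hmin
  have h3 := le_antisymm h1 h2
  refine ⟨i₀, ?_, h3⟩
  intro h0
  rw [h0, zero_smul, AddValuation.map_zero, v.top_iff] at h3
  exact h h3

end IsTotallyRamified

end Local

end ZpTower

namespace ZpTower

open Module

theorem le_map_mul {L : Type*} [Field L] {v : AddValuation L (WithTop ℤ)} {x y : L} {a b : ℤ}
    (hx : (a : WithTop ℤ) ≤ v x) (hy : (b : WithTop ℤ) ≤ v y) :
    ((a + b : ℤ) : WithTop ℤ) ≤ v (x * y) := by
  rw [AddValuation.map_mul, WithTop.coe_add]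
  exact add_le_add hx hy

theorem le_map_mono {L : Type*} [Field L] {v : AddValuation L (WithTop ℤ)} {x : L} {a b : ℤ}
    (hab : b ≤ a) (hx : (a : WithTop ℤ) ≤ v x) : (b : WithTop ℤ) ≤ v x :=
  (WithTop.coe_le_coe.2 hab).trans hx

theorem exists_map_eq_coe {L : Type*} [Field L] (v : AddValuation L (WithTop ℤ)) {x : L}
    (hx : x ≠ 0) : ∃ a : ℤ, v x = a := by
  obtain ⟨a, ha⟩ := WithTop.ne_top_iff_exists.1 (mt v.top_iff.1 hx)
  exact ⟨a, ha.symm⟩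

section Local

variable {K L : Type*} [Field K] [Field L] [Algebra K L] [FiniteDimensional K L]
  {v : AddValuation L (WithTop ℤ)} {π : L}

namespace IsTotallyRamified

variable (H : IsTotallyRamified K v π)
include H

theorem le_map_pow_sub_pow {g : L ≃ₐ[K] L} {i : ℤ} (hi : (i : WithTop ℤ) ≤ v (g π - π)) (j : ℕ) :
    ((i + j : ℤ) : WithTop ℤ) ≤ v (g (π ^ (j + 1)) - π ^ (j + 1)) := by
  induction j with
  | zero => simpa using hi
  | succ j ih =>
    have h : g (π ^ (j + 1 + 1)) - π ^ (j + 1 + 1)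
        = (g (π ^ (j + 1)) - π ^ (j + 1)) * g π + π ^ (j + 1) * (g π - π) := by
      simp only [_root_.map_pow]; ring
    rw [h]
    refine AddValuation.map_le_add v ?_ ?_
    · refine le_map_mono (le_of_eq ?_) (le_map_mul (b := 1) ih ?_)
      · push_cast; ring
      · rw [H.map_gal, H.map_uniformizer]; rfl
    · refine le_map_mono (le_of_eq ?_) (le_map_mul (a := ((j + 1 : ℕ) : ℤ)) (le_of_eq ?_) hi)
      · push_cast; ring
      · rw [H.map_pow]

theorem le_map_smul_sub {g : L ≃ₐ[K] L} {i m : ℤ} (hi : (i : WithTop ℤ) ≤ v (g π - π)) (c : K)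
    (j : ℕ) (hm : (m : WithTop ℤ) ≤ v (c • π ^ j)) :
    ((m + i - 1 : ℤ) : WithTop ℤ) ≤ v (g (c • π ^ j) - c • π ^ j) := by
  rw [map_smul, ← smul_sub]
  cases j with
  | zero => simp
  | succ j =>
    by_cases hc : c = 0
    · simp [hc]
    obtain ⟨a, ha⟩ := H.map_base c hc
    have h1 : ((finrank K L * a + ((j + 1 : ℕ) : ℤ) : ℤ) : WithTop ℤ) = v (c • π ^ (j + 1)) := by
      rw [Algebra.smul_def, AddValuation.map_mul, ha, H.map_pow]; rfl
    rw [← h1, WithTop.coe_le_coe] at hm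
    rw [Algebra.smul_def]
    refine le_map_mono ?_ (le_map_mul ha.ge (H.le_map_pow_sub_pow hi j))
    push_cast at hm
    linarith

theorem le_map_sub {g : L ≃ₐ[K] L} {i m : ℤ} (hi : (i : WithTop ℤ) ≤ v (g π - π)) {x : L}
    (hm : (m : WithTop ℤ) ≤ v x) : ((m + i - 1 : ℤ) : WithTop ℤ) ≤ v (g x - x) := by
  obtain ⟨c, hc, hle⟩ := H.exists_expansion x
  have : g x - x = ∑ j, (g (c j • π ^ (j : ℕ)) - c j • π ^ (j : ℕ)) := by
    conv_lhs => rw [hc]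
    rw [map_sum, Finset.sum_sub_distrib]
  rw [this]
  exact AddValuation.map_le_sum v fun j _ => H.le_map_smul_sub hi (c j) j (hm.trans (hle j))

theorem one_le_map_sub (g : L ≃ₐ[K] L) : ((1 : ℤ) : WithTop ℤ) ≤ v (g π - π) := by
  refine AddValuation.map_le_sub v ?_ ?_
  · rw [H.map_gal, H.map_uniformizer]; rfl
  · rw [H.map_uniformizer]; rfl

theorem eq_one_of_map_eq {g : L ≃ₐ[K] L} (h : g π = π) : g = 1 := by
  have : (g : L →ₐ[K] L) = AlgHom.id K L :=
    H.powerBasis.algHom_ext (by simpa [H.powerBasis_gen] using h)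
  ext x
  exact DFunLike.congr_fun this x

theorem exists_map_sub_eq {g : L ≃ₐ[K] L} (hg : g ≠ 1) : ∃ i : ℤ, v (g π - π) = i ∧ 1 ≤ i := by
  obtain ⟨i, hi⟩ := exists_map_eq_coe v (sub_ne_zero.2 (mt H.eq_one_of_map_eq hg))
  refine ⟨i, hi, ?_⟩
  have := H.one_le_map_sub g
  rwa [hi, WithTop.coe_le_coe] at this

theorem map_sub_le_map_pow_sub (g : L ≃ₐ[K] L) (a : ℕ) : v (g π - π) ≤ v ((g ^ a) π - π) := by
  induction a with
  | zero => simp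
  | succ a ih =>
    have : (g ^ (a + 1)) π - π = g ((g ^ a) π - π) + (g π - π) := by
      rw [pow_succ']; simp
    rw [this]
    exact AddValuation.map_le_add v (by rwa [H.map_gal]) le_rfl

theorem map_pow_sub_eq {g : L ≃ₐ[K] L} {a b : ℕ} (h : g ^ (a * b) = g) :
    v ((g ^ a) π - π) = v (g π - π) := by
  refine le_antisymm ?_ (H.map_sub_le_map_pow_sub g a)
  have := H.map_sub_le_map_pow_sub (g ^ a) b
  rwa [← pow_mul, h] at this

end IsTotallyRamified

end Local

end ZpTower

namespace ZpTower

open Module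

theorem exists_coe_sum {L ι : Type*} [Field L] (v : AddValuation L (WithTop ℤ))
    (s : Finset ι) (f : ι → L) (i : ι → ℤ) (h : ∀ j ∈ s, v (f j) = i j) :
    v (∏ j ∈ s, f j) = ((∑ j ∈ s, i j : ℤ) : WithTop ℤ) := by
  classical
  induction s using Finset.induction_on with
  | empty => simp
  | insert a s ha ih =>
    rw [Finset.prod_insert ha, Finset.sum_insert ha, AddValuation.map_mul,
      h a (Finset.mem_insert_self _ _), ih fun j hj => h j (Finset.mem_insert_of_mem hj),
      WithTop.coe_add]

open Polynomial in
theorem aeval_derivative_minpoly_eq_prod {K L : Type*} [Field K] [Field L] [Algebra K L]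
    [FiniteDimensional K L] [IsGalois K L] [DecidableEq (L ≃ₐ[K] L)] (x : L)
    (hx : ∀ g : L ≃ₐ[K] L, g x = x → g = 1) (hdeg : (minpoly K x).natDegree = finrank K L) :
    aeval x (derivative (minpoly K x)) =
      ∏ g ∈ (Finset.univ : Finset (L ≃ₐ[K] L)).erase 1, (x - g x) := by
  classical
  have hint : IsIntegral K x := Algebra.IsIntegral.isIntegral x
  have hinj : Function.Injective fun g : L ≃ₐ[K] L => g x := by
    intro g h hgh
    have : (h⁻¹ * g) x = x := by
      simp only at hgh
      rw [AlgEquiv.mul_apply, hgh]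
      exact h.symm_apply_apply x
    exact (inv_mul_eq_one.1 (hx _ this)).symm
  have hcard : ((Finset.univ : Finset (L ≃ₐ[K] L)).erase 1).card + 1 = finrank K L := by
    rw [Finset.card_erase_add_one (Finset.mem_univ _), Finset.card_univ, ← Nat.card_eq_fintype_card,
      IsGalois.card_aut_eq_finrank]
  have hprod : minpolyDiv K x =
      ∏ g ∈ (Finset.univ : Finset (L ≃ₐ[K] L)).erase 1, (X - C (g x)) := by
    refine Polynomial.eq_of_monic_of_dvd_of_natDegree_le (monic_prod_of_monic _ _ fun g _ =>
      monic_X_sub_C _) (minpolyDiv_monic hint) ?_ ?_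
    · refine Finset.prod_dvd_of_coprime ?_ ?_
      · exact fun g _ h _ hgh => pairwise_coprime_X_sub_C hinj hgh
      · intro g hg
        rw [dvd_iff_isRoot, IsRoot.def, eval_minpolyDiv_of_aeval_eq_zero, if_neg]
        · intro h
          exact (Finset.mem_erase.1 hg).1 (hx g h.symm)
        · rw [aeval_algHom_apply, minpoly.aeval, map_zero]
    · rw [natDegree_prod_of_monic _ _ fun g _ => monic_X_sub_C _]
      simp only [natDegree_X_sub_C, Finset.sum_const, smul_eq_mul, mul_one]
      have := natDegree_minpolyDiv_succ hint
      omega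
  rw [← eval_minpolyDiv_self, hprod, eval_prod]
  simp

open Polynomial in
/-- Euler's formula for the trace in terms of a power basis. -/
theorem trace_eq_coeff_powerBasis {K L : Type*} [Field K] [Field L] [Algebra K L]
    [FiniteDimensional K L] [Algebra.IsSeparable K L] (pb : PowerBasis K L) (w : L)
    (c : Fin pb.dim → K)
    (hc : w * aeval pb.gen (derivative (minpoly K pb.gen)) = ∑ j, c j • pb.gen ^ (j : ℕ))
    (j₀ : Fin pb.dim) (hj₀ : (j₀ : ℕ) + 1 = pb.dim) : Algebra.trace K L w = c j₀ := by
  set D := aeval pb.gen (derivative (minpoly K pb.gen)) with hD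
  have hD0 : D ≠ 0 := (Algebra.IsSeparable.isSeparable K pb.gen).aeval_derivative_ne_zero
    (minpoly.aeval K pb.gen)
  have hdual : pb.basis.traceDual j₀ = 1 / D := by
    rw [Module.Basis.traceDual_powerBasis_eq]
    congr 1
    have hm := minpolyDiv_monic (R := K) (x := pb.gen) pb.isIntegral_gen
    have hd := natDegree_minpolyDiv_succ (R := K) (x := pb.gen) pb.isIntegral_gen
    rw [pb.natDegree_minpoly] at hd
    rw [show (j₀ : ℕ) = (minpolyDiv K pb.gen).natDegree by omega]
    exact hm
  have hw : w = ∑ j, c j • (pb.basis.traceDual j₀ * pb.basis j) := by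
    have : w = (w * D) / D := by field_simp
    rw [this, hc, hdual, Finset.sum_div]
    refine Finset.sum_congr rfl fun j _ => ?_
    rw [PowerBasis.coe_basis, Algebra.smul_def, Algebra.smul_def]
    ring
  rw [hw, map_sum]
  simp only [LinearMap.map_smul, Module.Basis.trace_traceDual_mul, smul_eq_mul]
  simp

section Local

variable {K L : Type*} [Field K] [Field L] [Algebra K L] [FiniteDimensional K L] [IsGalois K L]
  {v : AddValuation L (WithTop ℤ)} {π : L}

namespace IsTotallyRamified

variable (H : IsTotallyRamified K v π)
include H

theorem natDegree_minpoly : (minpoly K π).natDegree = finrank K L := by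
  rw [← H.powerBasis_gen, H.powerBasis.natDegree_minpoly]
  rfl

/-- Valuation of the derivative of the minimal polynomial of a uniformizer. -/
theorem map_aeval_derivative [DecidableEq (L ≃ₐ[K] L)] (i : (L ≃ₐ[K] L) → ℤ)
    (hi : ∀ g ≠ 1, v (g π - π) = i g) :
    v (Polynomial.aeval π (Polynomial.derivative (minpoly K π)))
      = ((∑ g ∈ Finset.univ.erase 1, i g : ℤ) : WithTop ℤ) := by
  rw [aeval_derivative_minpoly_eq_prod π (fun g => H.eq_one_of_map_eq) H.natDegree_minpoly]
  refine exists_coe_sum v _ _ _ fun g hg => ?_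
  rw [← hi g (Finset.mem_erase.1 hg).1, AddValuation.map_sub_swap]

theorem trace_eq_coeff (w : L) (c : Fin (finrank K L) → K)
    (hc : w * Polynomial.aeval π (Polynomial.derivative (minpoly K π)) = ∑ j, c j • π ^ (j : ℕ))
    (j₀ : Fin (finrank K L)) (hj₀ : (j₀ : ℕ) + 1 = finrank K L) : Algebra.trace K L w = c j₀ :=
  trace_eq_coeff_powerBasis H.powerBasis w c hc j₀ hj₀

theorem map_trace [DecidableEq (L ≃ₐ[K] L)] (i : (L ≃ₐ[K] L) → ℤ)
    (hi : ∀ g ≠ 1, v (g π - π) = i g) {w : L} {m : ℤ} (hw : v w = m) :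
    ((m + ∑ g ∈ Finset.univ.erase 1, i g - (finrank K L - 1) : ℤ) : WithTop ℤ) ≤
      v (algebraMap K L (Algebra.trace K L w)) ∧
    ((finrank K L : ℤ) ∣ m + ∑ g ∈ Finset.univ.erase 1, i g - (finrank K L - 1) →
      v (algebraMap K L (Algebra.trace K L w)) =
        ((m + ∑ g ∈ Finset.univ.erase 1, i g - (finrank K L - 1) : ℤ) : WithTop ℤ)) := by
  have hpos : 0 < finrank K L := finrank_pos
  obtain ⟨c, hc, hle⟩ := H.exists_expansion
    (w * Polynomial.aeval π (Polynomial.derivative (minpoly K π)))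
  have hval : v (w * Polynomial.aeval π (Polynomial.derivative (minpoly K π)))
      = ((m + ∑ g ∈ Finset.univ.erase 1, i g : ℤ) : WithTop ℤ) := by
    rw [AddValuation.map_mul, hw, H.map_aeval_derivative i hi, WithTop.coe_add]
  set S := m + ∑ g ∈ Finset.univ.erase 1, i g with hS
  let j₀ : Fin (finrank K L) := ⟨finrank K L - 1, by omega⟩
  have hj₀ : (j₀ : ℕ) + 1 = finrank K L := by simp only [j₀]; omega
  have htr := H.trace_eq_coeff w c hc j₀ hj₀
  rw [htr]
  constructor
  · by_cases h0 : c j₀ = 0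
    · simp [h0]
    obtain ⟨a, ha⟩ := H.map_base _ h0
    have := hle j₀
    rw [hval, Algebra.smul_def, AddValuation.map_mul, ha, H.map_pow, ← WithTop.coe_add,
      WithTop.coe_le_coe] at this
    rw [ha, WithTop.coe_le_coe]
    have : ((j₀ : ℕ) : ℤ) + 1 = finrank K L := by exact_mod_cast hj₀
    lia
  · rintro ⟨q, hq⟩
    have hne : w * Polynomial.aeval π (Polynomial.derivative (minpoly K π)) ≠ 0 := by
      intro h
      rw [h, AddValuation.map_zero] at hval
      exact WithTop.top_ne_coe hval
    rw [hc] at hne hval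
    obtain ⟨j, hj, hvj⟩ := H.exists_map_eq c hne
    obtain ⟨a, ha⟩ := H.map_base _ hj
    rw [hval, Algebra.smul_def, AddValuation.map_mul, ha, H.map_pow, ← WithTop.coe_add,
      WithTop.coe_inj] at hvj
    have hj2 := j.2
    have hjj : j = j₀ := by
      apply Fin.ext
      have h1 : (finrank K L : ℤ) ∣ ((j : ℕ) : ℤ) + 1 := ⟨q + 1 - a, by
        rw [mul_sub, mul_add, ← hq]; lia⟩
      have h2 : finrank K L ∣ (j : ℕ) + 1 := by exact_mod_cast h1
      have := Nat.le_of_dvd (by omega) h2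
      omega
    rw [← hjj, ha, WithTop.coe_inj]
    have : ((j : ℕ) : ℤ) + 1 = finrank K L := by rw [hjj]; exact_mod_cast hj₀
    lia

end IsTotallyRamified

end Local

end ZpTower

namespace ZpTower

open Module

section Local

variable {K L : Type*} [Field K] [Field L] [Algebra K L] [FiniteDimensional K L] [IsGalois K L]
  {v : AddValuation L (WithTop ℤ)} {π : L}

namespace IsTotallyRamified

variable (H : IsTotallyRamified K v π)
include H

theorem exists_map_eq_and_map_sub_eq (σ : L ≃ₐ[K] L) (a : ℕ) {i : ℤ}
    (hi : v ((σ ^ a) π - π) = i) :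
    ∃ y : L, v (σ y - y) = ((a + i - 1 : ℤ) : WithTop ℤ) := by
  have hπ := H.ne_zero
  refine ⟨∏ j ∈ Finset.range a, (σ ^ j) π, ?_⟩
  set y := ∏ j ∈ Finset.range a, (σ ^ j) π with hy
  have hvy : v y = ((a : ℤ) : WithTop ℤ) := by
    rw [hy, exists_coe_sum v _ _ (fun _ => 1)]
    · simp
    · intro j _
      rw [H.map_gal, H.map_uniformizer]; rfl
  have h1 : σ y * π = y * (σ ^ a) π := by
    have : σ y = ∏ j ∈ Finset.range a, (σ ^ (j + 1)) π := by
      rw [hy, map_prod]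
      refine Finset.prod_congr rfl fun j _ => ?_
      rw [pow_succ']; rfl
    have h2 := Finset.prod_range_succ (fun j => (σ ^ j) π) a
    rw [Finset.prod_range_succ'] at h2
    rw [this, hy, ← h2]
    simp
  have h3 : (σ y - y) * π = y * ((σ ^ a) π - π) := by
    rw [sub_mul, h1]; ring
  have h4 := congrArg v h3
  rw [AddValuation.map_mul, AddValuation.map_mul, hvy, hi, H.map_uniformizer] at h4
  have h5 : σ y - y ≠ 0 := by
    intro h0
    rw [h0, AddValuation.map_zero, top_add, ← WithTop.coe_add] at h4
    exact WithTop.top_ne_coe h4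
  obtain ⟨b, hb⟩ := exists_map_eq_coe v h5
  rw [hb, show (1 : WithTop ℤ) = ((1 : ℤ) : WithTop ℤ) from rfl, ← WithTop.coe_add,
    ← WithTop.coe_add, WithTop.coe_inj] at h4
  rw [hb, WithTop.coe_inj]
  lia

/-- An element of the form `σ y - y` has trace zero, which restricts the possible residues
of ramification breaks. -/
theorem not_dvd_add_sum [DecidableEq (L ≃ₐ[K] L)] (i : (L ≃ₐ[K] L) → ℤ)
    (hi : ∀ g ≠ 1, v (g π - π) = i g) (σ : L ≃ₐ[K] L) (a : ℕ) (ha : σ ^ a ≠ 1) :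
    ¬ (finrank K L : ℤ) ∣ a + i (σ ^ a) - 1 + ∑ g ∈ Finset.univ.erase 1, i g
      - (finrank K L - 1) := by
  intro hdvd
  obtain ⟨y, hy⟩ := H.exists_map_eq_and_map_sub_eq σ a (hi _ ha)
  have h := (H.map_trace i hi hy).2 hdvd
  have htr : Algebra.trace K L (σ y - y) = 0 := by
    rw [map_sub, Algebra.trace_eq_of_algEquiv, sub_self]
  rw [htr, map_zero, AddValuation.map_zero] at h
  exact WithTop.top_ne_coe h

theorem sub_one_mul_le_of_prime [DecidableEq (L ≃ₐ[K] L)] {p : ℕ} (hp : p.Prime)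
    (hN : finrank K L = p) (t : ℤ) (ht : ∀ g : L ≃ₐ[K] L, g ≠ 1 → v (g π - π) = (t + 1 : ℤ))
    {e : ℤ} (he : v (p : L) = e) :
    (p - 1) * t ≤ e ∧ ((p : ℤ) ∣ t → (p - 1) * t = e) := by
  have hsum : ∑ g ∈ (Finset.univ : Finset (L ≃ₐ[K] L)).erase 1, (t + 1) = (p - 1) * (t + 1) := by
    have hcard : ((Finset.univ : Finset (L ≃ₐ[K] L)).erase 1).card + 1 = p := by
      rw [Finset.card_erase_add_one (Finset.mem_univ _), Finset.card_univ,
        ← Nat.card_eq_fintype_card, IsGalois.card_aut_eq_finrank, hN]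
    rw [Finset.sum_const, nsmul_eq_mul]
    congr 1
    rw [eq_sub_iff_add_eq]
    exact_mod_cast hcard
  have htr : algebraMap K L (Algebra.trace K L (1 : L)) = p := by
    rw [← map_one (algebraMap K L), Algebra.trace_algebraMap, hN]
    simp
  have h := H.map_trace (fun _ => t + 1) ht (w := 1) (m := 0) (by simp)
  rw [htr, he, hsum, hN, WithTop.coe_le_coe, WithTop.coe_inj] at h
  refine ⟨by linarith [h.1], fun ⟨q, hq⟩ => ?_⟩
  have := h.2 ⟨(p - 1) * q, by rw [hq]; ring⟩
  linarith

theorem le_map_pow_prime_sub {p : ℕ} (hp : p.Prime) (g : L ≃ₐ[K] L) {t : ℤ} (ht0 : 0 ≤ t)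
    (ht : v (g π - π) = (t + 1 : ℤ)) {e : ℤ} (he : v (p : L) = e) :
    ((min (1 + p * t) (e + 1 + t) : ℤ) : WithTop ℤ) ≤ v ((g ^ p) π - π) := by
  let T : Module.End K L := g.toLinearMap - 1
  have hT : ∀ x, T x = g x - x := fun x => rfl
  have hTj : ∀ j : ℕ, ((1 + j * t : ℤ) : WithTop ℤ) ≤ v ((T ^ j) π) := by
    intro j
    induction j with
    | zero => simp [H.map_uniformizer]
    | succ j ih =>
      rw [pow_succ', Module.End.mul_apply, hT]
      refine le_map_mono (le_of_eq ?_) (H.le_map_sub ht.ge ih)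
      push_cast; ring
  have hg : g.toLinearMap = T + 1 := by simp [T]
  have hgp : ∀ m : ℕ, (g ^ m).toLinearMap = (g.toLinearMap : Module.End K L) ^ m := by
    intro m
    induction m with
    | zero => rfl
    | succ m ih => rw [pow_succ, pow_succ, ← ih]; rfl
  have hexp : (g ^ p) π = ∑ j ∈ Finset.range (p + 1), (p.choose j : L) * (T ^ j) π := by
    have : (g ^ p) π = ((g ^ p).toLinearMap : Module.End K L) π := rfl
    rw [this, hgp, hg, (Commute.one_right T).add_pow]
    simp only [one_pow, mul_one, LinearMap.sum_apply]
    refine Finset.sum_congr rfl fun j _ => ?_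
    rw [(Nat.cast_commute _ _).eq.symm, Module.End.mul_apply]
    simp [Module.End.natCast_apply]
  have hsub : (g ^ p) π - π = ∑ j ∈ Finset.range p, (p.choose (j + 1) : L) * (T ^ (j + 1)) π := by
    rw [hexp, Finset.sum_range_succ']
    simp
  rw [hsub]
  have hZ : ∀ n : ℕ, ((0 : ℤ) : WithTop ℤ) ≤ v (n : L) := by
    intro n
    induction n with
    | zero => simp
    | succ n ih =>
      rw [Nat.cast_succ]
      exact AddValuation.map_le_add v ih (by simp)
  refine AddValuation.map_le_sum v fun j hj => ?_
  rw [Finset.mem_range] at hj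
  by_cases hjp : j + 1 = p
  · rw [hjp, Nat.choose_self, Nat.cast_one, one_mul]
    exact le_map_mono (min_le_left _ _) (hTj p)
  · obtain ⟨q, hq⟩ := hp.dvd_choose_self (Nat.succ_ne_zero j) (by omega)
    rw [hq, Nat.cast_mul]
    refine le_map_mono (min_le_right _ _)
      (le_map_mul (a := e + 0) (b := 1 + t) ?_ ?_ |> le_map_mono (by lia))
    · exact le_map_mul he.ge (hZ q)
    · refine le_map_mono ?_ (hTj (j + 1))
      push_cast
      nlinarith

end IsTotallyRamified

end Local

end ZpTower

namespace ZpTower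

theorem padicValNat_eq_of_dvd_of_not_dvd {p : ℕ} [Fact p.Prime] {a i : ℕ} (h : p ^ i ∣ a)
    (h' : ¬ p ^ (i + 1) ∣ a) : padicValNat p a = i := by
  have ha : a ≠ 0 := by rintro rfl; simp at h'
  rw [padicValNat_dvd_iff_le ha] at h h'
  omega

theorem padicValNat_lt_of_lt {p : ℕ} [Fact p.Prime] {a k : ℕ} (ha : a ≠ 0) (hak : a < p ^ k) :
    padicValNat p a < k := by
  by_contra h
  have := (padicValNat_dvd_iff_le (p := p) (n := k) ha).2 (not_lt.1 h)
  exact absurd (Nat.le_of_dvd (Nat.pos_of_ne_zero ha) this) (not_le.2 hak)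

theorem padicValNat_mul_add {p : ℕ} [Fact p.Prime] {x k m : ℕ} (hx : x ≠ 0) (hxk : x < p ^ k) :
    padicValNat p (p ^ k * m + x) = padicValNat p x := by
  have hlt := padicValNat_lt_of_lt hx hxk
  apply padicValNat_eq_of_dvd_of_not_dvd
  · exact dvd_add (Dvd.dvd.mul_right (pow_dvd_pow _ hlt.le) _) pow_padicValNat_dvd
  · rw [Nat.dvd_add_right (Dvd.dvd.mul_right (pow_dvd_pow _ hlt) _)]
    exact pow_succ_padicValNat_not_dvd hx

theorem padicValNat_pow_mul {p : ℕ} [hp : Fact p.Prime] {k m : ℕ} (hm : m ≠ 0) (hmp : m < p) :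
    padicValNat p (p ^ k * m) = k := by
  apply padicValNat_eq_of_dvd_of_not_dvd
  · exact dvd_mul_right _ _
  · rw [pow_succ, Nat.mul_dvd_mul_iff_left (pow_pos hp.out.pos _)]
    exact fun h => absurd (Nat.le_of_dvd (Nat.pos_of_ne_zero hm) h) (not_le.2 hmp)

section

variable {p : ℕ} [hp : Fact p.Prime] (t : ℕ → ℤ)

/-- Sum of `t (v_p b)` over `0 < b < N`. -/
def breakSum (p : ℕ) (t : ℕ → ℤ) (N : ℕ) : ℤ :=
  ∑ b ∈ Finset.range N, if b = 0 then 0 else t (padicValNat p b)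

theorem breakSum_mul (k m : ℕ) (hm : m + 1 ≤ p) :
    breakSum p t (p ^ k * (m + 1)) = (m + 1) * breakSum p t (p ^ k) + m * t k := by
  induction m with
  | zero => simp
  | succ m ih =>
    rw [mul_add, mul_one, breakSum, Finset.sum_range_add, ← breakSum, ih (by omega)]
    have hpk : 0 < p ^ k := pow_pos hp.out.pos _
    have : ∀ x ∈ Finset.range (p ^ k),
        (if p ^ k * (m + 1) + x = 0 then 0 else t (padicValNat p (p ^ k * (m + 1) + x)))
          = (if x = 0 then 0 else t (padicValNat p x)) + if x = 0 then t k else 0 := by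
      intro x hx
      rw [Finset.mem_range] at hx
      by_cases h0 : x = 0
      · rw [h0, if_neg (by positivity), add_zero,
          padicValNat_pow_mul (Nat.succ_ne_zero m) (by omega)]
        simp
      · rw [if_neg (by omega), padicValNat_mul_add h0 hx]
        simp [h0]
    rw [Finset.sum_congr rfl this, Finset.sum_add_distrib, ← breakSum, Finset.sum_ite_eq']
    rw [if_pos (Finset.mem_range.2 hpk)]
    push_cast
    ring

theorem dvd_sub_of_le {k i j : ℕ} (h : ∀ l, l + 1 < k → (p : ℤ) ^ (l + 1) ∣ t (l + 1) - t l)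
    (hij : i ≤ j) (hjk : j < k) : (p : ℤ) ^ (i + 1) ∣ t j - t i := by
  induction j, hij using Nat.le_induction with
  | base => simp
  | succ j hij ih =>
    have h1 := (pow_dvd_pow (p : ℤ) (show i + 1 ≤ j + 1 by omega)).trans (h j hjk)
    have := dvd_add h1 (ih (by omega))
    simpa using this

theorem dvd_of_dvd_add {k x i j : ℕ}
    (h : ∀ l, l + 1 < k → (p : ℤ) ^ (l + 1) ∣ t (l + 1) - t l) (hij : i ≤ j) (hjk : j < k)
    {y : ℤ} (hy : (p : ℤ) ^ (i + 1) ∣ y) (hxy : (p : ℤ) ^ k ∣ (x + t i) - (y + t j)) :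
    p ^ (i + 1) ∣ x := by
  have h1 := (pow_dvd_pow (p : ℤ) (show i + 1 ≤ k by omega)).trans hxy
  have h2 := dvd_sub_of_le t h hij hjk
  have h3 : (p : ℤ) ^ (i + 1) ∣ x := by
    have := dvd_add (dvd_add h1 h2) hy
    rwa [show (x + t i) - (y + t j) + (t j - t i) + y = (x : ℤ) by ring] at this
  exact_mod_cast h3

/-- The map `a ↦ a + t (v_p a)` on residues modulo `p ^ k`, with `v_p 0` read as `k - 1`. -/
def breakMap (p : ℕ) (t : ℕ → ℤ) (k a : ℕ) : ℤ :=
  a + if a = 0 then t (k - 1) else t (padicValNat p a)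

theorem breakMap_inj {k : ℕ}
    (h : ∀ l, l + 1 < k → (p : ℤ) ^ (l + 1) ∣ t (l + 1) - t l)
    {a b : ℕ} (ha : a < p ^ k) (hb : b < p ^ k)
    (hab : (p : ℤ) ^ k ∣ breakMap p t k a - breakMap p t k b) : a = b := by
  wlog hle : (if a = 0 then k else padicValNat p a) ≤ (if b = 0 then k else padicValNat p b)
    generalizing a b
  · refine (this hb ha ?_ (le_of_not_ge hle)).symm
    rw [← neg_sub]; exact (dvd_neg).2 hab
  by_cases ha0 : a = 0
  · rw [if_pos ha0] at hle
    by_cases hb0 : b = 0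
    · rw [ha0, hb0]
    · rw [if_neg hb0] at hle
      exact absurd (padicValNat_lt_of_lt hb0 hb) (not_lt.2 hle)
  rw [if_neg ha0] at hle
  have hak := padicValNat_lt_of_lt ha0 ha
  have hcontra : ¬ p ^ (padicValNat p a + 1) ∣ a := pow_succ_padicValNat_not_dvd ha0
  rw [breakMap, breakMap, if_neg ha0] at hab
  by_cases hb0 : b = 0
  · rw [if_pos hb0] at hab
    exact absurd (dvd_of_dvd_add t h (by omega) (by omega) (by simp [hb0]) hab) hcontra
  rw [if_neg hb0] at hab hle
  have hbk := padicValNat_lt_of_lt hb0 hb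
  rcases hle.lt_or_eq with hlt | heq
  · refine absurd (dvd_of_dvd_add t h hle hbk ?_ hab) hcontra
    have : p ^ (padicValNat p a + 1) ∣ b := (pow_dvd_pow p hlt).trans pow_padicValNat_dvd
    exact_mod_cast this
  · rw [heq] at hab
    have h1 : ((p ^ k : ℕ) : ℤ) ∣ (a : ℤ) - b := by
      push_cast
      rwa [add_sub_add_right_eq_sub] at hab
    have := (Nat.modEq_iff_dvd.2 h1).symm
    rwa [Nat.ModEq, Nat.mod_eq_of_lt ha, Nat.mod_eq_of_lt hb] at this

theorem breakMap_surj {k : ℕ}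
    (h : ∀ l, l + 1 < k → (p : ℤ) ^ (l + 1) ∣ t (l + 1) - t l) :
    Function.Bijective fun a : Fin (p ^ k) => ((breakMap p t k a : ℤ) : ZMod (p ^ k)) := by
  haveI : NeZero (p ^ k) := ⟨pow_ne_zero _ hp.out.ne_zero⟩
  rw [Fintype.bijective_iff_injective_and_card]
  refine ⟨fun a b hab => ?_, by simp [ZMod.card]⟩
  apply Fin.ext
  refine breakMap_inj t h a.2 b.2 ?_
  have := (ZMod.intCast_eq_intCast_iff_dvd_sub _ _ _).1 hab.symm
  exact_mod_cast this

theorem dvd_breakSum_add {k : ℕ}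
    (h : ∀ l, l + 1 < k → (p : ℤ) ^ (l + 1) ∣ t (l + 1) - t l) :
    (p : ℤ) ^ k ∣ breakSum p t (p ^ k) + t (k - 1) := by
  haveI : NeZero (p ^ k) := ⟨pow_ne_zero _ hp.out.ne_zero⟩
  have hpk : 0 < p ^ k := pow_pos hp.out.pos _
  have hid : Function.Bijective fun a : Fin (p ^ k) => ((a : ℕ) : ZMod (p ^ k)) := by
    rw [Fintype.bijective_iff_injective_and_card]
    refine ⟨fun a b hab => ?_, by simp [ZMod.card]⟩
    have := (ZMod.natCast_eq_natCast_iff' _ _ _).1 hab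
    rw [Nat.mod_eq_of_lt a.2, Nat.mod_eq_of_lt b.2] at this
    exact Fin.ext this
  have h1 := (breakMap_surj t h).sum_comp (fun x => x)
  have h2 := hid.sum_comp (fun x => x)
  rw [← h2] at h1
  have h3 : ((breakSum p t (p ^ k) + t (k - 1) : ℤ) : ZMod (p ^ k)) = 0 := by
    have : breakSum p t (p ^ k) + t (k - 1)
        = ∑ a : Fin (p ^ k), (breakMap p t k a - ((a : ℕ) : ℤ)) := by
      rw [Fin.sum_univ_eq_sum_range (fun a => breakMap p t k a - (a : ℤ)), breakSum]
      have : t (k - 1) = ∑ a ∈ Finset.range (p ^ k), if a = 0 then t (k - 1) else 0 := by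
        rw [Finset.sum_ite_eq', if_pos (Finset.mem_range.2 hpk)]
      rw [this, ← Finset.sum_add_distrib]
      refine Finset.sum_congr rfl fun a _ => ?_
      rw [breakMap]
      split_ifs <;> simp
    rw [this]
    push_cast
    rw [Finset.sum_sub_distrib, h1, sub_self]
  have := (ZMod.intCast_zmod_eq_zero_iff_dvd _ _).1 h3
  exact_mod_cast this

/-- The Hasse–Arf type congruence for the ramification breaks of a cyclic tower. -/
theorem pow_dvd_sub_of_not_dvd
    (hnd : ∀ m a : ℕ, a ≠ 0 → a < p ^ (m + 1) →
      ¬ (p : ℤ) ^ (m + 1) ∣ a + t (padicValNat p a) + breakSum p t (p ^ (m + 1))) (k : ℕ) :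
    (p : ℤ) ^ (k + 1) ∣ t (k + 1) - t k := by
  induction k using Nat.strong_induction_on with
  | _ k ih =>
  have hpk : 0 < p ^ (k + 1) := pow_pos hp.out.pos _
  haveI : NeZero (p ^ (k + 1)) := ⟨hpk.ne'⟩
  have h : ∀ l, l + 1 < k + 1 → (p : ℤ) ^ (l + 1) ∣ t (l + 1) - t l :=
    fun l hl => ih l (by omega)
  have h1 := dvd_breakSum_add t h
  rw [Nat.add_sub_cancel] at h1
  have h2 : (p : ℤ) ^ (k + 1) ∣ t k + breakSum p t (p ^ (k + 1 + 1)) := by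
    obtain ⟨a, ha⟩ := (breakMap_surj t h).2
      ((-breakSum p t (p ^ (k + 1 + 1)) : ℤ) : ZMod (p ^ (k + 1)))
    have ha := (ZMod.intCast_eq_intCast_iff_dvd_sub _ _ _).1 ha.symm
    rw [sub_neg_eq_add] at ha
    rw [breakMap] at ha
    by_cases ha0 : (a : ℕ) = 0
    · rw [if_pos ha0, ha0] at ha
      simpa using ha
    · rw [if_neg ha0] at ha
      obtain ⟨q, hq⟩ := ha
      exfalso
      set c := ((-q) % p).toNat with hc
      have hp0 : (0 : ℤ) < p := by exact_mod_cast hp.out.pos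
      have hc' : (c : ℤ) = (-q) % p := Int.toNat_of_nonneg (Int.emod_nonneg _ hp0.ne')
      have hcp : c < p := by
        have := Int.emod_lt_of_pos (-q) hp0
        rw [← hc'] at this
        exact_mod_cast this
      have ha2 : (a : ℕ) < p ^ (k + 1) := a.2
      refine hnd (k + 1) (p ^ (k + 1) * c + a) (by omega) ?_ ?_
      · calc p ^ (k + 1) * c + a < p ^ (k + 1) * c + p ^ (k + 1) := by omega
          _ = p ^ (k + 1) * (c + 1) := by ring
          _ ≤ p ^ (k + 1) * p := Nat.mul_le_mul_left _ hcp
          _ = p ^ (k + 1 + 1) := by ring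
      · rw [padicValNat_mul_add ha0 a.2]
        have h5 : (p : ℤ) ∣ c + q := by
          rw [hc', Int.dvd_iff_emod_eq_zero, Int.emod_add_emod]
          simp
        obtain ⟨r, hr⟩ := h5
        refine ⟨r, ?_⟩
        push_cast at hq ⊢
        rw [pow_succ (p : ℤ) (k + 1), mul_assoc, ← hr, mul_add, ← hq]
        ring
  have h3 := breakSum_mul (p := p) t (k + 1) (p - 1) (by have := hp.out.pos; omega)
  have hp1 : ((p - 1 : ℕ) : ℤ) = p - 1 := by
    rw [Nat.cast_sub hp.out.one_lt.le]; simp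
  rw [Nat.sub_add_cancel hp.out.one_lt.le, ← pow_succ, hp1] at h3
  have h4 : (p : ℤ) ^ (k + 1) ∣ ((p : ℤ) - 1) * (t (k + 1) - t k) := by
    have := dvd_sub h2 (h1.mul_left (p : ℤ))
    rw [h3] at this
    refine this.trans (dvd_of_eq ?_)
    ring
  refine IsCoprime.dvd_of_dvd_mul_left (IsCoprime.pow_left ?_) h4
  exact ⟨1, -1, by ring⟩

end

end ZpTower

namespace ZpTower

theorem exists_eventually_eq_of_tendsto_intCast {w : ℕ → ℤ} {l : ℝ}
    (h : Filter.Tendsto (fun k => (w k : ℝ)) Filter.atTop (nhds l)) :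
    ∃ K, ∀ k ≥ K, w k = w K ∧ (w K : ℝ) = l := by
  obtain ⟨K, hK⟩ := Metric.tendsto_atTop.1 h (1 / 2) (by norm_num)
  have hconst : ∀ k ≥ K, w k = w K := by
    intro k hk
    have h1 := hK k hk
    have h2 := hK K le_rfl
    rw [Real.dist_eq] at h1 h2
    have h3 : |((w k - w K : ℤ) : ℝ)| < 1 := by
      push_cast
      calc |(w k : ℝ) - w K| = |((w k : ℝ) - l) - (w K - l)| := by ring_nf
        _ ≤ |(w k : ℝ) - l| + |w K - l| := abs_sub _ _
        _ < 1 := by linarith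
    have h4 : |w k - w K| < 1 := by exact_mod_cast h3
    have := Int.abs_lt_one_iff.1 h4
    omega
  have hl : (w K : ℝ) = l := by
    refine tendsto_nhds_unique (tendsto_const_nhds.congr' ?_) h
    filter_upwards [Filter.eventually_ge_atTop K] with k hk
    rw [hconst k hk]
  exact ⟨K, fun k hk => ⟨hconst k hk, hl⟩⟩

theorem exists_eventually_eq_linear {p : ℕ} (hp : 2 ≤ p) (t : ℕ → ℤ)
    (hdvd : ∀ k, (p : ℤ) ^ (k + 1) ∣ t (k + 1) - t k) (hmul : ∀ k, p * t k ≤ t (k + 1))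
    (h0 : 1 ≤ t 0) {C : ℚ} (hC : ∀ k, (t k : ℚ) ≤ C * (p : ℚ) ^ k) :
    ∃ A B : ℚ, 0 < A ∧ ∃ N, ∀ k ≥ N, (t k : ℚ) = A * (p : ℚ) ^ k + B := by
  choose w hw using hdvd
  have hp0 : (0 : ℝ) < p := by positivity
  have hp1 : (1 : ℝ) < p := by exact_mod_cast hp
  set x : ℕ → ℝ := fun k => t k / (p : ℝ) ^ k with hx
  have hmono : Monotone x := by
    refine monotone_nat_of_le_succ fun k => ?_
    simp only [hx]
    rw [div_le_div_iff₀ (by positivity) (by positivity), pow_succ]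
    have : ((p : ℝ) * t k) ≤ t (k + 1) := by exact_mod_cast hmul k
    calc (t k : ℝ) * ((p : ℝ) ^ k * p) = (p * t k) * (p : ℝ) ^ k := by ring
      _ ≤ t (k + 1) * (p : ℝ) ^ k := by gcongr
  have hbdd : BddAbove (Set.range x) := by
    refine ⟨C, ?_⟩
    rintro _ ⟨k, rfl⟩
    simp only [hx]
    rw [div_le_iff₀ (by positivity)]
    exact_mod_cast hC k
  have hlim := tendsto_atTop_ciSup hmono hbdd
  set X := ⨆ k, x k with hX
  have hX0 : 0 < X := by
    have : x 0 ≤ X := le_ciSup hbdd 0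
    have h1 : (1 : ℝ) ≤ t 0 := by exact_mod_cast h0
    simp only [hx, pow_zero, div_one] at this
    linarith
  have hwx : ∀ k, (w k : ℝ) = x (k + 1) - x k / p := by
    intro k
    have : (t (k + 1) : ℝ) - t k = (p : ℝ) ^ (k + 1) * w k := by exact_mod_cast hw k
    simp only [hx]
    have h2 : (p : ℝ) ^ k ≠ 0 := by positivity
    rw [pow_succ] at this ⊢
    field_simp
    linarith
  have hwlim : Filter.Tendsto (fun k => (w k : ℝ)) Filter.atTop (nhds (X - X / p)) := by
    simp only [hwx]
    exact ((Filter.tendsto_add_atTop_iff_nat 1).2 hlim).sub (hlim.div_const _)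
  obtain ⟨N, hN⟩ := exists_eventually_eq_of_tendsto_intCast hwlim
  have hwpos : 0 < w N := by
    have : (0 : ℝ) < w N := by
      rw [(hN N le_rfl).2, sub_pos]
      exact div_lt_self hX0 hp1
    exact_mod_cast this
  have hpq : (p : ℚ) - 1 ≠ 0 := by
    have : (1 : ℚ) < p := by exact_mod_cast hp
    linarith
  have hpq' : (0 : ℚ) < (p : ℚ) - 1 := by
    have : (1 : ℚ) < p := by exact_mod_cast hp
    linarith
  refine ⟨w N * p / (p - 1), t N - w N * (p : ℚ) ^ (N + 1) / (p - 1), ?_, N, fun k hk => ?_⟩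
  · have : (0 : ℚ) < w N := by exact_mod_cast hwpos
    positivity
  · induction k, hk using Nat.le_induction with
    | base => field_simp; ring
    | succ k hk ih =>
      have : (t (k + 1) : ℚ) - t k = (p : ℚ) ^ (k + 1) * w k := by exact_mod_cast hw k
      rw [(hN k hk).1] at this
      rw [← sub_add_cancel (t (k + 1) : ℚ) (t k), this, ih]
      field_simp
      ring

theorem exists_eventually_eq_of_recursion {p : ℕ} (hp : 2 ≤ p) (u : ℕ → ℚ) {A B : ℚ} (hA : 0 < A)
    {N : ℕ} (h : ∀ n ≥ N, u (n + 1) = p * u n + A * (p : ℚ) ^ n + B) :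
    ∃ a b c : ℚ, 0 < a ∧ ∃ N : ℕ, ∀ n ≥ N,
      u n = a * n * (p : ℚ) ^ n + b * (p : ℚ) ^ n + c := by
  have hp1 : (1 : ℚ) < p := by exact_mod_cast hp
  have hp0 : (0 : ℚ) < p := by linarith
  have hp2 : (p : ℚ) - 1 ≠ 0 := by linarith
  refine ⟨A / p, (u N + B / (p - 1)) / (p : ℚ) ^ N - A / p * N, -B / (p - 1), by positivity, N,
    fun n hn => ?_⟩
  induction n, hn using Nat.le_induction with
  | base => field_simp; ring
  | succ n hn ih =>
    rw [h n hn, ih]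
    push_cast
    field_simp
    ring

end ZpTower

namespace ZpTower

open Module

section AddVal

open IsDedekindDomain WithZero

variable {R : Type*} [CommRing R] [IsDedekindDomain R] (Q : HeightOneSpectrum R)
  (L : Type*) [Field L] [Algebra R L] [IsFractionRing R L]

open Classical in
/-- The additive form of the valuation attached to a nonzero prime of a Dedekind domain. -/
noncomputable def addVal : AddValuation L (WithTop ℤ) :=
  AddValuation.of (fun x => if x = 0 then ⊤ else ((-log (Q.valuation L x) : ℤ) : WithTop ℤ))
    (by simp) (by simp)
    (fun x y => by
      by_cases hx : x = 0
      · simp [hx]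
      by_cases hy : y = 0
      · simp [hy]
      by_cases hxy : x + y = 0
      · simp [hxy]
      have hx' : Q.valuation L x ≠ 0 := by simpa using hx
      have hy' : Q.valuation L y ≠ 0 := by simpa using hy
      have hxy' : Q.valuation L (x + y) ≠ 0 := by simpa using hxy
      simp only [hx, hy, hxy, if_false]
      rw [← WithTop.coe_min, WithTop.coe_le_coe, min_le_iff, neg_le_neg_iff, neg_le_neg_iff,
        log_le_log hxy' hx', log_le_log hxy' hy', ← le_max_iff]
      exact Valuation.map_add _ _ _)
    (fun x y => by
      by_cases hx : x = 0
      · simp [hx]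
      by_cases hy : y = 0
      · simp [hy]
      have hx' : Q.valuation L x ≠ 0 := by simpa using hx
      have hy' : Q.valuation L y ≠ 0 := by simpa using hy
      simp only [hx, hy, mul_eq_zero, or_self, if_false]
      rw [map_mul, log_mul hx' hy', neg_add, WithTop.coe_add])

variable {L}

theorem addVal_eq_coe_iff {x : L} {n : ℤ} :
    addVal Q L x = n ↔ Q.valuation L x = exp (-n) := by
  classical
  change (if x = 0 then ⊤ else ((-log (Q.valuation L x) : ℤ) : WithTop ℤ)) = n ↔ _
  by_cases hx : x = 0
  · simpa [hx] using (exp_ne_zero (a := n)).symm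
  have hx' : Q.valuation L x ≠ 0 := by simpa using hx
  rw [if_neg hx, WithTop.coe_inj]
  constructor
  · intro h
    rw [← h, neg_neg, exp_log hx']
  · intro h
    rw [h, log_exp, neg_neg]

theorem exists_addVal_eq {x : L} (hx : x ≠ 0) : ∃ n : ℤ, addVal Q L x = n :=
  exists_map_eq_coe _ hx

theorem le_addVal_iff {x : L} {n : ℤ} :
    (n : WithTop ℤ) ≤ addVal Q L x ↔ Q.valuation L x ≤ exp (-n) := by
  by_cases hx : x = 0
  · simp [hx]
  obtain ⟨m, hm⟩ := exists_addVal_eq Q hx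
  rw [hm, (addVal_eq_coe_iff Q).1 hm, exp_le_exp, neg_le_neg_iff, WithTop.coe_le_coe]

theorem le_addVal_algebraMap_iff {r : R} {n : ℕ} :
    ((n : ℤ) : WithTop ℤ) ≤ addVal Q L (algebraMap R L r) ↔ r ∈ Q.asIdeal ^ n := by
  rw [le_addVal_iff, HeightOneSpectrum.valuation_of_algebraMap, Q.intValuation_le_pow_iff_mem]

theorem addVal_algebraMap_nonneg (r : R) : 0 ≤ addVal Q L (algebraMap R L r) := by
  have := (le_addVal_algebraMap_iff Q (L := L) (r := r) (n := 0)).2 (by simp)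
  simpa using this

theorem addVal_algebraMap_eq_iff {r : R} {n : ℕ} :
    addVal Q L (algebraMap R L r) = ((n : ℤ) : WithTop ℤ) ↔
      emultiplicity Q.asIdeal (Ideal.span {r}) = n := by
  rw [addVal_eq_coe_iff, HeightOneSpectrum.valuation_of_algebraMap, le_antisymm_iff,
    Q.intValuation_le_exp_iff_le_emultiplicity, Q.exp_le_intValuation_iff_emultiplicity_le,
    and_comm, ← le_antisymm_iff]

theorem addVal_algebraMap_eq_zero_iff {r : R} :
    addVal Q L (algebraMap R L r) = 0 ↔ r ∉ Q.asIdeal := by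
  have := addVal_eq_coe_iff Q (L := L) (x := algebraMap R L r) (n := 0)
  simp only [WithTop.coe_zero, neg_zero, exp_zero] at this
  rw [this, HeightOneSpectrum.valuation_of_algebraMap, Q.intValuation_eq_one_iff_mem_primeCompl]
  rfl

theorem exists_addVal_algebraMap_eq_one : ∃ π : R, addVal Q L (algebraMap R L π) = 1 := by
  obtain ⟨π, hπ⟩ := Q.intValuation_exists_uniformizer
  exact ⟨π, (addVal_eq_coe_iff Q (n := 1)).2
    (by rw [HeightOneSpectrum.valuation_of_algebraMap, hπ])⟩

end AddVal

end ZpTower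

namespace ZpTower

open Module

section TotallyRamified

open IsDedekindDomain NumberField
open scoped Pointwise

variable {K L : Type*} [Field K] [Field L] [NumberField K] [NumberField L] [Algebra K L]

/-- A prime of `𝓞 L` whose ramification index over `𝓞 K` is `[L : K]`. -/
def IsTotRam (K : Type*) {L : Type*} [Field K] [Field L] [Algebra K L]
    (Q : HeightOneSpectrum (𝓞 L)) : Prop :=
  Q.asIdeal.ramificationIdx (𝓞 K) = finrank K L

theorem addVal_liesOver (P : HeightOneSpectrum (𝓞 K)) (Q : HeightOneSpectrum (𝓞 L))
    [Q.asIdeal.LiesOver P.asIdeal] {c : K} {m : ℤ} (h : addVal P K c = m) :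
    addVal Q L (algebraMap K L c) = ((Q.asIdeal.ramificationIdx (𝓞 K) * m : ℤ) : WithTop ℤ) := by
  rw [addVal_eq_coe_iff] at h ⊢
  rw [← HeightOneSpectrum.valuation_liesOver L P Q, h,
    Ideal.ramificationIdx'_eq_ramificationIdx _ _ P.ne_bot, ← WithZero.exp_nsmul, nsmul_eq_mul]
  congr 1
  simp

theorem IsTotRam.ncard_primesOver [IsGalois K L] {Q : HeightOneSpectrum (𝓞 L)}
    (h : IsTotRam K Q) (P : HeightOneSpectrum (𝓞 K)) [Q.asIdeal.LiesOver P.asIdeal] :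
    (P.asIdeal.primesOver (𝓞 L)).ncard = 1 ∧ P.asIdeal.inertiaDegIn (𝓞 L) = 1 := by
  have h1 := Ideal.ncard_primesOver_mul_ramificationIdxIn_mul_inertiaDegIn P.asIdeal (𝓞 L)
    Gal(L/K)
  rw [Ideal.ramificationIdxIn_eq_ramificationIdx P.asIdeal Q.asIdeal Gal(L/K), h,
    IsGaloisGroup.card_eq_finrank Gal(L/K) K L] at h1
  have h2 : (P.asIdeal.primesOver (𝓞 L)).ncard * P.asIdeal.inertiaDegIn (𝓞 L) = 1 := by
    have h3 : 0 < finrank K L := finrank_pos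
    refine Nat.eq_of_mul_eq_mul_left h3 ?_
    rw [mul_one]
    conv_rhs => rw [← h1]
    ring
  exact ⟨Nat.eq_one_of_mul_eq_one_right h2, Nat.eq_one_of_mul_eq_one_left h2⟩

theorem IsTotRam.eq_of_liesOver [IsGalois K L] {Q : HeightOneSpectrum (𝓞 L)}
    (h : IsTotRam K Q) (P : HeightOneSpectrum (𝓞 K)) [Q.asIdeal.LiesOver P.asIdeal]
    (I : Ideal (𝓞 L)) [I.IsPrime] [I.LiesOver P.asIdeal] : I = Q.asIdeal := by
  obtain ⟨J, hJ⟩ := Set.ncard_eq_one.1 (h.ncard_primesOver P).1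
  have h1 : I ∈ P.asIdeal.primesOver (𝓞 L) := ⟨inferInstance, inferInstance⟩
  have h2 : Q.asIdeal ∈ P.asIdeal.primesOver (𝓞 L) := ⟨inferInstance, inferInstance⟩
  rw [hJ, Set.mem_singleton_iff] at h1 h2
  rw [h1, h2]

theorem IsTotRam.smul_eq [IsGalois K L] {Q : HeightOneSpectrum (𝓞 L)} (h : IsTotRam K Q)
    (g : Gal(L/K)) : g • Q.asIdeal = Q.asIdeal := by
  have : Q.asIdeal.LiesOver (HeightOneSpectrum.under (𝓞 K) Q).asIdeal := ⟨rfl⟩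
  exact h.eq_of_liesOver (HeightOneSpectrum.under (𝓞 K) Q) (g • Q.asIdeal)

theorem IsTotRam.addVal_gal [IsGalois K L] {Q : HeightOneSpectrum (𝓞 L)} (h : IsTotRam K Q)
    (g : Gal(L/K)) (x : L) : addVal Q L (g x) = addVal Q L x := by
  have key : ∀ r : 𝓞 L, addVal Q L (g (algebraMap (𝓞 L) L r)) =
      addVal Q L (algebraMap (𝓞 L) L r) := by
    intro r
    by_cases hr : r = 0
    · simp [hr]
    have key2 : ∀ n : ℕ, ((n : ℤ) : WithTop ℤ) ≤ addVal Q L (g (algebraMap (𝓞 L) L r)) ↔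
        ((n : ℤ) : WithTop ℤ) ≤ addVal Q L (algebraMap (𝓞 L) L r) := by
      intro n
      change _ ≤ addVal Q L (algebraMap (𝓞 L) L (g • r)) ↔ _
      rw [le_addVal_algebraMap_iff, le_addVal_algebraMap_iff]
      conv_lhs => rw [← h.smul_eq g]
      rw [← Ideal.smul_mem_pointwise_smul_iff (a := g) (S := Q.asIdeal ^ n),
        Ideal.pointwise_smul_def, Ideal.pointwise_smul_def, Ideal.map_pow]
    have hr1 : algebraMap (𝓞 L) L r ≠ 0 := by simpa using hr
    have hr2 : g (algebraMap (𝓞 L) L r) ≠ 0 := by simpa using hr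
    obtain ⟨a, ha⟩ := exists_addVal_eq Q hr1
    obtain ⟨b, hb⟩ := exists_addVal_eq Q hr2
    have ha0 := addVal_algebraMap_nonneg Q (L := L) r
    have hb0 := addVal_algebraMap_nonneg Q (L := L) (g • r)
    change 0 ≤ addVal Q L (g (algebraMap (𝓞 L) L r)) at hb0
    rw [ha, WithTop.coe_nonneg] at ha0
    rw [hb, WithTop.coe_nonneg] at hb0
    lift a to ℕ using ha0
    lift b to ℕ using hb0
    rw [ha, hb] at key2 ⊢
    simp only [WithTop.coe_le_coe, Nat.cast_le] at key2
    have := (key2 a).2 le_rfl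
    have := (key2 b).1 le_rfl
    rw [le_antisymm ‹b ≤ a› ‹a ≤ b›]
  obtain ⟨a, b, hb, rfl⟩ := IsFractionRing.div_surjective (A := 𝓞 L) x
  rw [map_div₀, AddValuation.map_div, AddValuation.map_div, key, key]

theorem IsTotRam.isTotallyRamified [IsGalois K L] {Q : HeightOneSpectrum (𝓞 L)}
    (h : IsTotRam K Q) {π : L} (hπ : addVal Q L π = 1) :
    IsTotallyRamified K (addVal Q L) π where
  map_uniformizer := hπ
  map_gal := h.addVal_gal
  map_base c hc := by
    have : Q.asIdeal.LiesOver (HeightOneSpectrum.under (𝓞 K) Q).asIdeal := ⟨rfl⟩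
    obtain ⟨m, hm⟩ := exists_addVal_eq (HeightOneSpectrum.under (𝓞 K) Q) hc
    exact ⟨m, by rw [addVal_liesOver _ Q hm, h]⟩

end TotallyRamified

end ZpTower

namespace ZpTower

open Module

section Different

open IsDedekindDomain NumberField
open scoped Pointwise

variable {K L : Type*} [Field K] [Field L] [NumberField K] [NumberField L] [Algebra K L]
  [IsGalois K L] {Q : HeightOneSpectrum (𝓞 L)}

/-- Coefficients of an integral element with respect to powers of a uniformizer are integral
at the prime. -/
theorem IsTotRam.exists_smul_mem_adjoin (h : IsTotRam K Q) (P : HeightOneSpectrum (𝓞 K))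
    [Q.asIdeal.LiesOver P.asIdeal] {π : 𝓞 L} (hπ : addVal Q L (algebraMap (𝓞 L) L π) = 1)
    (x : 𝓞 L) : ∃ s : 𝓞 K, s ∉ P.asIdeal ∧ s • x ∈ Algebra.adjoin (𝓞 K) {π} := by
  obtain ⟨c, hc, hv⟩ := (h.isTotallyRamified hπ).exists_expansion (algebraMap (𝓞 L) L x)
  have hint : ∀ j, P.valuation K (c j) ≤ 1 := by
    intro j
    by_cases h0 : c j = 0
    · simp [h0]
    obtain ⟨m, hm⟩ := exists_addVal_eq P h0
    have h1 := addVal_liesOver P Q hm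
    rw [h] at h1
    have h2 := (addVal_algebraMap_nonneg Q (L := L) x).trans (hv j)
    rw [Algebra.smul_def, AddValuation.map_mul, h1, (h.isTotallyRamified hπ).map_pow,
      ← WithTop.coe_add, WithTop.coe_nonneg] at h2
    have h3 : 0 ≤ m := by
      by_contra! hneg
      have h4 : (finrank K L : ℤ) * m ≤ (finrank K L : ℤ) * (-1) :=
        mul_le_mul_of_nonneg_left (by omega) (by positivity)
      have := j.2
      omega
    have h5 := (le_addVal_iff P (n := 0) (x := c j)).1 (by rw [hm]; exact_mod_cast h3)
    simpa using h5
  choose n d hd using fun j => P.exists_primeCompl_mul_eq_of_integer (c j) (hint j)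
  refine ⟨∏ j, (d j : 𝓞 K), ?_, ?_⟩
  · rw [Ideal.IsPrime.prod_mem_iff]
    rintro ⟨j, -, hj⟩
    exact (d j).2 hj
  have hdvd : ∀ j, ∃ e : 𝓞 K, ∏ j, (d j : 𝓞 K) = d j * e := fun j =>
    Finset.dvd_prod_of_mem (fun j => (d j : 𝓞 K)) (Finset.mem_univ j)
  choose e he using hdvd
  have : (∏ j, (d j : 𝓞 K)) • x = ∑ j, (e j * n j) • π ^ (j : ℕ) := by
    apply FaithfulSMul.algebraMap_injective (𝓞 L) L
    rw [Algebra.smul_def, map_mul, hc, map_sum, Finset.mul_sum]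
    refine Finset.sum_congr rfl fun j _ => ?_
    have hd' : algebraMap (𝓞 L) L (algebraMap (𝓞 K) (𝓞 L) (n j)) =
        algebraMap K L (c j) * algebraMap (𝓞 L) L (algebraMap (𝓞 K) (𝓞 L) (d j)) := by
      rw [← IsScalarTower.algebraMap_apply (𝓞 K) (𝓞 L) L,
        ← IsScalarTower.algebraMap_apply (𝓞 K) (𝓞 L) L, IsScalarTower.algebraMap_apply (𝓞 K) K L,
        IsScalarTower.algebraMap_apply (𝓞 K) K L, ← hd j, map_mul]
    rw [he j, Algebra.smul_def, Algebra.smul_def]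
    simp only [map_mul, map_pow, hd']
    ring
  rw [this]
  refine Subalgebra.sum_mem _ fun j _ => Subalgebra.smul_mem _ (Subalgebra.pow_mem _ ?_ _) _
  exact Algebra.subset_adjoin rfl

theorem IsTotRam.conductor_not_le (h : IsTotRam K Q) {π : 𝓞 L}
    (hπ : addVal Q L (algebraMap (𝓞 L) L π) = 1) : ¬ conductor (𝓞 K) π ≤ Q.asIdeal := by
  classical
  let P := HeightOneSpectrum.under (𝓞 K) Q
  have hP : Q.asIdeal.LiesOver P.asIdeal := ⟨rfl⟩
  obtain ⟨S, hS⟩ := (Module.Finite.fg_top : (⊤ : Submodule (𝓞 K) (𝓞 L)).FG)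
  choose s hs hs' using h.exists_smul_mem_adjoin P hπ
  intro hle
  have hmem : algebraMap (𝓞 K) (𝓞 L) (∏ y ∈ S, s y) ∈ conductor (𝓞 K) π := by
    rw [mem_conductor_iff]
    intro b
    rw [← Algebra.smul_def]
    have hb : b ∈ Submodule.span (𝓞 K) (S : Set (𝓞 L)) := by rw [hS]; trivial
    induction hb using Submodule.span_induction with
    | mem y hy =>
      obtain ⟨e, he⟩ := Finset.dvd_prod_of_mem s (Finset.mem_coe.1 hy)
      rw [he, mul_comm, mul_smul]
      exact Subalgebra.smul_mem _ (hs' y) _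
    | zero => simp
    | add x y _ _ hx hy => rw [smul_add]; exact Subalgebra.add_mem _ hx hy
    | smul a x _ hx => rw [smul_comm]; exact Subalgebra.smul_mem _ hx _
  have h1 : ∏ y ∈ S, s y ∈ P.asIdeal := hle hmem
  rw [Ideal.IsPrime.prod_mem_iff] at h1
  obtain ⟨y, -, hy⟩ := h1
  exact hs y hy

theorem IsTotRam.emultiplicity_differentIdeal (h : IsTotRam K Q) {π : 𝓞 L}
    (hπ : addVal Q L (algebraMap (𝓞 L) L π) = 1) [DecidableEq Gal(L/K)] (i : Gal(L/K) → ℤ)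
    (hi : ∀ g : Gal(L/K), g ≠ 1 →
      addVal Q L (g (algebraMap (𝓞 L) L π) - algebraMap (𝓞 L) L π) = i g) :
    ∃ D : ℕ, emultiplicity Q.asIdeal (differentIdeal (𝓞 K) (𝓞 L)) = D ∧
      (D : ℤ) = ∑ g ∈ Finset.univ.erase 1, i g := by
  have H := h.isTotallyRamified hπ
  have h1 := H.map_aeval_derivative i hi
  rw [minpoly.isIntegrallyClosed_eq_field_fractions K L (Algebra.IsIntegral.isIntegral (R := 𝓞 K) π),
    Polynomial.derivative_map, Polynomial.aeval_map_algebraMap, Polynomial.aeval_algebraMap_apply]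
    at h1
  have h2 := addVal_algebraMap_nonneg Q (L := L)
    (Polynomial.aeval π (Polynomial.derivative (minpoly (𝓞 K) π)))
  rw [h1, WithTop.coe_nonneg] at h2
  obtain ⟨D, hD⟩ := Int.eq_ofNat_of_zero_le h2
  refine ⟨D, ?_, hD.symm⟩
  rw [hD, addVal_algebraMap_eq_iff, ← conductor_mul_differentIdeal (𝓞 K) K L π, 
    emultiplicity_mul Q.prime, emultiplicity_eq_zero.2, zero_add] at h1
  · exact h1
  · rw [Ideal.dvd_iff_le]
    exact h.conductor_not_le hπ
  · have := H.powerBasis.adjoin_gen_eq_top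
    rwa [H.powerBasis_gen] at this

end Different

end ZpTower

namespace ZpTower

open Module

section Cyclic

variable {K F L : Type*} [Field K] [Field F] [Field L] [Algebra K F] [Algebra F L] [Algebra K L]
  [IsScalarTower K F L] [FiniteDimensional K L] [IsGalois K L]

/-- In a cyclic extension the automorphisms over an intermediate field are those killed by its
codegree. -/
theorem range_restrictScalarsHom [IsCyclic Gal(L/K)] (x : Gal(L/K)) :
    (∃ g : Gal(L/F), AlgEquiv.restrictScalars K g = x) ↔ x ^ finrank F L = 1 := by
  classical
  have : FiniteDimensional F L := FiniteDimensional.right K F L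
  have : IsGalois F L := IsGalois.tower_top_of_isGalois K F L
  have hpos : 0 < finrank F L := finrank_pos
  have hcard : (Finset.univ.image (AlgEquiv.restrictScalars K : Gal(L/F) → Gal(L/K))).card =
      finrank F L := by
    rw [Finset.card_image_of_injective _ (AlgEquiv.restrictScalars_injective K), Finset.card_univ,
      ← Nat.card_eq_fintype_card, IsGalois.card_aut_eq_finrank]
  have hsub : Finset.univ.image (AlgEquiv.restrictScalars K : Gal(L/F) → Gal(L/K)) ⊆
      Finset.univ.filter fun x => x ^ finrank F L = 1 := by
    intro y hy
    obtain ⟨g, -, rfl⟩ := Finset.mem_image.1 hy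
    simp only [Finset.mem_filter, Finset.mem_univ, true_and]
    rw [← AlgEquiv.restrictScalarsHom_apply, ← map_pow, ← IsGalois.card_aut_eq_finrank F L,
      pow_card_eq_one', map_one]
  have heq := Finset.eq_of_subset_of_card_le hsub
    (by rw [hcard]; exact IsCyclic.card_pow_eq_one_le hpos)
  have := Finset.ext_iff.1 heq x
  simpa using this

theorem isCyclic_gal_tower_top [IsCyclic Gal(L/K)] : IsCyclic Gal(L/F) :=
  isCyclic_of_injective (AlgEquiv.restrictScalarsHom K : Gal(L/F) →* Gal(L/K))
    (AlgEquiv.restrictScalarsHom_injective K)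

end Cyclic

section Layer

open IsDedekindDomain NumberField

variable {K F L : Type*} [Field K] [Field F] [Field L] [NumberField K] [NumberField F]
  [NumberField L] [Algebra K F] [Algebra F L] [Algebra K L] [IsScalarTower K F L]

/-- If `L / K` is totally ramified cyclic of prime power degree, and `F / K` is its first layer,
then the different exponent of `F / K` determines how generators of `Gal(L/K)` move a
uniformizer. -/
theorem IsTotRam.sub_one_mul_eq {p s : ℕ} [Fact p.Prime] [IsGalois K L] [IsCyclic Gal(L/K)]
    {Q : HeightOneSpectrum (𝓞 L)} (P : HeightOneSpectrum (𝓞 F)) [Q.asIdeal.LiesOver P.asIdeal]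
    (h : IsTotRam K Q) (h' : IsTotRam F Q) (hFL : finrank F L = p ^ s)
    (hKF : finrank K F = p) {π : 𝓞 L} (hπ : addVal Q L (algebraMap (𝓞 L) L π) = 1)
    {D : ℕ} (hD : emultiplicity P.asIdeal (differentIdeal (𝓞 K) (𝓞 F)) = D)
    {g : Gal(L/K)} (hg : orderOf g = p ^ (s + 1)) {j : ℤ}
    (hj : addVal Q L (g (algebraMap (𝓞 L) L π) - algebraMap (𝓞 L) L π) = j) :
    (p - 1 : ℤ) * j = D := by
  classical
  have hp : p.Prime := Fact.out
  have : IsGalois F L := IsGalois.tower_top_of_isGalois K F L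
  have H := h.isTotallyRamified hπ
  have hKL : finrank K L = p ^ (s + 1) := by
    rw [← finrank_mul_finrank K F L, hFL, hKF, pow_succ']
  have hex : ∀ x : Gal(L/K), ∃ i : ℤ, x ≠ 1 →
      addVal Q L (x (algebraMap (𝓞 L) L π) - algebraMap (𝓞 L) L π) = i := by
    intro x
    by_cases hx : x = 1
    · exact ⟨0, fun h => (h hx).elim⟩
    · obtain ⟨i, hi, -⟩ := H.exists_map_sub_eq hx
      exact ⟨i, fun _ => hi⟩
  choose i hi using hex
  obtain ⟨D₁, hD₁, hs₁⟩ := h.emultiplicity_differentIdeal hπ i hi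
  obtain ⟨D₂, hD₂, hs₂⟩ := h'.emultiplicity_differentIdeal hπ
    (fun x => i (AlgEquiv.restrictScalars K x)) (fun x hx =>
      hi (AlgEquiv.restrictScalars K x)
        ((map_ne_one_iff _ (AlgEquiv.restrictScalarsHom_injective K)).2 hx))
  have hdiff : (D₁ : ℤ) = D₂ + p ^ s * D := by
    letI : Algebra (FractionRing (𝓞 K)) (FractionRing (𝓞 L)) := FractionRing.liftAlgebra _ _
    have h1 := differentIdeal_eq_differentIdeal_mul_differentIdeal (𝓞 K) (𝓞 F) (𝓞 L)
    letI : Algebra (FractionRing (𝓞 K)) (FractionRing (𝓞 F)) := FractionRing.liftAlgebra _ _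
    rw [h1, emultiplicity_mul Q.prime, hD₂,
      Ideal.IsDedekindDomain.emultiplicity_map_eq_ramificationIdx'_mul differentIdeal_ne_bot
        P.irreducible Q.irreducible Q.ne_bot, hD,
      Ideal.ramificationIdx'_eq_ramificationIdx _ _ P.ne_bot, h', hFL] at hD₁
    have h2 : D₂ + p ^ s * D = D₁ := by exact_mod_cast hD₁
    rw [← h2]
    push_cast
    ring
  set S : Finset Gal(L/K) := Finset.univ.filter fun x => x ^ p ^ s = 1 with hS
  have hSim : S = Finset.univ.image (AlgEquiv.restrictScalars K : Gal(L/F) → Gal(L/K)) := by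
    ext x
    have := range_restrictScalarsHom (F := F) x
    rw [hFL] at this
    simp [hS, ← this]
  have hsum₂ : (D₂ : ℤ) = ∑ x ∈ S.erase 1, i x := by
    have h1 : (1 : Gal(L/K)) = AlgEquiv.restrictScalars K (1 : Gal(L/F)) := rfl
    rw [hs₂, hSim, h1, ← Finset.image_erase (AlgEquiv.restrictScalars_injective K),
      Finset.sum_image (AlgEquiv.restrictScalars_injective K).injOn]
  have hg1 : g ≠ 1 := by
    rintro rfl
    rw [orderOf_one] at hg
    exact (Nat.one_lt_pow (by omega) hp.one_lt).ne hg
  have hcardG : Nat.card Gal(L/K) = p ^ (s + 1) := by rw [IsGalois.card_aut_eq_finrank, hKL]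
  have hgen : ∀ x : Gal(L/K), x ∉ S → i x = j := by
    intro x hx
    have hxo : orderOf x = p ^ (s + 1) :=
      orderOf_eq_prime_pow (by simpa [hS] using hx) (by rw [← hcardG, pow_card_eq_one'])
    have hzp : ∀ y z : Gal(L/K), orderOf y = p ^ (s + 1) → ∃ a : ℕ, y ^ a = z := by
      intro y z hy
      have : Subgroup.zpowers y = ⊤ := by
        rw [← Subgroup.card_eq_iff_eq_top, Nat.card_zpowers, hy, hcardG]
      have hz : z ∈ Subgroup.zpowers y := by rw [this]; trivial
      rw [← mem_powers_iff_mem_zpowers] at hz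
      exact hz
    obtain ⟨a, ha⟩ := hzp g x hg
    obtain ⟨b, hb⟩ := hzp x g hxo
    have hx1 : x ≠ 1 := by rintro rfl; simp [hS] at hx
    have h1 := H.map_pow_sub_eq (g := g) (a := a) (b := b) (by rw [pow_mul, ha, hb])
    rw [ha, hi x hx1, hj] at h1
    exact_mod_cast h1
  have hcardS : S.card = p ^ s := by
    rw [hSim, Finset.card_image_of_injective _ (AlgEquiv.restrictScalars_injective K),
      Finset.card_univ, ← Nat.card_eq_fintype_card, IsGalois.card_aut_eq_finrank, hFL]
  have hsplit : (D₁ : ℤ) = ∑ x ∈ S.erase 1, i x + ∑ x ∈ Finset.univ \ S, i x := by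
    rw [hs₁, ← Finset.sum_union]
    · congr 1
      ext x
      by_cases hx : x ∈ S
      · simp [hx]
      · have : x ≠ 1 := by rintro rfl; simp [hS] at hx
        simp [hx, this]
    · refine Finset.disjoint_left.2 fun x hx hx' => ?_
      simp at hx hx'
      exact hx' hx.2
  rw [Finset.sum_congr rfl (fun x hx => hgen x (Finset.mem_sdiff.1 hx).2), Finset.sum_const,
    Finset.card_sdiff_of_subset (Finset.subset_univ _), hcardS, Finset.card_univ,
    ← Nat.card_eq_fintype_card, hcardG, ← hsum₂, nsmul_eq_mul, hdiff, add_right_inj,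
    Nat.cast_sub (Nat.pow_le_pow_right hp.pos (by omega))] at hsplit
  push_cast at hsplit
  have hpos : (p : ℤ) ^ s ≠ 0 := by have := hp.ne_zero; positivity
  refine mul_left_cancel₀ hpos ?_
  rw [hsplit]
  ring

end Layer

end ZpTower

namespace ZpTower

open Module

section Layer

open IsDedekindDomain NumberField

/-- The different exponent of a layer `F / K` of a cyclic totally ramified extension determines
how the corresponding automorphisms move a uniformizer. -/
theorem IsTotRam.sub_one_mul_eq_of_orderOf {K₀ K F L : Type*} [Field K₀] [Field K] [Field F]
    [Field L] [NumberField K₀] [NumberField K] [NumberField F] [NumberField L] [Algebra K₀ K]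
    [Algebra K₀ L] [Algebra K F] [Algebra F L] [Algebra K L] [IsScalarTower K F L]
    [IsScalarTower K₀ K L] {p s : ℕ} [Fact p.Prime] [IsGalois K₀ L] [IsCyclic Gal(L/K₀)]
    {Q : HeightOneSpectrum (𝓞 L)} (P : HeightOneSpectrum (𝓞 F)) [Q.asIdeal.LiesOver P.asIdeal]
    (h : IsTotRam K Q) (h' : IsTotRam F Q) (hFL : finrank F L = p ^ s)
    (hKF : finrank K F = p) {π : 𝓞 L} (hπ : addVal Q L (algebraMap (𝓞 L) L π) = 1)
    {D : ℕ} (hD : emultiplicity P.asIdeal (differentIdeal (𝓞 K) (𝓞 F)) = D)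
    {x : Gal(L/K₀)} (hx : orderOf x = p ^ (s + 1)) {j : ℤ}
    (hj : addVal Q L (x (algebraMap (𝓞 L) L π) - algebraMap (𝓞 L) L π) = j) :
    (p - 1 : ℤ) * j = D := by
  have hKL : finrank K L = p ^ (s + 1) := by
    rw [← finrank_mul_finrank K F L, hFL, hKF, pow_succ']
  obtain ⟨g, rfl⟩ := (range_restrictScalarsHom (F := K) x).2 (by rw [hKL, ← hx, pow_orderOf_eq_one])
  have : IsGalois K L := IsGalois.tower_top_of_isGalois K₀ K L
  have : IsCyclic Gal(L/K) := isCyclic_gal_tower_top (K := K₀)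
  refine IsTotRam.sub_one_mul_eq (Q := Q) P h h' hFL hKF hπ hD (g := g) ?_ hj
  rw [← hx]
  exact (orderOf_injective (AlgEquiv.restrictScalarsHom K₀ : Gal(L/K) →* Gal(L/K₀))
    (AlgEquiv.restrictScalarsHom_injective K₀) g).symm

end Layer

section Abstract

variable {K L : Type*} [Field K] [Field L] [Algebra K L] [FiniteDimensional K L] [IsGalois K L]
  {v : AddValuation L (WithTop ℤ)} {π : L}

theorem orderOf_pow_eq {G : Type*} [Group G] {p m : ℕ} [Fact p.Prime] {σ : G}
    (hσ : orderOf σ = p ^ (m + 1)) {a : ℕ} (ha0 : a ≠ 0) (ha : a < p ^ (m + 1)) :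
    padicValNat p a < m + 1 ∧ orderOf (σ ^ a) = p ^ (m + 1 - padicValNat p a) := by
  have hp : p.Prime := Fact.out
  have h1 : p ^ padicValNat p a ≤ a := Nat.le_of_dvd (Nat.pos_of_ne_zero ha0) pow_padicValNat_dvd
  have h2 : padicValNat p a < m + 1 := (Nat.pow_lt_pow_iff_right hp.one_lt).1 (h1.trans_lt ha)
  refine ⟨h2, ?_⟩
  rw [orderOf_pow' σ ha0, hσ]
  have : (p ^ (m + 1)).gcd a = p ^ padicValNat p a := by
    refine Nat.dvd_antisymm ?_ (Nat.dvd_gcd (pow_dvd_pow p h2.le) pow_padicValNat_dvd)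
    obtain ⟨k, hk, hk'⟩ := (Nat.dvd_prime_pow hp).1 (Nat.gcd_dvd_left (p ^ (m + 1)) a)
    rw [hk']
    refine pow_dvd_pow p ?_
    have h3 : p ^ k ∣ a := hk' ▸ Nat.gcd_dvd_right _ _
    exact (padicValNat_dvd_iff_le ha0).1 h3
  rw [this, Nat.pow_div h2.le hp.pos]

theorem IsTotallyRamified.not_pow_dvd_add_breakSum (H : IsTotallyRamified K v π)
    [IsCyclic Gal(L/K)] {p m : ℕ} [Fact p.Prime] (hKL : finrank K L = p ^ (m + 1)) (t : ℕ → ℤ)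
    (ht : ∀ (x : Gal(L/K)) (j : ℕ), j < m + 1 → orderOf x = p ^ (m + 1 - j) →
      v (x π - π) = (t j + 1 : ℤ)) {a : ℕ} (ha0 : a ≠ 0) (ha : a < p ^ (m + 1)) :
    ¬ (p : ℤ) ^ (m + 1) ∣ a + t (padicValNat p a) + breakSum p t (p ^ (m + 1)) := by
  classical
  have hp : p.Prime := Fact.out
  obtain ⟨σ, hσ⟩ := IsCyclic.exists_generator (α := Gal(L/K))
  have hσo : orderOf σ = p ^ (m + 1) := by
    rw [orderOf_eq_card_of_forall_mem_zpowers hσ, IsGalois.card_aut_eq_finrank, hKL]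
  have hex : ∀ x : Gal(L/K), ∃ i : ℤ, x ≠ 1 → v (x π - π) = i := by
    intro x
    by_cases hx : x = 1
    · exact ⟨0, fun h => (h hx).elim⟩
    · obtain ⟨i, hi, -⟩ := H.exists_map_sub_eq hx
      exact ⟨i, fun _ => hi⟩
  choose i hi using hex
  have hi' : ∀ b, b ≠ 0 → b < p ^ (m + 1) → σ ^ b ≠ 1 ∧ i (σ ^ b) = t (padicValNat p b) + 1 := by
    intro b hb0 hb
    have h1 : σ ^ b ≠ 1 := by
      intro h
      have := Nat.le_of_dvd (Nat.pos_of_ne_zero hb0) (orderOf_dvd_of_pow_eq_one h)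
      omega
    refine ⟨h1, ?_⟩
    have h2 := orderOf_pow_eq hσo hb0 hb
    have h3 := ht _ _ h2.1 h2.2
    rw [hi _ h1] at h3
    exact_mod_cast h3
  have hsum : ∑ g ∈ Finset.univ.erase 1, i g = breakSum p t (p ^ (m + 1)) + (p ^ (m + 1) - 1) := by
    have h1 : ∑ g ∈ Finset.univ.erase 1, i g =
        ∑ b ∈ (Finset.range (p ^ (m + 1))).erase 0, (t (padicValNat p b) + 1) := by
      symm
      refine Finset.sum_bij (fun b _ => σ ^ b) ?_ ?_ ?_ ?_
      · intro b hb
        simp only [Finset.mem_erase, Finset.mem_range] at hb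
        simpa using (hi' b hb.1 hb.2).1
      · intro b hb c hc hbc
        simp only [Finset.mem_erase, Finset.mem_range] at hb hc
        refine pow_injOn_Iio_orderOf (x := σ) ?_ ?_ hbc
        · rw [hσo]; exact hb.2
        · rw [hσo]; exact hc.2
      · intro g hg
        have h2 := IsCyclic.image_range_orderOf hσ
        have h3 : g ∈ Finset.image (fun i => σ ^ i) (Finset.range (orderOf σ)) := by
          rw [h2]; exact Finset.mem_univ g
        obtain ⟨b, hb, rfl⟩ := Finset.mem_image.1 h3
        refine ⟨b, ?_, rfl⟩
        rw [hσo] at hb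
        refine Finset.mem_erase.2 ⟨?_, hb⟩
        rintro rfl
        simp at hg
      · intro b hb
        simp only [Finset.mem_erase, Finset.mem_range] at hb
        exact (hi' b hb.1 hb.2).2.symm
    have h0 : 0 ∈ Finset.range (p ^ (m + 1)) := Finset.mem_range.2 (pow_pos hp.pos _)
    rw [h1, Finset.sum_add_distrib, breakSum, ← Finset.add_sum_erase _ _ h0, if_pos rfl, zero_add]
    congr 1
    · refine Finset.sum_congr rfl fun b hb => ?_
      rw [if_neg (Finset.mem_erase.1 hb).1]
    · rw [Finset.sum_const, Finset.card_erase_of_mem h0, Finset.card_range, nsmul_eq_mul, mul_one,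
        Nat.cast_sub (Nat.one_le_pow _ _ hp.pos)]
      push_cast
      ring
  have := H.not_dvd_add_sum i hi σ a (hi' a ha0 ha).1
  rw [(hi' a ha0 ha).2, hsum, hKL] at this
  intro h
  apply this
  push_cast
  convert h using 1
  ring

theorem IsTotallyRamified.mul_break_le (H : IsTotallyRamified K v π)
    [IsCyclic Gal(L/K)] {p : ℕ} [Fact p.Prime] (hKL : finrank K L = p ^ 2) {t t' e : ℤ}
    (ht : ∀ x : Gal(L/K), orderOf x = p ^ 2 → v (x π - π) = (t + 1 : ℤ))
    (ht' : ∀ x : Gal(L/K), orderOf x = p → v (x π - π) = (t' + 1 : ℤ))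
    (ht0 : 0 ≤ t) (he : v (p : L) = e) (hte : (p - 1) * t ≤ e) : p * t ≤ t' := by
  have hp : p.Prime := Fact.out
  obtain ⟨σ, hσ⟩ := IsCyclic.exists_generator (α := Gal(L/K))
  have hσo : orderOf σ = p ^ 2 := by
    rw [orderOf_eq_card_of_forall_mem_zpowers hσ, IsGalois.card_aut_eq_finrank, hKL]
  have h1 := H.le_map_pow_prime_sub hp σ ht0 (ht σ hσo) he
  rw [ht' (σ ^ p) (by
    rw [orderOf_pow_of_dvd hp.ne_zero (by rw [hσo]; exact dvd_pow_self p (by norm_num)), hσo,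
      pow_two, Nat.mul_div_cancel _ hp.pos])] at h1
  have h2 : min (1 + p * t) (e + 1 + t) ≤ t' + 1 := by exact_mod_cast h1
  have h3 : min (1 + p * t) (e + 1 + t) = 1 + p * t := min_eq_left (by linarith)
  linarith

end Abstract

end ZpTower

namespace ZpTower

open Module
open IsDedekindDomain NumberField

/-- The inclusion of an intermediate field in a larger one, as an algebra structure. -/
noncomputable abbrev inclusionAlgebra {E F : IntermediateField ℚ (AlgebraicClosure ℚ)} (h : E ≤ F) : Algebra E F :=
  (IntermediateField.inclusion h).toRingHom.toAlgebra

theorem isScalarTower_inclusionAlgebra {E F G : IntermediateField ℚ (AlgebraicClosure ℚ)} (h : E ≤ F) (h' : F ≤ G) :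
    letI := inclusionAlgebra h
    letI := inclusionAlgebra h'
    letI := inclusionAlgebra (h.trans h')
    IsScalarTower E F G := by
  letI := inclusionAlgebra h
  letI := inclusionAlgebra h'
  letI := inclusionAlgebra (h.trans h')
  exact IsScalarTower.of_algebraMap_eq fun x => rfl

/-- A `ℤ_p`-tower of fields. -/
structure IsZpTower (p : ℕ) (K : ℕ → IntermediateField ℚ (AlgebraicClosure ℚ)) : Prop where
  mono : Monotone K
  isGalois : ∀ {i j : ℕ} (h : i ≤ j), letI := inclusionAlgebra (mono h); IsGalois (K i) (K j)
  isCyclic : ∀ {i j : ℕ} (h : i ≤ j), letI := inclusionAlgebra (mono h); IsCyclic Gal(K j/K i)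
  finrank_eq : ∀ {i j : ℕ} (h : i ≤ j), letI := inclusionAlgebra (mono h);
    finrank (K i) (K j) = p ^ (j - i)

/-- A compatible system of totally ramified primes in a tower. -/
structure IsTotRamSystem {K : ℕ → IntermediateField ℚ (AlgebraicClosure ℚ)} [∀ n, NumberField (K n)]
    (hK : Monotone K) (Q : ∀ n, HeightOneSpectrum (𝓞 (K n))) : Prop where
  liesOver : ∀ {i j : ℕ} (h : i ≤ j), letI := inclusionAlgebra (hK h);
    (Q j).asIdeal.LiesOver (Q i).asIdeal
  isTotRam : ∀ {i j : ℕ} (h : i ≤ j), letI := inclusionAlgebra (hK h); IsTotRam (K i) (Q j)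

variable {p : ℕ} [Fact p.Prime] {K : ℕ → IntermediateField ℚ (AlgebraicClosure ℚ)} [∀ n, NumberField (K n)]
  (T : IsZpTower p K) {Q : ∀ n, HeightOneSpectrum (𝓞 (K n))} (S : IsTotRamSystem T.mono Q)

include T S

theorem IsTotRamSystem.addVal_natCast {a : ℕ} {e : ℤ} (he : addVal (Q 0) (K 0) (a : K 0) = e)
    (n : ℕ) : addVal (Q n) (K n) (a : K n) = ((p ^ n * e : ℤ) : WithTop ℤ) := by
  letI := inclusionAlgebra (T.mono (Nat.zero_le n))
  have := S.liesOver (Nat.zero_le n)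
  have h1 := addVal_liesOver (Q 0) (Q n) he
  rw [S.isTotRam (Nat.zero_le n), T.finrank_eq (Nat.zero_le n)] at h1
  simpa using h1

theorem IsTotRamSystem.map_sub_eq {D : ℕ → ℕ} (hD : ∀ k, 
      letI := inclusionAlgebra (T.mono k.le_succ)
      emultiplicity (Q (k + 1)).asIdeal (differentIdeal (𝓞 (K k)) (𝓞 (K (k + 1)))) = D k)
    {m j n : ℕ} (hmj : m ≤ j) (hjn : j < n) :
    letI := inclusionAlgebra (T.mono (hmj.trans hjn.le))
    ∀ (π : 𝓞 (K n)) (_ : addVal (Q n) (K n) (algebraMap (𝓞 (K n)) (K n) π) = 1)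
      (x : Gal(K n/K m)) (_ : orderOf x = p ^ (n - j)),
      ∃ i : ℤ, addVal (Q n) (K n) (x (algebraMap (𝓞 (K n)) (K n) π) - algebraMap (𝓞 (K n)) (K n) π)
        = i ∧ (p - 1 : ℤ) * i = D j := by
  letI := inclusionAlgebra (T.mono (hmj.trans hjn.le))
  letI := inclusionAlgebra (T.mono hmj)
  letI := inclusionAlgebra (T.mono hjn.le)
  letI := inclusionAlgebra (T.mono j.le_succ)
  letI := inclusionAlgebra (T.mono (show j + 1 ≤ n from hjn))
  intro π hπ x hx
  have hp : p.Prime := Fact.out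
  have := isScalarTower_inclusionAlgebra (T.mono j.le_succ) (T.mono (show j + 1 ≤ n from hjn))
  have := isScalarTower_inclusionAlgebra (T.mono hmj) (T.mono hjn.le)
  have := T.isGalois (hmj.trans hjn.le)
  have := T.isCyclic (hmj.trans hjn.le)
  have := S.liesOver (show j + 1 ≤ n from hjn)
  have hx1 : x ≠ 1 := by
    rintro rfl
    rw [orderOf_one] at hx
    exact (Nat.one_lt_pow (by omega) hp.one_lt).ne hx
  obtain ⟨i, hi, -⟩ := ((S.isTotRam (hmj.trans hjn.le)).isTotallyRamified hπ).exists_map_sub_eq hx1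
  refine ⟨i, hi, ?_⟩
  refine IsTotRam.sub_one_mul_eq_of_orderOf (K₀ := K m) (K := K j) (F := K (j + 1))
    (s := n - (j + 1)) (Q (j + 1)) (S.isTotRam hjn.le) (S.isTotRam (show j + 1 ≤ n from hjn))
    (T.finrank_eq (show j + 1 ≤ n from hjn)) ?_ hπ (hD j) (x := x) ?_ hi
  · rw [T.finrank_eq j.le_succ]; simp
  · rw [hx]; congr 1; omega

end ZpTower

namespace ZpTower

open Module
open IsDedekindDomain NumberField

variable {p : ℕ} [Fact p.Prime] {K : ℕ → IntermediateField ℚ (AlgebraicClosure ℚ)}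
  [∀ n, NumberField (K n)]
  (T : IsZpTower p K) {Q : ∀ n, HeightOneSpectrum (𝓞 (K n))} (S : IsTotRamSystem T.mono Q)

include T S

theorem IsTotRamSystem.exists_breaks {D : ℕ → ℕ} (hD : ∀ k, 
      letI := inclusionAlgebra (T.mono k.le_succ)
      emultiplicity (Q (k + 1)).asIdeal (differentIdeal (𝓞 (K k)) (𝓞 (K (k + 1)))) = D k) :
    ∃ t : ℕ → ℤ, (∀ k, 0 ≤ t k) ∧ (∀ k, (D k : ℤ) = (p - 1) * (t k + 1)) ∧
    ∀ (m j n : ℕ) (hmj : m ≤ j) (hjn : j < n), 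
      letI := inclusionAlgebra (T.mono (hmj.trans hjn.le))
      ∀ (π : 𝓞 (K n)) (_ : addVal (Q n) (K n) (algebraMap (𝓞 (K n)) (K n) π) = 1)
        (x : Gal(K n/K m)) (_ : orderOf x = p ^ (n - j)),
        addVal (Q n) (K n) (x (algebraMap (𝓞 (K n)) (K n) π) - algebraMap (𝓞 (K n)) (K n) π)
          = (t j + 1 : ℤ) := by
  have hp : p.Prime := Fact.out
  have hp1 : (p : ℤ) - 1 ≠ 0 := by have := hp.one_lt; omega
  have hex : ∀ k, ∃ t : ℤ, 0 ≤ t ∧ (D k : ℤ) = (p - 1) * (t + 1) := by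
    intro k
    letI := inclusionAlgebra (T.mono k.le_succ)
    obtain ⟨π, hπ⟩ := exists_addVal_algebraMap_eq_one (L := K (k + 1)) (Q (k + 1))
    have := T.isGalois k.le_succ
    have := T.isCyclic k.le_succ
    obtain ⟨σ, hσ⟩ := IsCyclic.exists_generator (α := Gal(K (k + 1)/K k))
    have hσo : orderOf σ = p ^ (k + 1 - k) := by
      rw [orderOf_eq_card_of_forall_mem_zpowers hσ, IsGalois.card_aut_eq_finrank,
        T.finrank_eq k.le_succ]
    obtain ⟨i, hi, hi'⟩ := S.map_sub_eq T hD le_rfl k.lt_succ_self π hπ σ hσo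
    have hσ1 : σ ≠ 1 := by
      rintro rfl
      rw [orderOf_one] at hσo
      exact (Nat.one_lt_pow (by omega) hp.one_lt).ne hσo
    have h1 := ((S.isTotRam k.le_succ).isTotallyRamified hπ).one_le_map_sub σ
    rw [hi] at h1
    have h2 : 1 ≤ i := by exact_mod_cast h1
    exact ⟨i - 1, by omega, by rw [← hi']; ring⟩
  choose t ht0 ht using hex
  refine ⟨t, ht0, ht, fun m j n hmj hjn => ?_⟩
  intro π hπ x hx
  obtain ⟨i, hi, hi'⟩ := S.map_sub_eq T hD hmj hjn π hπ x hx
  rw [hi]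
  rw [ht] at hi'
  rw [mul_left_cancel₀ hp1 hi']

/-- The different exponents of the layers of a totally ramified tower eventually follow an affine
function of `p ^ k`. -/
theorem IsTotRamSystem.exists_eventually_eq_linear {e : ℤ} (he0 : 1 ≤ e)
    (he : addVal (Q 0) (K 0) (p : K 0) = e) {D : ℕ → ℕ} (hD : ∀ k, 
      letI := inclusionAlgebra (T.mono k.le_succ)
      emultiplicity (Q (k + 1)).asIdeal (differentIdeal (𝓞 (K k)) (𝓞 (K (k + 1)))) = D k) :
    ∃ A B : ℚ, 0 < A ∧ ∃ N, ∀ k ≥ N, (D k : ℚ) = A * (p : ℚ) ^ k + B := by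
  have hp : p.Prime := Fact.out
  have hp2 := hp.two_le
  obtain ⟨t, ht0, htD, ht⟩ := S.exists_breaks T hD
  have hbound : ∀ k, (p - 1) * t k ≤ p ^ (k + 1) * e ∧
      ((p : ℤ) ∣ t k → (p - 1) * t k = p ^ (k + 1) * e) := by
    intro k
    letI := inclusionAlgebra (T.mono k.le_succ)
    obtain ⟨π, hπ⟩ := exists_addVal_algebraMap_eq_one (L := K (k + 1)) (Q (k + 1))
    have := T.isGalois k.le_succ
    classical
    have hKL : finrank (K k) (K (k + 1)) = p := by rw [T.finrank_eq k.le_succ]; simp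
    refine ((S.isTotRam k.le_succ).isTotallyRamified hπ).sub_one_mul_le_of_prime hp hKL (t k) ?_
      (S.addVal_natCast T he (k + 1))
    intro g hg
    refine ht k k (k + 1) le_rfl k.lt_succ_self π hπ g ?_
    rw [show k + 1 - k = 1 by omega, pow_one]
    refine orderOf_eq_prime ?_ hg
    have hc : Nat.card Gal(K (k + 1)/K k) = p := by rw [IsGalois.card_aut_eq_finrank, hKL]
    have h1 := pow_card_eq_one' (x := g)
    rwa [hc] at h1
  have hmul : ∀ k, p * t k ≤ t (k + 1) := by
    intro k
    have hk : k ≤ k + 2 := by omega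
    letI := inclusionAlgebra (T.mono hk)
    obtain ⟨π, hπ⟩ := exists_addVal_algebraMap_eq_one (L := K (k + 2)) (Q (k + 2))
    have := T.isGalois hk
    have := T.isCyclic hk
    have hKL : finrank (K k) (K (k + 2)) = p ^ 2 := by rw [T.finrank_eq hk]; simp
    refine ((S.isTotRam hk).isTotallyRamified hπ).mul_break_le hKL (t := t k) (t' := t (k + 1))
      ?_ ?_ (ht0 k) (S.addVal_natCast T he (k + 2)) ?_
    · intro x hx
      exact ht k k (k + 2) le_rfl (by omega) π hπ x (by rw [hx]; congr 1; omega)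
    · intro x hx
      exact ht k (k + 1) (k + 2) (by omega) (by omega) π hπ x
        (by rw [hx, show k + 2 - (k + 1) = 1 by omega, pow_one])
    · refine (hbound k).1.trans ?_
      gcongr
      · exact_mod_cast hp.one_le
      · omega
  have hnd : ∀ m a : ℕ, a ≠ 0 → a < p ^ (m + 1) →
      ¬ (p : ℤ) ^ (m + 1) ∣ a + t (padicValNat p a) + breakSum p t (p ^ (m + 1)) := by
    intro m a ha0 ha
    letI := inclusionAlgebra (T.mono (Nat.zero_le (m + 1)))
    obtain ⟨π, hπ⟩ := exists_addVal_algebraMap_eq_one (L := K (m + 1)) (Q (m + 1))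
    have := T.isGalois (Nat.zero_le (m + 1))
    have := T.isCyclic (Nat.zero_le (m + 1))
    refine ((S.isTotRam (Nat.zero_le (m + 1))).isTotallyRamified hπ).not_pow_dvd_add_breakSum
      (by rw [T.finrank_eq (Nat.zero_le (m + 1))]; simp) t ?_ ha0 ha
    intro x j hj hx
    exact ht 0 j (m + 1) (Nat.zero_le _) hj π hπ x hx
  have h1 : 1 ≤ t 0 := by
    by_contra! h
    have h0 : t 0 = 0 := le_antisymm (by omega) (ht0 0)
    have h2 := (hbound 0).2 (by simp [h0])
    rw [h0, mul_zero] at h2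
    have : 0 < (p : ℤ) ^ (0 + 1) * e := by
      have := hp.pos
      positivity
    omega
  have hp1 : (0 : ℚ) < (p : ℚ) - 1 := by
    have : (2 : ℚ) ≤ p := by exact_mod_cast hp2
    linarith
  obtain ⟨A, B, hA, N, hN⟩ := ZpTower.exists_eventually_eq_linear hp2 t (pow_dvd_sub_of_not_dvd t hnd)
    hmul h1 (C := p * e / (p - 1)) (by
      intro k
      have := (hbound k).1
      have h : ((p : ℚ) - 1) * t k ≤ p ^ (k + 1) * e := by exact_mod_cast this
      rw [div_mul_eq_mul_div, le_div_iff₀ hp1]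
      calc (t k : ℚ) * (p - 1) = (p - 1) * t k := by ring
        _ ≤ _ := h
        _ = _ := by ring)
  refine ⟨(p - 1) * A, (p - 1) * (B + 1), by positivity, N, fun k hk => ?_⟩
  have h2 : (D k : ℚ) = (p - 1) * (t k + 1) := by exact_mod_cast htD k
  rw [h2, hN k hk]
  ring

end ZpTower

namespace ZpTower

open Module
open IsDedekindDomain NumberField

theorem mem_zpowers_of_orderOf_dvd {G : Type*} [Group G] [Finite G] [IsCyclic G] {x y : G}
    (h : orderOf x ∣ orderOf y) : x ∈ Subgroup.zpowers y := by
  classical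
  have := Fintype.ofFinite G
  have hsub : Finset.image (fun i => y ^ i) (Finset.range (orderOf y)) ⊆
      Finset.univ.filter fun z => z ^ orderOf y = 1 := by
    intro z hz
    obtain ⟨i, -, rfl⟩ := Finset.mem_image.1 hz
    rw [Finset.mem_filter, pow_right_comm, pow_orderOf_eq_one, one_pow]
    exact ⟨Finset.mem_univ _, rfl⟩
  have heq := Finset.eq_of_subset_of_card_le hsub (by
    rw [Finset.card_image_of_injOn (by simpa using pow_injOn_Iio_orderOf), Finset.card_range]
    exact IsCyclic.card_pow_eq_one_le (orderOf_pos y))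
  have hx : x ∈ Finset.univ.filter fun z => z ^ orderOf y = 1 := by
    simpa using orderOf_dvd_iff_pow_eq_one.1 h
  rw [← heq] at hx
  obtain ⟨i, -, rfl⟩ := Finset.mem_image.1 hx
  exact Subgroup.npow_mem_zpowers y i

variable {K F L : Type*} [Field K] [Field F] [Field L] [NumberField K] [NumberField F]
  [NumberField L] [Algebra K F] [Algebra F L] [Algebra K L] [IsScalarTower K F L]

theorem exists_heightOneSpectrum_liesOver {K L : Type*} [Field K] [Field L] [NumberField K]
    [NumberField L] [Algebra K L] (P : HeightOneSpectrum (𝓞 K)) :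
    ∃ Q : HeightOneSpectrum (𝓞 L), Q.asIdeal.LiesOver P.asIdeal := by
  have : P.asIdeal.IsMaximal := P.isMaximal
  obtain ⟨Q, hQ, hQ'⟩ :=
    Ideal.exists_maximal_ideal_liesOver_of_isIntegral (S := 𝓞 L) P.asIdeal
  exact ⟨⟨Q, hQ.isPrime, Ideal.ne_bot_of_liesOver_of_ne_bot P.ne_bot Q⟩, hQ'⟩

theorem ramificationIdx_eq_card_inertia [IsGalois K L] (Q : HeightOneSpectrum (𝓞 L)) :
    Q.asIdeal.ramificationIdx (𝓞 K) = Nat.card (Q.asIdeal.inertia Gal(L/K)) := by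
  have h : Q.asIdeal.LiesOver (HeightOneSpectrum.under (𝓞 K) Q).asIdeal := ⟨rfl⟩
  have := Ideal.card_inertia_eq_ramificationIdxIn (G := Gal(L/K))
    (HeightOneSpectrum.under (𝓞 K) Q).asIdeal Q.asIdeal
  rw [this, Ideal.ramificationIdxIn_eq_ramificationIdx _ Q.asIdeal Gal(L/K)]

/-- In a cyclic extension of prime power degree, once a prime has begun to ramify, it ramifies
totally. -/
theorem isTotRam_of_ramificationIdx_ne_one {p n : ℕ} [Fact p.Prime] [IsGalois K L]
    [IsCyclic Gal(L/K)] (hKL : finrank K L = p ^ n) {Q : HeightOneSpectrum (𝓞 L)}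
    (P : HeightOneSpectrum (𝓞 F)) [Q.asIdeal.LiesOver P.asIdeal]
    (hP : P.asIdeal.ramificationIdx (𝓞 K) ≠ 1) : IsTotRam F Q := by
  have hp : p.Prime := Fact.out
  have : IsGalois F L := IsGalois.tower_top_of_isGalois K F L
  have hQ0 : Q.asIdeal.ramificationIdx (𝓞 F) ≠ 0 := by
    rw [ramificationIdx_eq_card_inertia]
    exact Nat.card_pos.ne'
  have htower := Ideal.ramificationIdx_tower (R := 𝓞 K) P.asIdeal Q.asIdeal
  obtain ⟨s, -, hs⟩ : ∃ s ≤ n, finrank F L = p ^ s := by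
    refine (Nat.dvd_prime_pow hp).1 (Dvd.intro_left (finrank K F) ?_)
    rw [finrank_mul_finrank, hKL]
  have hsmul : ∀ (g : Gal(L/F)) (x : 𝓞 L), AlgEquiv.restrictScalars K g • x = g • x :=
    fun g x => rfl
  by_cases hcase : ∀ x ∈ Q.asIdeal.inertia Gal(L/K), x ^ p ^ s = 1
  · exfalso
    apply hP
    have hcard : Nat.card (Q.asIdeal.inertia Gal(L/K)) = Nat.card (Q.asIdeal.inertia Gal(L/F)) := by
      symm
      refine Nat.card_congr (Equiv.ofBijective
        (fun g => ⟨AlgEquiv.restrictScalars K g.1, fun x => g.2 x⟩) ⟨?_, ?_⟩)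
      · intro g g' h
        exact Subtype.ext (AlgEquiv.restrictScalars_injective K (congrArg Subtype.val h))
      · rintro ⟨x, hx⟩
        obtain ⟨g, rfl⟩ := (range_restrictScalarsHom (F := F) x).2 (by rw [hs]; exact hcase x hx)
        exact ⟨⟨g, fun y => hx y⟩, rfl⟩
    rw [ramificationIdx_eq_card_inertia, hcard, ← ramificationIdx_eq_card_inertia] at htower
    exact Nat.eq_of_mul_eq_mul_right (Nat.pos_of_ne_zero hQ0) (by rw [one_mul]; exact htower.symm)
  · push Not at hcase
    obtain ⟨x, hx, hxs⟩ := hcase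
    have htop : Q.asIdeal.inertia Gal(L/F) = ⊤ := by
      refine eq_top_iff.2 fun g _ => ?_
      have hg : AlgEquiv.restrictScalars K g ∈ Subgroup.zpowers x := by
        have h1 := (range_restrictScalarsHom (F := F) (AlgEquiv.restrictScalars K g)).1 ⟨g, rfl⟩
        rw [hs] at h1
        refine mem_zpowers_of_orderOf_dvd ((orderOf_dvd_of_pow_eq_one h1).trans ?_)
        obtain ⟨r, -, hr⟩ := (Nat.dvd_prime_pow hp).1 (show orderOf x ∣ p ^ n by
          rw [← hKL, ← IsGalois.card_aut_eq_finrank]; exact orderOf_dvd_natCard x)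
        rw [hr]
        refine pow_dvd_pow p ?_
        by_contra! hlt
        exact hxs (orderOf_dvd_iff_pow_eq_one.1 (hr ▸ pow_dvd_pow p hlt.le))
      have h2 : AlgEquiv.restrictScalars K g ∈ Q.asIdeal.inertia Gal(L/K) :=
        (Subgroup.zpowers_le.2 hx) hg
      exact fun y => h2 y
    rw [IsTotRam, ramificationIdx_eq_card_inertia, htop, Subgroup.card_top,
      IsGalois.card_aut_eq_finrank]

theorem emultiplicity_differentIdeal_eq_zero (Q : HeightOneSpectrum (𝓞 L))
    (hQ : Q.asIdeal.ramificationIdx (𝓞 K) = 1) :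
    emultiplicity Q.asIdeal (differentIdeal (𝓞 K) (𝓞 L)) = 0 := by
  letI : Algebra (FractionRing (𝓞 K)) (FractionRing (𝓞 L)) := FractionRing.liftAlgebra _ _
  rw [emultiplicity_eq_zero, not_dvd_differentIdeal_iff]
  exact Ideal.ramificationIdx_eq_one_iff.1 hQ

end ZpTower

namespace ZpTower

open Module
open IsDedekindDomain NumberField

variable {p : ℕ} [Fact p.Prime] {K : ℕ → IntermediateField ℚ (AlgebraicClosure ℚ)}
  [∀ n, NumberField (K n)]

theorem IsZpTower.of_zero (hmono : Monotone K)
    (hgal : ∀ n : ℕ, letI := inclusionAlgebra (hmono (Nat.zero_le n)); IsGalois (K 0) (K n))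
    (hcyc : ∀ n : ℕ, letI := inclusionAlgebra (hmono (Nat.zero_le n));
      Nonempty ((K n ≃ₐ[K 0] K n) ≃* Multiplicative (ZMod (p ^ n)))) :
    IsZpTower p K := by
  have hp : p.Prime := Fact.out
  have hcyc' : ∀ n : ℕ, letI := inclusionAlgebra (hmono (Nat.zero_le n));
      IsCyclic Gal(K n/K 0) := fun n =>
    (hcyc n).some.symm.isCyclic.1 inferInstance
  have hrank : ∀ n : ℕ, letI := inclusionAlgebra (hmono (Nat.zero_le n));
      finrank (K 0) (K n) = p ^ n := by
    intro n
    letI := inclusionAlgebra (hmono (Nat.zero_le n))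
    have := hgal n
    rw [← IsGalois.card_aut_eq_finrank, Nat.card_congr (hcyc n).some.toEquiv]
    simp
  refine ⟨hmono, fun {i j} h => ?_, fun {i j} h => ?_, fun {i j} h => ?_⟩
  all_goals
    letI := inclusionAlgebra (hmono h)
    letI := inclusionAlgebra (hmono (Nat.zero_le i))
    letI := inclusionAlgebra (hmono (Nat.zero_le j))
    have := isScalarTower_inclusionAlgebra (hmono (Nat.zero_le i)) (hmono h)
    have := hgal j
  · exact IsGalois.tower_top_of_isGalois (K 0) (K i) (K j)
  · have := hcyc' j
    exact isCyclic_gal_tower_top (K := K 0)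
  · have h1 := finrank_mul_finrank (K 0) (K i) (K j)
    rw [hrank i, hrank j] at h1
    have h2 : p ^ i * p ^ (j - i) = p ^ j := by rw [← pow_add]; congr 1; omega
    exact Nat.eq_of_mul_eq_mul_left (pow_pos hp.pos i) (h1.trans h2.symm)

variable (T : IsZpTower p K)
include T

theorem IsZpTower.shift (m : ℕ) : IsZpTower p (fun n => K (m + n)) where
  mono := fun i j h => T.mono (by omega)
  isGalois := fun {i j} h => T.isGalois (show m + i ≤ m + j by omega)
  isCyclic := fun {i j} h => T.isCyclic (show m + i ≤ m + j by omega)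
  finrank_eq := fun {i j} h => by
    rw [T.finrank_eq (show m + i ≤ m + j by omega)]; congr 1; omega

/-- After finitely many layers, every prime above `p` is either totally ramified or unramified
in the rest of the tower. -/
theorem IsZpTower.exists_isTotRam_or_unramified : ∃ m : ℕ, ∀ P : HeightOneSpectrum (𝓞 (K m)),
    (p : 𝓞 (K m)) ∈ P.asIdeal →
    (∀ (i j : ℕ) (hmi : m ≤ i) (hij : i ≤ j) (Q : HeightOneSpectrum (𝓞 (K j))),
      letI := inclusionAlgebra (T.mono (hmi.trans hij))
      letI := inclusionAlgebra (T.mono hij)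
      Q.asIdeal.LiesOver P.asIdeal → IsTotRam (K i) Q) ∨
    (∀ (i j : ℕ) (hmi : m ≤ i) (hij : i ≤ j) (Q : HeightOneSpectrum (𝓞 (K j))),
      letI := inclusionAlgebra (T.mono (hmi.trans hij))
      letI := inclusionAlgebra (T.mono hij)
      Q.asIdeal.LiesOver P.asIdeal → Q.asIdeal.ramificationIdx (𝓞 (K i)) = 1) := by
  let Ram : HeightOneSpectrum (𝓞 (K 0)) → ℕ → Prop := fun P n =>
    letI := inclusionAlgebra (T.mono (Nat.zero_le n))
    ∃ Q : HeightOneSpectrum (𝓞 (K n)), Q.asIdeal.LiesOver P.asIdeal ∧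
      Q.asIdeal.ramificationIdx (𝓞 (K 0)) ≠ 1
  have hfin : {P : HeightOneSpectrum (𝓞 (K 0)) | (p : 𝓞 (K 0)) ∈ P.asIdeal}.Finite := by
    have hp0 : Ideal.span {(p : 𝓞 (K 0))} ≠ 0 := by
      simpa using (Fact.out : p.Prime).ne_zero
    refine (Ideal.finite_factors hp0).subset fun P hP => ?_
    simpa [Ideal.dvd_span_singleton] using hP
  have hRam : ∀ P n, Ram P n →
      letI := inclusionAlgebra (T.mono (Nat.zero_le n))
      ∀ Q : HeightOneSpectrum (𝓞 (K n)), Q.asIdeal.LiesOver P.asIdeal →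
        Q.asIdeal.ramificationIdx (𝓞 (K 0)) ≠ 1 := by
    intro P n
    letI := inclusionAlgebra (T.mono (Nat.zero_le n))
    rintro ⟨Q, hQ, hQ'⟩ Q' hQ''
    have := T.isGalois (Nat.zero_le n)
    rwa [← Ideal.ramificationIdxIn_eq_ramificationIdx P.asIdeal Q'.asIdeal Gal(K n/K 0),
      Ideal.ramificationIdxIn_eq_ramificationIdx P.asIdeal Q.asIdeal Gal(K n/K 0)]
  have hex : ∀ P, ∃ n, (∃ m, Ram P m) → Ram P n := by
    intro P
    by_cases h : ∃ m, Ram P m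
    · exact ⟨h.choose, fun _ => h.choose_spec⟩
    · exact ⟨0, fun h' => (h h').elim⟩
  choose N hN using hex
  obtain ⟨m, hm⟩ := (hfin.image N).bddAbove
  have hlo : ∀ (i j : ℕ) (hij : i ≤ j) (Q : HeightOneSpectrum (𝓞 (K j)))
      (P : HeightOneSpectrum (𝓞 (K 0))),
      letI := inclusionAlgebra (T.mono (Nat.zero_le j))
      letI := inclusionAlgebra (T.mono (Nat.zero_le i))
      letI := inclusionAlgebra (T.mono hij)
      Q.asIdeal.LiesOver P.asIdeal → ∃ Q' : HeightOneSpectrum (𝓞 (K i)), 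
        Q.asIdeal.LiesOver Q'.asIdeal ∧ Q'.asIdeal.LiesOver P.asIdeal ∧
        Q.asIdeal.ramificationIdx (𝓞 (K 0)) =
          Q'.asIdeal.ramificationIdx (𝓞 (K 0)) * Q.asIdeal.ramificationIdx (𝓞 (K i)) := by
    intro i j hij Q P
    letI := inclusionAlgebra (T.mono (Nat.zero_le j))
    letI := inclusionAlgebra (T.mono (Nat.zero_le i))
    letI := inclusionAlgebra (T.mono hij)
    intro hQ
    have := isScalarTower_inclusionAlgebra (T.mono (Nat.zero_le i)) (T.mono hij)
    have h : Q.asIdeal.LiesOver (HeightOneSpectrum.under (𝓞 (K i)) Q).asIdeal := ⟨rfl⟩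
    exact ⟨HeightOneSpectrum.under (𝓞 (K i)) Q, h, Ideal.LiesOver.tower_bot Q.asIdeal _ P.asIdeal,
      Ideal.ramificationIdx_tower _ _⟩
  have hup : ∀ P i j, i ≤ j → Ram P i → Ram P j := by
    intro P i j hij h
    letI := inclusionAlgebra (T.mono (Nat.zero_le j))
    letI := inclusionAlgebra (T.mono (Nat.zero_le i))
    letI := inclusionAlgebra (T.mono hij)
    obtain ⟨Q₁, hQ'⟩ := exists_heightOneSpectrum_liesOver (L := K j) P
    obtain ⟨Q₂, h1, h2, h3⟩ := hlo i j hij Q₁ P hQ'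
    refine ⟨Q₁, hQ', ?_⟩
    rw [h3]
    intro h4
    exact hRam P i h Q₂ h2 (Nat.eq_one_of_mul_eq_one_right h4)
  refine ⟨m, fun P' hP' => ?_⟩
  letI := inclusionAlgebra (T.mono (Nat.zero_le m))
  set P := HeightOneSpectrum.under (𝓞 (K 0)) P' with hP
  have hPP' : P'.asIdeal.LiesOver P.asIdeal := ⟨rfl⟩
  have hpP : (p : 𝓞 (K 0)) ∈ P.asIdeal := by
    rw [Ideal.LiesOver.over (P := P'.asIdeal) (p := P.asIdeal)]
    simpa [Ideal.mem_comap] using hP'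
  have hlies : ∀ (j : ℕ) (hmj : m ≤ j) (Q : HeightOneSpectrum (𝓞 (K j))),
      letI := inclusionAlgebra (T.mono hmj)
      letI := inclusionAlgebra (T.mono (Nat.zero_le j))
      Q.asIdeal.LiesOver P'.asIdeal → Q.asIdeal.LiesOver P.asIdeal := by
    intro j hmj Q
    letI := inclusionAlgebra (T.mono hmj)
    letI := inclusionAlgebra (T.mono (Nat.zero_le j))
    intro hQ
    have := isScalarTower_inclusionAlgebra (T.mono (Nat.zero_le m)) (T.mono hmj)
    exact Ideal.LiesOver.trans Q.asIdeal P'.asIdeal P.asIdeal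
  by_cases hr : ∃ n, Ram P n
  · refine Or.inl fun i j hmi hij Q => ?_
    letI := inclusionAlgebra (T.mono (hmi.trans hij))
    letI := inclusionAlgebra (T.mono hij)
    letI := inclusionAlgebra (T.mono (Nat.zero_le j))
    letI := inclusionAlgebra (T.mono (Nat.zero_le i))
    intro hQ
    have hi : Ram P i := hup P (N P) i ((hm ⟨P, hpP, rfl⟩).trans hmi) (hN P hr)
    obtain ⟨Q₂, h1, h2, h3⟩ := hlo i j hij Q P (hlies j (hmi.trans hij) Q hQ)
    have := isScalarTower_inclusionAlgebra (T.mono (Nat.zero_le i)) (T.mono hij)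
    have := T.isGalois (Nat.zero_le j)
    have := T.isCyclic (Nat.zero_le j)
    exact isTotRam_of_ramificationIdx_ne_one (K := K 0) (T.finrank_eq (Nat.zero_le j)) Q₂
      (hRam P i hi Q₂ h2)
  · refine Or.inr fun i j hmi hij Q => ?_
    letI := inclusionAlgebra (T.mono (hmi.trans hij))
    letI := inclusionAlgebra (T.mono hij)
    letI := inclusionAlgebra (T.mono (Nat.zero_le j))
    letI := inclusionAlgebra (T.mono (Nat.zero_le i))
    intro hQ
    obtain ⟨Q₂, h1, h2, h3⟩ := hlo i j hij Q P (hlies j (hmi.trans hij) Q hQ)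
    have h4 : Q.asIdeal.ramificationIdx (𝓞 (K 0)) = 1 := by
      by_contra h
      exact hr ⟨j, Q, hlies j (hmi.trans hij) Q hQ, h⟩
    rw [h4] at h3
    exact Nat.eq_one_of_mul_eq_one_left h3.symm

end ZpTower

namespace ZpTower

open Module
open IsDedekindDomain NumberField

theorem padicValNat_prod {p : ℕ} [Fact p.Prime] {ι : Type*} (s : Finset ι) (f : ι → ℕ)
    (h : ∀ i ∈ s, f i ≠ 0) : padicValNat p (∏ i ∈ s, f i) = ∑ i ∈ s, padicValNat p (f i) := by
  classical
  induction s using Finset.induction_on with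
  | empty => simp
  | insert a s ha ih =>
    rw [Finset.prod_insert ha, Finset.sum_insert ha,
      padicValNat.mul (h a (by simp)) (Finset.prod_ne_zero_iff.2 fun i hi => h i (by simp [hi])),
      ih fun i hi => h i (by simp [hi])]

section

variable {K L : Type*} [Field K] [Field L] [NumberField K] [NumberField L] [Algebra K L]

theorem padicValNat_absNorm {p : ℕ} [Fact p.Prime] {I : Ideal (𝓞 L)} (hI : I ≠ ⊥) {ι : Type*}
    (s : Finset ι) (Q : ι → HeightOneSpectrum (𝓞 L)) (hQ : Set.InjOn Q s) (m : ι → ℕ)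
    (hm : ∀ i ∈ s, emultiplicity (Q i).asIdeal I = m i)
    (hs : ∀ P : HeightOneSpectrum (𝓞 L), (p : 𝓞 L) ∈ P.asIdeal → P.asIdeal ∣ I → ∃ i ∈ s, Q i = P) :
    padicValNat p (Ideal.absNorm I) =
      ∑ i ∈ s, m i * padicValNat p (Ideal.absNorm (Q i).asIdeal) := by
  have hdvd : ∏ i ∈ s, (Q i).asIdeal ^ m i ∣ I := by
    refine Finset.prod_dvd_of_coprime (fun i hi j hj hij => ?_) fun i hi =>
      pow_dvd_of_le_emultiplicity (hm i hi).ge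
    refine IsCoprime.pow ?_
    have := (Q i).isMaximal
    have := (Q j).isMaximal
    refine Ideal.isCoprime_of_isMaximal ?_
    exact fun h => hij (hQ hi hj (HeightOneSpectrum.ext h))
  obtain ⟨J, hJ⟩ := hdvd
  have hJ0 : J ≠ ⊥ := by rintro rfl; exact hI (by simpa using hJ)
  have hpJ : ¬ p ∣ Ideal.absNorm J := by
    intro h
    obtain ⟨P, hP, hPp, hPJ⟩ := Ideal.exists_isMaximal_dvd_of_dvd_absNorm (Nat.prime_iff_prime_int.1 Fact.out) J
      (Int.natCast_dvd_natCast.2 h)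
    have hP0 : P ≠ ⊥ := by rintro rfl; exact hJ0 (zero_dvd_iff.1 hPJ)
    have hpP : (p : 𝓞 L) ∈ P := by
      have : (p : ℤ) ∈ Ideal.under ℤ P := by
        rw [hPp]; exact Ideal.mem_span_singleton_self _
      simpa [Ideal.under, Ideal.mem_comap] using this
    obtain ⟨i, hi, hiP⟩ := hs ⟨P, hP.isPrime, hP0⟩ hpP (hJ ▸ hPJ.mul_left _)
    have h1 : (Q i).asIdeal ^ (m i + 1) ∣ I := by
      rw [hJ, pow_succ]
      refine mul_dvd_mul (Finset.dvd_prod_of_mem (fun i => (Q i).asIdeal ^ m i) hi) ?_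
      rw [hiP]
      exact hPJ
    have h2 := le_emultiplicity_of_pow_dvd h1
    rw [hm i hi] at h2
    have h3 : m i + 1 ≤ m i := by exact_mod_cast h2
    omega
  have hn0 : ∀ i ∈ s, Ideal.absNorm (Q i).asIdeal ^ m i ≠ 0 := fun i _ =>
    pow_ne_zero _ (Ideal.absNorm_ne_zero_iff_mem_nonZeroDivisors.2
      (mem_nonZeroDivisors_of_ne_zero (Q i).ne_bot))
  rw [hJ, map_mul, map_prod, padicValNat.mul, padicValNat.eq_zero_of_not_dvd hpJ, add_zero]
  · simp_rw [map_pow]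
    rw [padicValNat_prod s _ hn0]
    exact Finset.sum_congr rfl fun i _ => padicValNat.pow _ _
  · rw [Finset.prod_ne_zero_iff]
    intro i hi
    rw [map_pow]
    exact hn0 i hi
  · exact Ideal.absNorm_ne_zero_iff_mem_nonZeroDivisors.2 (mem_nonZeroDivisors_of_ne_zero hJ0)

theorem IsTotRam.absNorm_eq [IsGalois K L] {Q : HeightOneSpectrum (𝓞 L)}
    (h : IsTotRam K Q) (P : HeightOneSpectrum (𝓞 K)) [Q.asIdeal.LiesOver P.asIdeal] :
    Ideal.absNorm Q.asIdeal = Ideal.absNorm P.asIdeal := by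
  letI : Algebra (FractionRing (𝓞 K)) (FractionRing (𝓞 L)) := FractionRing.liftAlgebra _ _
  have : P.asIdeal.IsMaximal := P.isMaximal
  have : Q.asIdeal.IsMaximal := Q.isMaximal
  have h1 := (h.ncard_primesOver P).2
  rw [Ideal.inertiaDegIn_eq_inertiaDeg P.asIdeal Q.asIdeal Gal(L/K)] at h1
  rw [← Ideal.absNorm_relNorm (𝓞 K), Ideal.relNorm_eq_pow_of_isMaximal Q.asIdeal P.asIdeal, h1,
    pow_one]

theorem padicValNat_absNorm_pos {p : ℕ} [Fact p.Prime] (P : HeightOneSpectrum (𝓞 K))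
    (hP : (p : 𝓞 K) ∈ P.asIdeal) : 0 < padicValNat p (Ideal.absNorm P.asIdeal) := by
  have hp : p.Prime := Fact.out
  have h0 : Ideal.absNorm P.asIdeal ≠ 0 := Ideal.absNorm_ne_zero_iff_mem_nonZeroDivisors.2
      (mem_nonZeroDivisors_of_ne_zero P.ne_bot)
  refine Nat.pos_of_ne_zero fun h => ?_
  rw [padicValNat.eq_zero_iff] at h
  rcases h with h | h | h
  · exact hp.one_lt.ne' h
  · exact h0 h
  · have h1 : (Ideal.absNorm P.asIdeal : 𝓞 K) ∈ P.asIdeal := Ideal.absNorm_mem _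
    have h2 : Nat.Coprime p (Ideal.absNorm P.asIdeal) := (Nat.Prime.coprime_iff_not_dvd hp).2 h
    have h3 := Nat.isCoprime_iff_coprime.2 h2
    obtain ⟨a, b, hab⟩ := h3
    apply P.isPrime.ne_top
    rw [Ideal.eq_top_iff_one]
    have h4 : (a : 𝓞 K) * p + b * (Ideal.absNorm P.asIdeal : 𝓞 K) = 1 := by
      have := congrArg (Int.cast : ℤ → 𝓞 K) hab
      exact_mod_cast this
    rw [← h4]
    exact add_mem (Ideal.mul_mem_left _ _ hP) (Ideal.mul_mem_left _ _ h1)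

end

end ZpTower

namespace ZpTower

open Module
open IsDedekindDomain NumberField

variable {p : ℕ} [Fact p.Prime] {K : ℕ → IntermediateField ℚ (AlgebraicClosure ℚ)}
  [∀ n, NumberField (K n)] (T : IsZpTower p K)

/-- A prime of the bottom field which is totally ramified in the tower. -/
def IsTotRamIn (P : HeightOneSpectrum (𝓞 (K 0))) : Prop :=
  ∀ (i j : ℕ) (hij : i ≤ j) (Q : HeightOneSpectrum (𝓞 (K j))),
      letI := inclusionAlgebra (T.mono (Nat.zero_le j))
      letI := inclusionAlgebra (T.mono hij)
      Q.asIdeal.LiesOver P.asIdeal → IsTotRam (K i) Q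

/-- A prime of the bottom field which is unramified in the tower. -/
def IsUnramifiedIn (P : HeightOneSpectrum (𝓞 (K 0))) : Prop :=
  ∀ (i j : ℕ) (hij : i ≤ j) (Q : HeightOneSpectrum (𝓞 (K j))),
      letI := inclusionAlgebra (T.mono (Nat.zero_le j))
      letI := inclusionAlgebra (T.mono hij)
      Q.asIdeal.LiesOver P.asIdeal → Q.asIdeal.ramificationIdx (𝓞 (K i)) = 1

theorem liesOver_under {m i j : ℕ} (hmi : m ≤ i) (hij : i ≤ j)
    (Q : HeightOneSpectrum (𝓞 (K j))) (P : HeightOneSpectrum (𝓞 (K m))) :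
      letI := inclusionAlgebra (T.mono (hmi.trans hij))
      letI := inclusionAlgebra (T.mono hmi)
      letI := inclusionAlgebra (T.mono hij)
      Q.asIdeal.LiesOver P.asIdeal → ∃ Q' : HeightOneSpectrum (𝓞 (K i)),
        Q.asIdeal.LiesOver Q'.asIdeal ∧ Q'.asIdeal.LiesOver P.asIdeal := by
  letI := inclusionAlgebra (T.mono (hmi.trans hij))
  letI := inclusionAlgebra (T.mono hmi)
  letI := inclusionAlgebra (T.mono hij)
  intro hQ
  have := isScalarTower_inclusionAlgebra (T.mono hmi) (T.mono hij)
  have h : Q.asIdeal.LiesOver (HeightOneSpectrum.under (𝓞 (K i)) Q).asIdeal := ⟨rfl⟩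
  exact ⟨HeightOneSpectrum.under (𝓞 (K i)) Q, h, Ideal.LiesOver.tower_bot Q.asIdeal _ P.asIdeal⟩

theorem IsTotRamIn.exists_system {P : HeightOneSpectrum (𝓞 (K 0))} (h : IsTotRamIn T P) :
    ∃ Q : ∀ n, HeightOneSpectrum (𝓞 (K n)), IsTotRamSystem T.mono Q ∧
      ∀ n, letI := inclusionAlgebra (T.mono (Nat.zero_le n))
        (Q n).asIdeal.LiesOver P.asIdeal := by
  have hex : ∀ n, ∃ Q : HeightOneSpectrum (𝓞 (K n)),
      letI := inclusionAlgebra (T.mono (Nat.zero_le n))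
      Q.asIdeal.LiesOver P.asIdeal := fun n =>
    letI := inclusionAlgebra (T.mono (Nat.zero_le n))
    exists_heightOneSpectrum_liesOver P
  choose Q hQ using hex
  refine ⟨Q, ⟨fun {i j} hij => ?_, fun {i j} hij => h i j hij (Q j) (hQ j)⟩, hQ⟩
  obtain ⟨Q', h1, h2⟩ := liesOver_under T (Nat.zero_le i) hij (Q j) P (hQ j)
  letI := inclusionAlgebra (T.mono (Nat.zero_le i))
  have := T.isGalois (Nat.zero_le i)
  have := hQ i
  have h3 := (h 0 i (Nat.zero_le i) (Q i) (hQ i)).eq_of_liesOver P Q'.asIdeal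
  rwa [HeightOneSpectrum.ext h3] at h1

theorem exists_padicValNat_discr
    (hd : ∀ P : HeightOneSpectrum (𝓞 (K 0)), (p : 𝓞 (K 0)) ∈ P.asIdeal →
      IsTotRamIn T P ∨ IsUnramifiedIn T P)
    (hr : ∃ P : HeightOneSpectrum (𝓞 (K 0)), (p : 𝓞 (K 0)) ∈ P.asIdeal ∧ IsTotRamIn T P) :
    ∃ a b c : ℚ, 0 < a ∧ ∃ N : ℕ, ∀ n ≥ N,
      (padicValNat p (discr (K n)).natAbs : ℚ) = a * n * (p : ℚ) ^ n + b * (p : ℚ) ^ n + c := by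
  have hp : p.Prime := Fact.out
  have hfin : {P : HeightOneSpectrum (𝓞 (K 0)) | (p : 𝓞 (K 0)) ∈ P.asIdeal ∧
      IsTotRamIn T P}.Finite := by
    have hp0 : Ideal.span {(p : 𝓞 (K 0))} ≠ 0 := by
      simpa using hp.ne_zero
    refine (Ideal.finite_factors hp0).subset fun P hP => ?_
    simpa [Ideal.dvd_span_singleton] using hP.1
  set s := hfin.toFinset with hs
  have hsR : ∀ P, P ∈ s ↔ (p : 𝓞 (K 0)) ∈ P.asIdeal ∧ IsTotRamIn T P := fun P => by simp [hs]
  have hex : ∀ P, ∃ Q : ∀ n, HeightOneSpectrum (𝓞 (K n)), P ∈ s → IsTotRamSystem T.mono Q ∧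
      ∀ n, letI := inclusionAlgebra (T.mono (Nat.zero_le n))
        (Q n).asIdeal.LiesOver P.asIdeal := by
    intro P
    by_cases h : P ∈ s
    · obtain ⟨Q, hQ⟩ := IsTotRamIn.exists_system T ((hsR P).1 h).2
      exact ⟨Q, fun _ => hQ⟩
    · exact ⟨fun n => letI := inclusionAlgebra (T.mono (Nat.zero_le n))
        (exists_heightOneSpectrum_liesOver P).choose, fun h' => (h h').elim⟩
  choose Q hQ using hex
  have hlies : ∀ P ∈ s, ∀ n, letI := inclusionAlgebra (T.mono (Nat.zero_le n))
      (Q P n).asIdeal.LiesOver P.asIdeal := fun P hP => (hQ P hP).2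
  have hDex : ∀ P k, ∃ D : ℕ, letI := inclusionAlgebra (T.mono k.le_succ)
      emultiplicity (Q P (k + 1)).asIdeal (differentIdeal (𝓞 (K k)) (𝓞 (K (k + 1)))) = D := by
    intro P k
    letI := inclusionAlgebra (T.mono k.le_succ)
    letI : Algebra (FractionRing (𝓞 (K k))) (FractionRing (𝓞 (K (k + 1)))) :=
      FractionRing.liftAlgebra _ _
    exact ⟨_, (FiniteMultiplicity.of_prime_left (Q P (k + 1)).prime
      differentIdeal_ne_bot).emultiplicity_eq_multiplicity⟩
  choose D hD using hDex
  have hAB : ∀ P, ∃ A B : ℚ, ∃ N, P ∈ s → 0 < A ∧ ∀ k ≥ N, (D P k : ℚ) = A * (p : ℚ) ^ k + B := by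
    intro P
    by_cases h : P ∈ s
    · obtain ⟨hQs, hQl⟩ := hQ P h
      have hpQ : (p : 𝓞 (K 0)) ∈ (Q P 0).asIdeal := by
        have h1 := ((hsR P).1 h).1
        rw [(hQl 0).over, Ideal.under_def, Ideal.mem_comap, map_natCast] at h1
        exact h1
      have hpne : (p : K 0) ≠ 0 := by exact_mod_cast hp.ne_zero
      obtain ⟨e, he⟩ := exists_addVal_eq (Q P 0) hpne
      have h1 := (le_addVal_algebraMap_iff (L := K 0) (Q P 0) (r := (p : 𝓞 (K 0))) (n := 1)).2
        (by simpa using hpQ)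
      rw [map_natCast, he] at h1
      obtain ⟨A, B, hA, N, hN⟩ := hQs.exists_eventually_eq_linear T
        (by exact_mod_cast h1) he (hD P)
      exact ⟨A, B, N, fun _ => ⟨hA, hN⟩⟩
    · exact ⟨0, 0, 0, fun h' => (h h').elim⟩
  choose A B N hABN using hAB
  let f : HeightOneSpectrum (𝓞 (K 0)) → ℕ := fun P => padicValNat p (Ideal.absNorm P.asIdeal)
  have hrec : ∀ n, padicValNat p (discr (K (n + 1))).natAbs =
      p * padicValNat p (discr (K n)).natAbs + ∑ P ∈ s, D P n * f P := by
    intro n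
    letI := inclusionAlgebra (T.mono n.le_succ)
    letI := inclusionAlgebra (T.mono (Nat.zero_le (n + 1)))
    letI := inclusionAlgebra (T.mono (Nat.zero_le n))
    letI : Algebra (FractionRing (𝓞 (K n))) (FractionRing (𝓞 (K (n + 1)))) :=
      FractionRing.liftAlgebra _ _
    have := T.isGalois (Nat.zero_le (n + 1))
    have hd0 : differentIdeal (𝓞 (K n)) (𝓞 (K (n + 1))) ≠ ⊥ := differentIdeal_ne_bot
    rw [natAbs_discr_eq_absNorm_differentIdeal_mul_natAbs_discr_pow (K n) (𝓞 (K n)) (K (n + 1))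
      (𝓞 (K (n + 1))), padicValNat.mul
        (Ideal.absNorm_ne_zero_iff_mem_nonZeroDivisors.2 (mem_nonZeroDivisors_of_ne_zero hd0))
        (pow_ne_zero _ (Int.natAbs_ne_zero.2 (discr_ne_zero (K n)))),
      padicValNat.pow, T.finrank_eq n.le_succ,
      show n + 1 - n = 1 by omega, pow_one, add_comm]
    congr 1
    rw [padicValNat_absNorm hd0 s (fun P => Q P (n + 1)) ?_ (fun P => D P n)
      (fun P _ => hD P n) ?_]
    · refine Finset.sum_congr rfl fun P hP => ?_
      have := hlies P hP (n + 1)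
      rw [(((hsR P).1 hP).2 0 (n + 1) (Nat.zero_le _) (Q P (n + 1)) this).absNorm_eq P]
    · intro P hP P' hP' h
      have h1 := (hlies P hP (n + 1)).over
      have h2 := (hlies P' hP' (n + 1)).over
      have h3 : Q P (n + 1) = Q P' (n + 1) := h
      rw [← h3] at h2
      exact HeightOneSpectrum.ext (h1.trans h2.symm)
    · intro R hpR hRd
      set P := HeightOneSpectrum.under (𝓞 (K 0)) R with hP
      have hRP : R.asIdeal.LiesOver P.asIdeal := ⟨rfl⟩
      have hpP : (p : 𝓞 (K 0)) ∈ P.asIdeal := by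
        rw [Ideal.LiesOver.over (P := R.asIdeal) (p := P.asIdeal)]
        simpa [Ideal.mem_comap] using hpR
      rcases hd P hpP with h | h
      · have hPs : P ∈ s := (hsR P).2 ⟨hpP, h⟩
        refine ⟨P, hPs, ?_⟩
        have h1 := hlies P hPs (n + 1)
        exact HeightOneSpectrum.ext
          ((h 0 (n + 1) (Nat.zero_le _) R hRP).eq_of_liesOver P (Q P (n + 1)).asIdeal)
      · exfalso
        have h1 := emultiplicity_differentIdeal_eq_zero R (h n (n + 1) n.le_succ R hRP)
        exact emultiplicity_eq_zero.1 h1 hRd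
  obtain ⟨P₀, hP₀⟩ := hr
  have hA : 0 < ∑ P ∈ s, A P * f P := by
    refine Finset.sum_pos (fun P hP => ?_) ⟨P₀, (hsR P₀).2 hP₀⟩
    have h1 : 0 < f P := padicValNat_absNorm_pos P ((hsR P).1 hP).1
    have h2 := (hABN P hP).1
    positivity
  refine exists_eventually_eq_of_recursion hp.two_le
    (fun n => (padicValNat p (discr (K n)).natAbs : ℚ)) hA (B := ∑ P ∈ s, B P * f P)
    (N := s.sup N) fun n hn => ?_
  simp only [hrec n]
  push_cast
  rw [add_assoc, Finset.sum_mul, ← Finset.sum_add_distrib]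
  congr 1
  refine Finset.sum_congr rfl fun P hP => ?_
  rw [(hABN P hP).2 n ((Finset.le_sup hP).trans hn)]
  ring

end ZpTower

namespace ZpTower

open Module

section Lattice

variable {M : Type*} [AddCommGroup M] [Module.Free ℤ M] [Module.Finite ℤ M]

theorem index_range_nsmul (p : ℕ) [NeZero p] :
    (LinearMap.range (LinearMap.lsmul ℤ M (p : ℤ))).toAddSubgroup.index = p ^ finrank ℤ M := by
  classical
  let b := Module.finBasis ℤ M
  let φ : M →+ (Fin (finrank ℤ M) → ZMod p) :=
    { toFun := fun x i => ((b.repr x i : ℤ) : ZMod p)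
      map_zero' := by ext; simp
      map_add' := fun x y => by ext; simp }
  have hsurj : Function.Surjective φ := by
    intro y
    choose z hz using fun i => ZMod.intCast_surjective (y i)
    refine ⟨b.equivFun.symm z, ?_⟩
    ext i
    change ((b.repr (b.equivFun.symm z) i : ℤ) : ZMod p) = y i
    rw [← hz i, ← Basis.equivFun_apply, LinearEquiv.apply_symm_apply]
  have hker : φ.ker = (LinearMap.range (LinearMap.lsmul ℤ M (p : ℤ))).toAddSubgroup := by
    ext x
    rw [AddMonoidHom.mem_ker, Submodule.mem_toAddSubgroup, LinearMap.mem_range]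
    constructor
    · intro h
      have h1 : ∀ i, (p : ℤ) ∣ b.repr x i := fun i =>
        (ZMod.intCast_zmod_eq_zero_iff_dvd _ p).1 (congrFun h i)
      choose z hz using h1
      refine ⟨b.equivFun.symm z, ?_⟩
      apply b.equivFun.injective
      ext i
      rw [LinearMap.lsmul_apply, map_smul, LinearEquiv.apply_symm_apply, Pi.smul_apply,
        smul_eq_mul, Basis.equivFun_apply, hz i]
    · rintro ⟨y, rfl⟩
      ext i
      change ((b.repr ((p : ℤ) • y) i : ℤ) : ZMod p) = 0
      simp
  rw [← hker, AddSubgroup.index_ker, AddMonoidHom.range_eq_top.2 hsurj, AddSubgroup.card_top]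
  simp

/-- A lower bound for the index of the image of an endomorphism dividing `p` and a power of which
is divisible by `p`. -/
theorem pow_le_index_range (f : Module.End ℤ M) {p k r : ℕ} [NeZero p] (hk : k ≠ 0)
    (hr : finrank ℤ M = r * k) (h1 : ∀ x, ∃ y, f y = (p : ℤ) • x)
    (h2 : ∀ x, ∃ y, (f ^ k) x = (p : ℤ) • y) :
    (LinearMap.range f).toAddSubgroup.index ≠ 0 ∧
      p ^ r ≤ (LinearMap.range f).toAddSubgroup.index := by
  have hp := index_range_nsmul (M := M) p
  have hp0 : p ^ finrank ℤ M ≠ 0 := pow_ne_zero _ (NeZero.ne p)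
  have hle : (LinearMap.range (LinearMap.lsmul ℤ M (p : ℤ))).toAddSubgroup ≤
      (LinearMap.range f).toAddSubgroup := by
    rintro _ ⟨x, rfl⟩
    exact h1 x
  have h0 : (LinearMap.range f).toAddSubgroup.index ≠ 0 := fun h => by
    have := AddSubgroup.index_dvd_of_le hle
    rw [h, hp] at this
    exact hp0 (Nat.eq_zero_of_zero_dvd this)
  refine ⟨h0, ?_⟩
  have hpow : ∀ j : ℕ, (LinearMap.range (f ^ j)).toAddSubgroup.index ≤
      (LinearMap.range f).toAddSubgroup.index ^ j ∧
      (LinearMap.range (f ^ j)).toAddSubgroup.index ≠ 0 := by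
    intro j
    induction j with
    | zero =>
      have : (LinearMap.range (f ^ 0)).toAddSubgroup = ⊤ := by
        ext x
        simp
      rw [this, AddSubgroup.index_top]
      simp
    | succ j ih =>
      have e : (LinearMap.range (f ^ (j + 1))).toAddSubgroup =
          (LinearMap.range f).toAddSubgroup.map (f ^ j).toAddMonoidHom := by
        ext x
        constructor
        · rintro ⟨y, rfl⟩
          exact ⟨f y, ⟨y, rfl⟩, by simp [pow_succ]⟩
        · rintro ⟨_, ⟨y, rfl⟩, rfl⟩
          exact ⟨y, by simp [pow_succ]⟩
      have e' : (LinearMap.range (f ^ j)).toAddSubgroup = (f ^ j).toAddMonoidHom.range := rfl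
      rw [e, AddSubgroup.index_map, ← e', pow_succ']
      have h3 : (((LinearMap.range f).toAddSubgroup) ⊔ (f ^ j).toAddMonoidHom.ker).index ∣
        (LinearMap.range f).toAddSubgroup.index := AddSubgroup.index_dvd_of_le le_sup_left
      exact ⟨Nat.mul_le_mul (Nat.le_of_dvd (Nat.pos_of_ne_zero h0) h3) ih.1,
        mul_ne_zero (ne_zero_of_dvd_ne_zero h0 h3) ih.2⟩
  have hle' : (LinearMap.range (f ^ k)).toAddSubgroup ≤
      (LinearMap.range (LinearMap.lsmul ℤ M (p : ℤ))).toAddSubgroup := by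
    rintro _ ⟨x, rfl⟩
    obtain ⟨y, hy⟩ := h2 x
    exact ⟨y, hy.symm⟩
  have h4 := Nat.le_of_dvd (Nat.pos_of_ne_zero (hpow k).2) (AddSubgroup.index_dvd_of_le hle')
  rw [hp, hr, pow_mul] at h4
  exact le_of_pow_le_pow_left₀ hk (Nat.zero_le _) (h4.trans (hpow k).1)

theorem exists_cyclotomic_eq (p n : ℕ) [Fact p.Prime] : ∃ u : Polynomial ℤ,
    Polynomial.cyclotomic (p ^ (n + 1)) ℤ =
      (Polynomial.X - 1) ^ (p ^ (n + 1) - p ^ n) + Polynomial.C (p : ℤ) * u := by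
  have h : (Polynomial.cyclotomic (p ^ (n + 1)) ℤ -
      (Polynomial.X - 1) ^ (p ^ (n + 1) - p ^ n)).map (Int.castRingHom (ZMod p)) = 0 := by
    have := Polynomial.cyclotomic_mul_prime_pow_eq (ZMod p) (p := p) (m := 1)
      (Fact.out : p.Prime).not_dvd_one (Nat.succ_pos n)
    rw [mul_one, Polynomial.cyclotomic_one] at this
    simp [Polynomial.map_cyclotomic, this]
  have h' : Polynomial.C (p : ℤ) ∣ Polynomial.cyclotomic (p ^ (n + 1)) ℤ -
      (Polynomial.X - 1) ^ (p ^ (n + 1) - p ^ n) := by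
    rw [Polynomial.C_dvd_iff_dvd_coeff]
    intro i
    have := congrArg (fun q => Polynomial.coeff q i) h
    simp only [Polynomial.coeff_map, Polynomial.coeff_zero] at this
    exact (ZMod.intCast_zmod_eq_zero_iff_dvd _ p).1 this
  obtain ⟨u, hu⟩ := h'
  exact ⟨u, by rw [← hu]; ring⟩

theorem exists_cyclotomic_eq' (p n : ℕ) [Fact p.Prime] : ∃ w : Polynomial ℤ,
    Polynomial.cyclotomic (p ^ (n + 1)) ℤ = (Polynomial.X - 1) * w + Polynomial.C (p : ℤ) := by
  have h : Polynomial.X - Polynomial.C (1 : ℤ) ∣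
      Polynomial.cyclotomic (p ^ (n + 1)) ℤ - Polynomial.C (p : ℤ) := by
    rw [Polynomial.dvd_iff_isRoot]
    simp [Polynomial.eval_one_cyclotomic_prime_pow]
  obtain ⟨w, hw⟩ := h
  exact ⟨w, by rw [← Polynomial.C_1, ← hw]; ring⟩

end Lattice

end ZpTower

namespace ZpTower

open Module

theorem index_sup_layer {M : Type*} [AddCommGroup M] [Module.Free ℤ M] [Module.Finite ℤ M]
    {p r n : ℕ} [Fact p.Prime] (σ : Module.End ℤ M) (hσ : σ ^ p ^ (n + 1) = 1)
    (hr : finrank ℤ M = finrank ℤ (LinearMap.ker (σ ^ p ^ n - 1)) + r * (p ^ (n + 1) - p ^ n)) :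
    let S := LinearMap.range (σ - 1) ⊔ LinearMap.ker (σ ^ p ^ n - 1)
    (S.toAddSubgroup.index ≠ 0 ∧ p ^ r ≤ S.toAddSubgroup.index) ∧
    ∀ x, σ x - x ∈ LinearMap.ker (σ ^ p ^ n - 1) → x ∈ LinearMap.ker (σ ^ p ^ n - 1) := by
  intro S
  have hp : p.Prime := Fact.out
  have : NeZero p := ⟨hp.ne_zero⟩
  set N := LinearMap.ker (σ ^ p ^ n - 1) with hN
  obtain ⟨u, hu⟩ := exists_cyclotomic_eq p n
  obtain ⟨w, hw⟩ := exists_cyclotomic_eq' p n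
  have hΦ : ∀ x, Polynomial.aeval σ (Polynomial.cyclotomic (p ^ (n + 1)) ℤ) x ∈ N := by
    intro x
    have h := congrArg (Polynomial.aeval σ)
      ((mul_comm _ _).trans (Polynomial.cyclotomic_prime_pow_mul_X_pow_sub_one ℤ p n))
    simp only [map_mul, map_sub, map_pow, Polynomial.aeval_X, map_one, hσ, sub_self] at h
    exact LinearMap.congr_fun h x
  have hu' : ∀ x, ((σ - 1) ^ (p ^ (n + 1) - p ^ n)) x +
      (p : ℤ) • Polynomial.aeval σ u x ∈ N := by
    intro x
    have := hΦ x
    rw [hu] at this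
    simpa [map_mul, Polynomial.aeval_C] using this
  have hw' : ∀ x, (σ - 1) (Polynomial.aeval σ w x) + (p : ℤ) • x ∈ N := by
    intro x
    have := hΦ x
    rw [hw] at this
    simpa [map_mul, Polynomial.aeval_C] using this
  have hcomm : ∀ q : Polynomial ℤ, ∀ x ∈ N, Polynomial.aeval σ q x ∈ N := by
    intro q x hx
    rw [hN, LinearMap.mem_ker] at hx ⊢
    have h1 : σ ^ p ^ n - 1 = Polynomial.aeval σ (Polynomial.X ^ p ^ n - 1 : Polynomial ℤ) := by
      simp
    rw [h1] at hx ⊢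
    rw [← Module.End.mul_apply, ← map_mul, mul_comm, map_mul, Module.End.mul_apply, hx, map_zero]
  have hD : N ≤ N.comap (σ - 1) := by
    intro x hx
    have := hcomm (Polynomial.X - 1) x hx
    simpa using this
  have hsat : ∀ x, (p : ℤ) • x ∈ N → x ∈ N := by
    intro x hx
    rw [hN, LinearMap.mem_ker] at hx ⊢
    rw [map_smul] at hx
    exact (smul_eq_zero.1 hx).resolve_left (by exact_mod_cast hp.ne_zero)
  refine ⟨?_, fun x hx => ?_⟩
  · let f : Module.End ℤ (M ⧸ N) := N.mapQ N (σ - 1) hD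
    have hfree : Module.Free ℤ (M ⧸ N) :=
      Module.Free.of_equiv (LinearMap.quotKerEquivRange (σ ^ p ^ n - 1)).symm
    have hrank : finrank ℤ (M ⧸ N) = r * (p ^ (n + 1) - p ^ n) := by
      have := Submodule.finrank_quotient_add_finrank N
      omega
    have hk : p ^ (n + 1) - p ^ n ≠ 0 := by
      have : p ^ n < p ^ (n + 1) := Nat.pow_lt_pow_right hp.one_lt n.lt_succ_self
      omega
    have key := pow_le_index_range (p := p) f hk hrank ?_ ?_
    · have hS : S.toAddSubgroup = (LinearMap.range f).toAddSubgroup.comap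
          (N.mkQ).toAddMonoidHom := by
        ext x
        rw [Submodule.mem_toAddSubgroup, Submodule.mem_sup]
        constructor
        · rintro ⟨_, ⟨y, rfl⟩, z, hz, rfl⟩
          refine ⟨N.mkQ y, ?_⟩
          change f (N.mkQ y) = N.mkQ ((σ - 1) y + z)
          have hz' : N.mkQ z = 0 := (Submodule.Quotient.mk_eq_zero N).2 hz
          rw [map_add, hz', add_zero]
          rfl
        · rintro ⟨y, hy⟩
          obtain ⟨y, rfl⟩ := N.mkQ_surjective y
          have hy' : N.mkQ ((σ - 1) y) = N.mkQ x := hy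
          have := (Submodule.Quotient.eq N).1 hy'.symm
          exact ⟨_, ⟨y, rfl⟩, _, this, by abel⟩
      rw [hS, AddSubgroup.index_comap_of_surjective _ N.mkQ_surjective]
      exact key
    · intro x
      obtain ⟨x, rfl⟩ := N.mkQ_surjective x
      refine ⟨-N.mkQ (Polynomial.aeval σ w x), ?_⟩
      have := (Submodule.Quotient.mk_eq_zero N).2 (hw' x)
      have h2 : f (N.mkQ (Polynomial.aeval σ w x)) + (p : ℤ) • N.mkQ x = 0 := this
      rw [map_neg, neg_eq_iff_add_eq_zero, h2]
    · intro x
      obtain ⟨x, rfl⟩ := N.mkQ_surjective x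
      refine ⟨-N.mkQ (Polynomial.aeval σ u x), ?_⟩
      have := (Submodule.Quotient.mk_eq_zero N).2 (hu' x)
      rw [← Submodule.mapQ_pow N hD]
      have h2 : N.mkQ (((σ - 1) ^ (p ^ (n + 1) - p ^ n)) x) +
        (p : ℤ) • N.mkQ (Polynomial.aeval σ u x) = 0 := this
      rw [smul_neg, ← add_eq_zero_iff_eq_neg, ← h2]
      rfl
  · apply hsat
    have h1 := hw' x
    have h2 : (σ - 1) (Polynomial.aeval σ w x) = Polynomial.aeval σ w (σ x - x) := by
      have h3 : σ - 1 = Polynomial.aeval σ (Polynomial.X - 1 : Polynomial ℤ) := by simp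
      have h4 : σ x - x = (σ - 1) x := rfl
      rw [h4, h3, ← Module.End.mul_apply, ← map_mul, mul_comm, map_mul, Module.End.mul_apply]
    rw [h2] at h1
    exact (N.add_mem_iff_right (hcomm w _ hx)).1 h1

/-- Let `σ` be an automorphism of order `p ^ n` of a lattice, such that the fixed lattice of
`σ ^ p ^ i` has rank `r * p ^ i - 1` for all `i ≤ n`. Then the image and the kernel of `σ - 1`
generate a sublattice of index at least `p ^ (r * n)`. -/
theorem pow_le_index_range_sup_ker {p r : ℕ} [Fact p.Prime] (n : ℕ) :
    ∀ {M : Type*} [AddCommGroup M] [Module.Free ℤ M] [Module.Finite ℤ M]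
    (σ : Module.End ℤ M) (_ : σ ^ p ^ n = 1)
    (_ : ∀ i ≤ n, finrank ℤ (LinearMap.ker (σ ^ p ^ i - 1)) + 1 = r * p ^ i),
    (LinearMap.range (σ - 1) ⊔ LinearMap.ker (σ - 1)).toAddSubgroup.index ≠ 0 ∧
      p ^ (r * n) ≤ (LinearMap.range (σ - 1) ⊔ LinearMap.ker (σ - 1)).toAddSubgroup.index := by
  have hp : p.Prime := Fact.out
  induction n with
  | zero =>
    intro M _ _ _ σ hσ hr
    have h : LinearMap.range (σ - 1) ⊔ LinearMap.ker (σ - 1) = ⊤ := by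
      rw [pow_zero, pow_one] at hσ
      simp [hσ]
    simp [h]
  | succ n ih =>
    intro M _ _ _ σ hσ hr
    have htop : finrank ℤ M + 1 = r * p ^ (n + 1) := by
      rw [← hr (n + 1) le_rfl, hσ, sub_self, LinearMap.ker_zero, finrank_top]
    have hlt := Nat.pow_lt_pow_right hp.one_lt n.lt_succ_self
    obtain ⟨⟨h0, h1⟩, h2⟩ := index_sup_layer (r := r) σ hσ (by
      have h3 := hr n n.le_succ
      have h4 : r * (p ^ (n + 1) - p ^ n) + r * p ^ n = r * p ^ (n + 1) := by
        rw [← mul_add, Nat.sub_add_cancel hlt.le]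
      omega)
    set N := LinearMap.ker (σ ^ p ^ n - 1) with hN
    have hσN : ∀ x ∈ N, σ x ∈ N := by
      intro x hx
      rw [hN, LinearMap.mem_ker, LinearMap.sub_apply, Module.End.one_apply, sub_eq_zero] at hx ⊢
      rw [← Module.End.mul_apply, ← pow_succ, pow_succ', Module.End.mul_apply, hx]
    have hker : ∀ i ≤ n, LinearMap.ker (σ ^ p ^ i - 1) ≤ N := by
      intro i hi x hx
      rw [hN, LinearMap.mem_ker, LinearMap.sub_apply, Module.End.one_apply, sub_eq_zero] at *
      obtain ⟨k, hk⟩ := pow_dvd_pow p hi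
      rw [hk, pow_mul, Module.End.pow_apply]
      exact Function.iterate_fixed hx k
    let τ : Module.End ℤ N := σ.restrict hσN
    have hτ : ∀ (i : ℕ) (x : N), (((τ ^ i) x : N) : M) = (σ ^ i) x := by
      intro i x
      rw [Module.End.pow_restrict]
      rfl
    have hkerτ : ∀ i ≤ n, LinearMap.ker (τ ^ p ^ i - 1) =
        (LinearMap.ker (σ ^ p ^ i - 1)).comap N.subtype := by
      intro i hi
      ext x
      rw [Submodule.mem_comap, LinearMap.mem_ker, LinearMap.mem_ker, Subtype.ext_iff]
      simp [hτ]
    obtain ⟨h3, h4⟩ := ih τ (by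
        ext x
        rw [hτ]
        have : (x : M) ∈ LinearMap.ker (σ ^ p ^ n - 1) := x.2
        rw [LinearMap.mem_ker, LinearMap.sub_apply, Module.End.one_apply, sub_eq_zero] at this
        exact this) (fun i hi => by
        rw [← hr i (hi.trans n.le_succ), hkerτ i hi]
        congr 1
        exact (Submodule.comapSubtypeEquivOfLe (hker i hi)).finrank_eq)
    have hk0 : LinearMap.ker (σ - 1) ≤ N := by simpa using hker 0 (Nat.zero_le n)
    have hle : (LinearMap.range (σ - 1) ⊔ LinearMap.ker (σ - 1)).toAddSubgroup ≤
        (LinearMap.range (σ - 1) ⊔ N).toAddSubgroup :=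
      Submodule.toAddSubgroup_mono (sup_le_sup_left hk0 _)
    have hrel : (LinearMap.range (σ - 1) ⊔ LinearMap.ker (σ - 1)).toAddSubgroup.relIndex
        (LinearMap.range (σ - 1) ⊔ N).toAddSubgroup =
        (LinearMap.range (τ - 1) ⊔ LinearMap.ker (τ - 1)).toAddSubgroup.index := by
      have e1 : (LinearMap.range (σ - 1) ⊔ N).toAddSubgroup =
          N.toAddSubgroup ⊔
            (LinearMap.range (σ - 1) ⊔ LinearMap.ker (σ - 1)).toAddSubgroup := by
        rw [← Submodule.sup_toAddSubgroup]
        congr 1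
        rw [sup_comm N, sup_assoc, sup_eq_right.2 hk0]
      rw [e1, AddSubgroup.relIndex_sup_right, AddSubgroup.relIndex]
      congr 1
      ext x
      rw [AddSubgroup.mem_addSubgroupOf, Submodule.mem_toAddSubgroup, Submodule.mem_toAddSubgroup,
        Submodule.mem_sup, Submodule.mem_sup]
      have hk1 := hkerτ 0 (Nat.zero_le n)
      rw [pow_zero, pow_one, pow_one] at hk1
      constructor
      · rintro ⟨_, ⟨y, rfl⟩, z, hz, hyz⟩
        have hzN := hk0 hz
        have hy : y ∈ N := h2 y (by
          have h5 : σ y - y = (x : M) - z := by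
            rw [← hyz, add_sub_cancel_right]
            rfl
          rw [h5]
          exact N.sub_mem x.2 hzN)
        refine ⟨_, ⟨⟨y, hy⟩, rfl⟩, ⟨z, hzN⟩, ?_, ?_⟩
        · rw [hk1]
          exact hz
        · ext
          exact hyz
      · rintro ⟨_, ⟨y, rfl⟩, z, hz, rfl⟩
        rw [hk1] at hz
        exact ⟨_, ⟨y, rfl⟩, z, hz, rfl⟩
    rw [← AddSubgroup.relIndex_mul_index hle, hrel]
    refine ⟨mul_ne_zero h3 h0, ?_⟩
    rw [mul_add, pow_add, mul_one]
    exact Nat.mul_le_mul h4 h1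

end ZpTower

namespace ZpTower

set_option maxSynthPendingDepth 3

open Module
open IsDedekindDomain NumberField

theorem index_range_sup_range_le {E E₀ : Type*} [AddCommGroup E] [AddCommGroup E₀] {N c a : ℕ}
    (d : E →+ E) (ν : E →+ E₀) (ι : E₀ →+ E) (hνι : ∀ x, ν (ι x) = N • x)
    (hνd : ∀ x, ν (d x) = 0) (hc : (nsmulAddMonoidHom (α := E₀) N).range.index ≤ c)
    (hc0 : (nsmulAddMonoidHom (α := E₀) N).range.index ≠ 0)
    (ha : d.range.relIndex ν.ker ≤ a) (ha0 : d.range.relIndex ν.ker ≠ 0) :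
    (d.range ⊔ ι.range).index ≠ 0 ∧ (d.range ⊔ ι.range).index ≤ a * c := by
  have h1 : (ι.range ⊔ ν.ker).index ∣ (nsmulAddMonoidHom (α := E₀) N).range.index := by
    have : (nsmulAddMonoidHom (α := E₀) N).range = ι.range.map ν := by
      ext x
      constructor
      · rintro ⟨y, rfl⟩
        exact ⟨_, ⟨y, rfl⟩, hνι y⟩
      · rintro ⟨_, ⟨y, rfl⟩, rfl⟩
        exact ⟨y, (hνι y).symm⟩
    rw [this, AddSubgroup.index_map]
    exact Dvd.intro _ rfl
  have hle : d.range ≤ ν.ker := by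
    rintro _ ⟨x, rfl⟩
    exact hνd x
  have h2 : (d.range ⊔ ι.range).relIndex (ν.ker ⊔ (d.range ⊔ ι.range)) ∣
      d.range.relIndex ν.ker := by
    rw [AddSubgroup.relIndex_sup_right]
    exact AddSubgroup.relIndex_dvd_of_le_left _ le_sup_left
  have h3 : ν.ker ⊔ (d.range ⊔ ι.range) = ι.range ⊔ ν.ker := by
    rw [← sup_assoc, sup_eq_left.2 hle, sup_comm]
  have h4 := AddSubgroup.relIndex_mul_index
    (show d.range ⊔ ι.range ≤ ν.ker ⊔ (d.range ⊔ ι.range) from le_sup_right)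
  rw [← h4]
  nth_rw 2 [h3]
  nth_rw 3 [h3]
  exact ⟨mul_ne_zero (ne_zero_of_dvd_ne_zero ha0 h2) (ne_zero_of_dvd_ne_zero hc0 h1),
    Nat.mul_le_mul ((Nat.le_of_dvd (Nat.pos_of_ne_zero ha0) h2).trans ha)
      ((Nat.le_of_dvd (Nat.pos_of_ne_zero hc0) h1).trans hc)⟩

variable (k : Type*) [Field k] [NumberField k]

/-- The projection from the units to the units modulo torsion, written additively. -/
def unitsModTorsion : Additive (𝓞 k)ˣ →+ Additive ((𝓞 k)ˣ ⧸ Units.torsion k) :=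
  (QuotientGroup.mk' (Units.torsion k)).toAdditive

theorem unitsModTorsion_surjective : Function.Surjective (unitsModTorsion k) :=
  QuotientGroup.mk'_surjective (Units.torsion k)

theorem unitsModTorsion_eq_zero_iff {u : Additive (𝓞 k)ˣ} :
    unitsModTorsion k u = 0 ↔ u.toMul ∈ Units.torsion k :=
  QuotientGroup.eq_one_iff u.toMul

theorem index_range_nsmul_units (N : ℕ) [NeZero N] :
    (nsmulAddMonoidHom (α := Additive (𝓞 k)ˣ) N).range.index ≠ 0 ∧
    (nsmulAddMonoidHom (α := Additive (𝓞 k)ˣ) N).range.index ≤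
      Nat.card (Units.torsion k) * N ^ Units.rank k := by
  set R := (nsmulAddMonoidHom (α := Additive (𝓞 k)ˣ) N).range
  have h1 : (R ⊔ (unitsModTorsion k).ker).index = N ^ Units.rank k := by
    have h0 := index_range_nsmul (M := Additive ((𝓞 k)ˣ ⧸ Units.torsion k)) N
    rw [Units.finrank_modTorsion] at h0
    rw [← h0]
    have h : (LinearMap.range (LinearMap.lsmul ℤ (Additive ((𝓞 k)ˣ ⧸ Units.torsion k))
        (N : ℤ))).toAddSubgroup = R.map (unitsModTorsion k) := by
      ext x
      constructor
      · rintro ⟨y, rfl⟩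
        obtain ⟨y, rfl⟩ := unitsModTorsion_surjective k y
        refine ⟨_, ⟨y, rfl⟩, ?_⟩
        change unitsModTorsion k (N • y) = (N : ℤ) • unitsModTorsion k y
        rw [map_nsmul, natCast_zsmul]
      · rintro ⟨_, ⟨y, rfl⟩, rfl⟩
        refine ⟨unitsModTorsion k y, ?_⟩
        change (N : ℤ) • unitsModTorsion k y = unitsModTorsion k (N • y)
        rw [map_nsmul, natCast_zsmul]
    rw [h, AddSubgroup.index_map,
      AddMonoidHom.range_eq_top.2 (unitsModTorsion_surjective k), AddSubgroup.index_top, mul_one]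
  have hcard : Nat.card (unitsModTorsion k).ker = Nat.card (Units.torsion k) :=
    Nat.card_congr (Additive.toMul.subtypeEquiv fun u => unitsModTorsion_eq_zero_iff k)
  have hfin : Finite (unitsModTorsion k).ker :=
    Nat.finite_of_card_ne_zero (by rw [hcard]; exact Nat.card_pos.ne')
  have h2 : R.relIndex ((unitsModTorsion k).ker ⊔ R) ∣ Nat.card (Units.torsion k) := by
    rw [AddSubgroup.relIndex_sup_right, ← hcard]
    exact AddSubgroup.index_dvd_card _
  have h3 := AddSubgroup.relIndex_mul_index (show R ≤ (unitsModTorsion k).ker ⊔ R from le_sup_right)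
  rw [sup_comm _ R, h1] at h3
  rw [sup_comm] at h2
  rw [← h3]
  exact ⟨mul_ne_zero (ne_zero_of_dvd_ne_zero Nat.card_pos.ne' h2)
    (pow_ne_zero _ (NeZero.ne N)), Nat.mul_le_mul_right _ (Nat.le_of_dvd Nat.card_pos h2)⟩

end ZpTower

namespace ZpTower

set_option maxSynthPendingDepth 3

open Module
open IsDedekindDomain NumberField

section Units

variable {k F L : Type*} [Field k] [Field F] [Field L] [NumberField k] [NumberField F]
  [NumberField L] [Algebra k L] [Algebra F L]

/-- The action of a field automorphism on the units of the ring of integers. -/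
def galUnits (g : Gal(L/k)) : (𝓞 L)ˣ →* (𝓞 L)ˣ :=
  Units.map (MulSemiringAction.toRingHom Gal(L/k) (𝓞 L) g : 𝓞 L →* 𝓞 L)

theorem coe_galUnits (g : Gal(L/k)) (u : (𝓞 L)ˣ) :
    ((galUnits g u : (𝓞 L)ˣ) : L) = g (u : L) := rfl

variable (F L) in
/-- The inclusion of the units of the ring of integers of a subfield. -/
def unitsInclusion : (𝓞 F)ˣ →* (𝓞 L)ˣ :=
  Units.map (algebraMap (𝓞 F) (𝓞 L) : 𝓞 F →* 𝓞 L)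

theorem mem_torsion_iff_exists_pow_eq_one {u : (𝓞 L)ˣ} :
    u ∈ Units.torsion L ↔ ∃ n, 0 < n ∧ u ^ n = 1 := by
  rw [Units.torsion, CommGroup.mem_torsion, isOfFinOrder_iff_pow_eq_one]

theorem torsion_le_comap (f : (𝓞 F)ˣ →* (𝓞 L)ˣ) :
    Units.torsion F ≤ (Units.torsion L).comap f := by
  intro u hu
  rw [mem_torsion_iff_exists_pow_eq_one] at hu
  rw [Subgroup.mem_comap, mem_torsion_iff_exists_pow_eq_one]
  obtain ⟨n, hn, h⟩ := hu
  exact ⟨n, hn, by rw [← map_pow, h, map_one]⟩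

/-- The map induced on units modulo torsion. -/
def latticeMap (f : (𝓞 F)ˣ →* (𝓞 L)ˣ) :
    Additive ((𝓞 F)ˣ ⧸ Units.torsion F) →ₗ[ℤ] Additive ((𝓞 L)ˣ ⧸ Units.torsion L) :=
  (QuotientGroup.map _ _ f (torsion_le_comap f)).toAdditive.toIntLinearMap

theorem latticeMap_apply (f : (𝓞 F)ˣ →* (𝓞 L)ˣ) (u : Additive (𝓞 F)ˣ) :
    latticeMap f (unitsModTorsion F u) = unitsModTorsion L (f.toAdditive u) := rfl

theorem exists_unitsInclusion_eq {g : Gal(L/k)}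
    (h : ∀ x : L, g x = x → ∃ y : F, algebraMap F L y = x) {u : (𝓞 L)ˣ} (hu : galUnits g u = u) :
    ∃ v, unitsInclusion F L v = u := by
  have hu' : ∀ {u : (𝓞 L)ˣ}, galUnits g u = u →
      ∃ y : 𝓞 F, algebraMap (𝓞 F) (𝓞 L) y = u := by
    intro u hu
    obtain ⟨y, hy⟩ := h (u : L) (by rw [← coe_galUnits, hu])
    have hint : IsIntegral ℤ y := by
      rw [← isIntegral_algebraMap_iff (algebraMap F L).injective, hy]
      exact RingOfIntegers.isIntegral_coe _
    exact ⟨⟨y, hint⟩, RingOfIntegers.ext hy⟩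
  obtain ⟨y, hy⟩ := hu' hu
  obtain ⟨z, hz⟩ := hu' (u := u⁻¹) (by rw [map_inv, hu])
  have hinj : Function.Injective (algebraMap (𝓞 F) (𝓞 L)) := FaithfulSMul.algebraMap_injective _ _
  refine ⟨⟨y, z, hinj ?_, hinj ?_⟩, Units.ext hy⟩
  · rw [map_mul, hy, hz, map_one, Units.mul_inv]
  · rw [map_mul, hy, hz, map_one, Units.inv_mul]

theorem finrank_ker_latticeMap (g : Gal(L/k)) (h1 : ∀ y : F, g (algebraMap F L y) = algebraMap F L y)
    (h2 : ∀ x : L, g x = x → ∃ y : F, algebraMap F L y = x) :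
    finrank ℤ (LinearMap.ker (latticeMap (galUnits g) - 1)) = Units.rank F := by
  set S := LinearMap.ker (latticeMap (galUnits g) - 1) with hS
  set R := LinearMap.range (latticeMap (unitsInclusion F L)) with hR
  have hinj : Function.Injective (latticeMap (unitsInclusion F L)) := by
    rw [injective_iff_map_eq_zero]
    intro x hx
    obtain ⟨u, rfl⟩ := unitsModTorsion_surjective F x
    rw [latticeMap_apply, unitsModTorsion_eq_zero_iff, mem_torsion_iff_exists_pow_eq_one] at hx
    rw [unitsModTorsion_eq_zero_iff, mem_torsion_iff_exists_pow_eq_one]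
    obtain ⟨n, hn, h⟩ := hx
    refine ⟨n, hn, ?_⟩
    have h' : unitsInclusion F L (u.toMul ^ n) = 1 := by rw [map_pow]; exact h
    have h'' : Function.Injective (unitsInclusion F L) :=
      Units.map_injective (FaithfulSMul.algebraMap_injective (𝓞 F) (𝓞 L))
    exact h'' (h'.trans (map_one _).symm)
  have hRr : finrank ℤ R = Units.rank F := by
    rw [LinearMap.finrank_range_of_inj hinj, Units.finrank_modTorsion]
  have hRS : R ≤ S := by
    rintro _ ⟨x, rfl⟩
    obtain ⟨u, rfl⟩ := unitsModTorsion_surjective F x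
    rw [hS, LinearMap.mem_ker, LinearMap.sub_apply, Module.End.one_apply, sub_eq_zero,
      latticeMap_apply, latticeMap_apply]
    congr 1
    apply Additive.toMul.injective
    apply Units.coe_injective L
    exact h1 _
  set w := Nat.card (Units.torsion L) with hw
  have hw0 : (w : ℤ) ≠ 0 := by exact_mod_cast Nat.card_pos.ne'
  have hSR : ∀ x ∈ S, (w : ℤ) • x ∈ R := by
    intro x hx
    obtain ⟨u, rfl⟩ := unitsModTorsion_surjective L x
    rw [hS, LinearMap.mem_ker, LinearMap.sub_apply, Module.End.one_apply, 
      latticeMap_apply, ← map_sub, unitsModTorsion_eq_zero_iff] at hx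
    have hx' : (galUnits g u.toMul / u.toMul) ^ w = 1 := by
      have := pow_card_eq_one' (x := (⟨_, hx⟩ : Units.torsion L))
      exact congrArg Subtype.val this
    rw [div_pow, div_eq_one, ← map_pow] at hx'
    obtain ⟨v, hv⟩ := exists_unitsInclusion_eq h2 hx'
    refine ⟨unitsModTorsion F (Additive.ofMul v), ?_⟩
    rw [latticeMap_apply, natCast_zsmul, ← map_nsmul]
    congr 1
  refine le_antisymm ?_ (hRr ▸ Submodule.finrank_mono hRS)
  rw [← hRr]
  let f : S →ₗ[ℤ] R := ((LinearMap.lsmul ℤ _ (w : ℤ)).comp S.subtype).codRestrict R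
    fun x => hSR x x.2
  refine LinearMap.finrank_le_finrank_of_injective (f := f) fun x y hxy => ?_
  have h3 : (w : ℤ) • (x : Additive ((𝓞 L)ˣ ⧸ Units.torsion L)) = (w : ℤ) • (y : _) :=
    congrArg Subtype.val hxy
  exact Subtype.ext (smul_right_injective _ hw0 h3)

theorem latticeMap_galUnits_pow (g : Gal(L/k)) (i : ℕ) :
    latticeMap (galUnits g) ^ i = latticeMap (galUnits (g ^ i)) := by
  induction i with
  | zero =>
    ext x
    obtain ⟨u, rfl⟩ := unitsModTorsion_surjective L x
    rw [pow_zero, pow_zero, latticeMap_apply]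
    rfl
  | succ i ih =>
    ext x
    obtain ⟨u, rfl⟩ := unitsModTorsion_surjective L x
    rw [pow_succ, ih, pow_succ, latticeMap_apply, Module.End.mul_apply, latticeMap_apply,
      latticeMap_apply]
    rfl

theorem pow_le_index_units [IsGalois k L] {p n : ℕ} [Fact p.Prime] (hp2 : p ≠ 2) (σ : Gal(L/k))
    (hσ : ∀ x, x ∈ Subgroup.zpowers σ) (hn : finrank k L = p ^ n) :
    p ^ (Fintype.card (InfinitePlace k) * n) ≤
      (LinearMap.range (latticeMap (galUnits σ) - 1) ⊔
        LinearMap.ker (latticeMap (galUnits σ) - 1)).toAddSubgroup.index := by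
  have hp : p.Prime := Fact.out
  have hσo : orderOf σ = p ^ n := by
    rw [orderOf_eq_card_of_forall_mem_zpowers hσ, IsGalois.card_aut_eq_finrank, hn]
  refine (pow_le_index_range_sup_ker n (latticeMap (galUnits σ)) ?_ fun i hi => ?_).2
  · rw [latticeMap_galUnits_pow, ← hσo, pow_orderOf_eq_one, ← pow_zero σ,
      ← latticeMap_galUnits_pow, pow_zero]
  · rw [latticeMap_galUnits_pow]
    have hcomm : ∀ x y : Gal(L/k), x * y = y * x := by
      intro x y
      obtain ⟨a, rfl⟩ := hσ x
      obtain ⟨b, rfl⟩ := hσ y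
      exact zpow_mul_comm σ a b
    let H := Subgroup.zpowers (σ ^ p ^ i)
    have hH : H.Normal := ⟨fun x hx y => by rwa [hcomm y x, mul_inv_cancel_right]⟩
    let F := IntermediateField.fixedField H
    have : IsGalois k F := IsGalois.of_fixedField_normal_subgroup H
    have hF : finrank k F = p ^ i := by
      have h1 : finrank F L = p ^ (n - i) := by
        rw [IntermediateField.finrank_fixedField_eq_card, Nat.card_zpowers,
          orderOf_pow_of_dvd (pow_ne_zero _ hp.ne_zero) (hσo ▸ pow_dvd_pow p hi), hσo,
          Nat.pow_div hi hp.pos]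
      have h2 := finrank_mul_finrank k F L
      rw [h1, hn, ← Nat.add_sub_cancel' hi, pow_add, Nat.add_sub_cancel_left] at h2
      exact Nat.eq_of_mul_eq_mul_right (pow_pos hp.pos _) h2
    have hodd : IsUnramifiedAtInfinitePlaces k F :=
      IsUnramifiedAtInfinitePlaces_of_odd_finrank (by
        rw [hF]
        exact (hp.odd_of_ne_two hp2).pow)
    have hcard := IsUnramifiedAtInfinitePlaces.card_infinitePlace k F
    rw [finrank_ker_latticeMap (F := F) (σ ^ p ^ i), Units.rank, ← hF, ← hcard,
      Nat.sub_add_cancel Fintype.card_pos]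
    · intro y
      exact y.2 ⟨σ ^ p ^ i, Subgroup.mem_zpowers _⟩
    · intro x hx
      refine ⟨⟨x, ?_⟩, rfl⟩
      rintro ⟨_, a, rfl⟩
      have h3 : σ ^ p ^ i ∈ MulAction.stabilizer Gal(L/k) x := hx
      exact zpow_mem h3 a

theorem pow_le_relIndex_mul_torsion [IsGalois k L] {p n a : ℕ} [Fact p.Prime] (hp2 : p ≠ 2)
    (σ : Gal(L/k)) (hσ : ∀ x, x ∈ Subgroup.zpowers σ) (hn : finrank k L = p ^ n)
    (ha : ((galUnits σ).toAdditive - AddMonoidHom.id _).range.relIndex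
      (Units.map (RingOfIntegers.norm k : 𝓞 L →* 𝓞 k)).toAdditive.ker ≤ a)
    (ha0 : ((galUnits σ).toAdditive - AddMonoidHom.id _).range.relIndex
      (Units.map (RingOfIntegers.norm k : 𝓞 L →* 𝓞 k)).toAdditive.ker ≠ 0) :
    p ^ n ≤ a * Nat.card (Units.torsion k) := by
  have hp : p.Prime := Fact.out
  have : NeZero (p ^ n) := ⟨pow_ne_zero _ hp.ne_zero⟩
  obtain ⟨hc0, hc⟩ := index_range_nsmul_units k (p ^ n)
  have hνι : ∀ x, (Units.map (RingOfIntegers.norm k : 𝓞 L →* 𝓞 k)).toAdditive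
      ((unitsInclusion k L).toAdditive x) = (p ^ n) • x := by
    intro x
    apply Additive.toMul.injective
    apply Units.coe_injective k
    have := Algebra.norm_algebraMap (S := L) ((x.toMul : (𝓞 k)ˣ) : k)
    rw [hn] at this
    refine Eq.trans ?_ (this.trans ?_)
    · rfl
    · rw [toMul_nsmul]
      beta_reduce
      rw [Units.val_pow_eq_pow_val, map_pow]
  have hνd : ∀ x, (Units.map (RingOfIntegers.norm k : 𝓞 L →* 𝓞 k)).toAdditive
      (((galUnits σ).toAdditive - AddMonoidHom.id (Additive (𝓞 L)ˣ)) x) = 0 := by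
    intro x
    rw [AddMonoidHom.sub_apply, map_sub, sub_eq_zero]
    apply Additive.toMul.injective
    apply Units.coe_injective k
    exact Algebra.norm_eq_of_algEquiv σ _
  obtain ⟨h0, h1⟩ := index_range_sup_range_le ((galUnits σ).toAdditive - AddMonoidHom.id _)
    (Units.map (RingOfIntegers.norm k : 𝓞 L →* 𝓞 k)).toAdditive
    (unitsInclusion k L).toAdditive (N := p ^ n) hνι hνd hc hc0 ha ha0
  have h2 := pow_le_index_units hp2 σ hσ hn
  set T := (LinearMap.range (latticeMap (galUnits σ) - 1) ⊔
      LinearMap.ker (latticeMap (galUnits σ) - 1)) with hT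
  have h3 : ((galUnits σ).toAdditive - AddMonoidHom.id _).range ⊔
      (unitsInclusion k L).toAdditive.range ≤ T.toAddSubgroup.comap (unitsModTorsion L) := by
    refine sup_le ?_ ?_
    · rintro _ ⟨x, rfl⟩
      refine Submodule.mem_sup_left ⟨unitsModTorsion L x, ?_⟩
      rw [AddMonoidHom.sub_apply, map_sub, ← latticeMap_apply]
      rfl
    · rintro _ ⟨x, rfl⟩
      refine Submodule.mem_sup_right ?_
      rw [LinearMap.mem_ker, LinearMap.sub_apply, Module.End.one_apply, sub_eq_zero,
        latticeMap_apply]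
      congr 1
      apply Additive.toMul.injective
      apply Units.coe_injective L
      exact σ.commutes _
  have h4 := Nat.le_of_dvd (Nat.pos_of_ne_zero h0) (AddSubgroup.index_dvd_of_le h3)
  rw [AddSubgroup.index_comap_of_surjective _ (unitsModTorsion_surjective L)] at h4
  have h5 := (h2.trans h4).trans h1
  have h6 : Fintype.card (InfinitePlace k) = Units.rank k + 1 :=
    (Nat.sub_add_cancel Fintype.card_pos).symm
  rw [h6, mul_comm _ n, pow_mul, pow_succ', ← mul_assoc] at h5
  exact Nat.le_of_mul_le_mul_right h5 (pow_pos (pow_pos hp.pos _) _)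

end Units

end ZpTower

namespace ZpTower

open Module
open IsDedekindDomain NumberField
open scoped Pointwise

section Descent

variable {k L : Type*} [Field k] [Field L] [NumberField k] [NumberField L] [Algebra k L]
  [IsGalois k L]

theorem smul_map_algebraMap (g : Gal(L/k)) (J : Ideal (𝓞 k)) :
    g • J.map (algebraMap (𝓞 k) (𝓞 L)) = J.map (algebraMap (𝓞 k) (𝓞 L)) := by
  rw [Ideal.pointwise_smul_def, Ideal.map_map]
  congr 1
  ext x
  exact g.commutes _

/-- In an unramified Galois extension, the ideals fixed by the Galois group are extended from the
base. -/
theorem exists_map_eq_of_smul_eq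
    (hunr : ∀ Q : HeightOneSpectrum (𝓞 L), Q.asIdeal.ramificationIdx (𝓞 k) = 1)
    (I : Ideal (𝓞 L)) (h0 : I ≠ ⊥) (hI : ∀ g : Gal(L/k), g • I = I) :
    ∃ J : Ideal (𝓞 k), J.map (algebraMap (𝓞 k) (𝓞 L)) = I := by
  induction I using WellFoundedGT.induction with
  | ind I ih =>
  by_cases htop : I = ⊤
  · exact ⟨⊤, by rw [htop, Ideal.map_top]⟩
  obtain ⟨M, hM, hIM⟩ := Ideal.exists_le_maximal I htop
  have hM0 : M ≠ ⊥ := fun h => h0 (le_bot_iff.1 (h ▸ hIM))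
  let Q : HeightOneSpectrum (𝓞 L) := ⟨M, hM.isPrime, hM0⟩
  let P := HeightOneSpectrum.under (𝓞 k) Q
  have hQP : Q.asIdeal.LiesOver P.asIdeal := ⟨rfl⟩
  have hPmax : P.asIdeal.IsMaximal := P.isMaximal
  have hPI : P.asIdeal.map (algebraMap (𝓞 k) (𝓞 L)) ∣ I := by
    rw [Ideal.map_algebraMap_eq_finsetProd_pow P.ne_bot]
    refine Finset.prod_dvd_of_coprime ?_ ?_
    · intro Q₁ h₁ Q₂ h₂ hne
      simp only [Set.coe_toFinset] at h₁ h₂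
      have := h₁.1
      have := h₁.2
      have := h₂.1
      have := h₂.2
      have : Q₁.IsMaximal := Ideal.IsMaximal.of_liesOver_isMaximal Q₁ P.asIdeal
      have : Q₂.IsMaximal := Ideal.IsMaximal.of_liesOver_isMaximal Q₂ P.asIdeal
      exact (Ideal.isCoprime_of_isMaximal hne).pow
    · intro Q₁ h₁
      rw [Set.mem_toFinset] at h₁
      have := h₁.1
      have := h₁.2
      have hne : Q₁ ≠ ⊥ := Ideal.ne_bot_of_liesOver_of_ne_bot P.ne_bot Q₁
      rw [hunr ⟨Q₁, h₁.1, hne⟩, pow_one, Ideal.dvd_iff_le]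
      obtain ⟨g, rfl⟩ := Ideal.exists_smul_eq_of_isGaloisGroup P.asIdeal Q.asIdeal Q₁ Gal(L/k)
      rw [← hI g]
      exact Ideal.pointwise_smul_le_pointwise_smul_iff.2 hIM
  obtain ⟨I', hI'⟩ := hPI
  have hP0 : P.asIdeal.map (algebraMap (𝓞 k) (𝓞 L)) ≠ ⊥ := Ideal.map_ne_bot_of_ne_bot P.ne_bot
  have hI'0 : I' ≠ ⊥ := by
    rintro rfl
    exact h0 (by rw [hI', Ideal.mul_bot])
  have hlt : I < I' := by
    rw [← Ideal.dvdNotUnit_iff_lt]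
    refine ⟨hI'0, _, ?_, hI'.trans (mul_comm _ _)⟩
    rw [Ideal.isUnit_iff]
    intro h
    have h2 : P.asIdeal.map (algebraMap (𝓞 k) (𝓞 L)) ≤ Q.asIdeal := Ideal.map_le_iff_le_comap.2 le_rfl
    rw [h] at h2
    exact hM.ne_top (top_le_iff.1 h2)
  obtain ⟨J, hJ⟩ := ih I' hlt hI'0 (fun g => by
    have h := hI g
    rw [hI', smul_mul', smul_map_algebraMap] at h
    exact mul_left_cancel₀ hP0 h)
  exact ⟨P.asIdeal * J, by rw [Ideal.map_mul, hJ, ← hI']⟩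

/-- If the classes of two elements of `K` under `φ` agree only if they are congruent modulo `H`,
then the relative index of `H` is at most the number of classes. -/
theorem relIndex_le_card {G C : Type*} [AddGroup G] [Finite C] (H K : AddSubgroup G) (φ : K → C)
    (hφ : ∀ x y : K, φ x = φ y → -(x : G) + y ∈ H) : H.relIndex K ≤ Nat.card C ∧ H.relIndex K ≠ 0 := by
  have hinj : Function.Injective fun q : K ⧸ H.addSubgroupOf K => φ q.out := by
    intro q q' h
    rw [← q.out_eq', ← q'.out_eq', QuotientAddGroup.eq]
    exact hφ _ _ h
  have := Finite.of_injective _ hinj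
  exact ⟨Nat.card_le_card_of_injective _ hinj, Nat.card_pos.ne'⟩

end Descent

section

variable {k L : Type} [Field k] [Field L] [NumberField k] [NumberField L] [Algebra k L]
  [IsGalois k L]

theorem relIndex_le_card_classGroup
    (hunr : ∀ Q : HeightOneSpectrum (𝓞 L), Q.asIdeal.ramificationIdx (𝓞 k) = 1)
    (σ : Gal(L/k)) (hσ : ∀ x, x ∈ Subgroup.zpowers σ) :
    ((galUnits σ).toAdditive - AddMonoidHom.id _).range.relIndex
      (Units.map (RingOfIntegers.norm k : 𝓞 L →* 𝓞 k)).toAdditive.ker ≤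
        Nat.card (ClassGroup (𝓞 k)) ∧
    ((galUnits σ).toAdditive - AddMonoidHom.id _).range.relIndex
      (Units.map (RingOfIntegers.norm k : 𝓞 L →* 𝓞 k)).toAdditive.ker ≠ 0 := by
  have : IsCyclic Gal(L/k) := ⟨σ, hσ⟩
  have key : ∀ ε : (Units.map (RingOfIntegers.norm k : 𝓞 L →* 𝓞 k)).toAdditive.ker,
      ∃ (α : 𝓞 L) (J : nonZeroDivisors (Ideal (𝓞 k))), α ≠ 0 ∧ (ε.1.toMul : 𝓞 L) * σ • α = α ∧
        (J : Ideal (𝓞 k)).map (algebraMap (𝓞 k) (𝓞 L)) = Ideal.span {α} := by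
    rintro ⟨ε, hε⟩
    have hnorm : Algebra.norm k (algebraMap (𝓞 L) L (ε.toMul : (𝓞 L)ˣ)) = 1 := by
      rw [← RingOfIntegers.coe_norm]
      have h : Units.map (RingOfIntegers.norm k : 𝓞 L →* 𝓞 k) ε.toMul = 1 := hε
      exact congrArg (fun u : (𝓞 k)ˣ => ((u : 𝓞 k) : k)) h
    obtain ⟨α, h0, hα⟩ := groupCohomology.exists_mul_galRestrict_of_norm_eq_one (A := 𝓞 k) hσ hnorm
    have hα' : ((ε.toMul : (𝓞 L)ˣ) : 𝓞 L) * σ • α = α := by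
      conv_rhs => rw [← hα]
      congr 1
      apply RingOfIntegers.ext
      exact (algebraMap_galRestrict_apply (𝓞 k) σ α).symm
    have hσI : σ • Ideal.span {α} = Ideal.span {α} := by
      rw [Ideal.pointwise_smul_def, Ideal.map_span, Set.image_singleton]
      conv_rhs => rw [← hα', Ideal.span_singleton_mul_left_unit (Units.isUnit _)]
      rfl
    obtain ⟨J, hJ⟩ := exists_map_eq_of_smul_eq hunr (Ideal.span {α}) (by simpa using h0) (by
      intro g
      obtain ⟨a, rfl⟩ := hσ g
      have : σ ∈ MulAction.stabilizer Gal(L/k) (Ideal.span {α}) := hσI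
      exact zpow_mem this a)
    have hJ0 : J ≠ 0 := by
      rintro rfl
      rw [Ideal.zero_eq_bot, Ideal.map_bot, eq_comm, Ideal.span_singleton_eq_bot] at hJ
      exact h0 hJ
    exact ⟨α, ⟨J, mem_nonZeroDivisors_of_ne_zero hJ0⟩, h0, hα', hJ⟩
  choose α J h0 hα hJ using key
  refine relIndex_le_card _ _ (fun ε => ClassGroup.mk0 (J ε)) fun ε ε' h => ?_
  obtain ⟨x, y, hx, hy, hxy⟩ := ClassGroup.mk0_eq_mk0_iff.1 h
  have h1 := congrArg (Ideal.map (algebraMap (𝓞 k) (𝓞 L))) hxy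
  rw [Ideal.map_mul, Ideal.map_mul, hJ, hJ, Ideal.map_span, Ideal.map_span, Set.image_singleton,
    Set.image_singleton, Ideal.span_singleton_mul_span_singleton,
    Ideal.span_singleton_mul_span_singleton, Ideal.span_singleton_eq_span_singleton] at h1
  obtain ⟨u, hu⟩ := h1
  have hfix : ∀ z : 𝓞 k, σ • algebraMap (𝓞 k) (𝓞 L) z = algebraMap (𝓞 k) (𝓞 L) z := fun z =>
    RingOfIntegers.ext (σ.commutes _)
  have hx' : algebraMap (𝓞 k) (𝓞 L) x ≠ 0 := by simpa using hx
  have h2 : (ε.1.toMul : 𝓞 L) * (u : 𝓞 L) = (ε'.1.toMul : 𝓞 L) * σ • (u : 𝓞 L) := by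
    have h3 := congrArg (fun z => (ε'.1.toMul : 𝓞 L) * σ • z) hu
    simp only [smul_mul', hfix] at h3
    have h4 : algebraMap (𝓞 k) (𝓞 L) x * (σ • α ε) *
        ((ε'.1.toMul : 𝓞 L) * σ • (u : 𝓞 L)) = algebraMap (𝓞 k) (𝓞 L) x * (σ • α ε) *
        ((ε.1.toMul : 𝓞 L) * (u : 𝓞 L)) := by
      calc _ = (ε'.1.toMul : 𝓞 L) *
            (algebraMap (𝓞 k) (𝓞 L) x * (σ • α ε) * σ • (u : 𝓞 L)) := by ring
        _ = algebraMap (𝓞 k) (𝓞 L) y * ((ε'.1.toMul : 𝓞 L) * σ • α ε') := by rw [h3]; ring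
        _ = algebraMap (𝓞 k) (𝓞 L) x * ((ε.1.toMul : 𝓞 L) * σ • α ε) * u := by
          rw [hα, hα, hu]
        _ = _ := by ring
    refine (mul_left_cancel₀ (mul_ne_zero hx' ?_) h4).symm
    intro h5
    apply h0 ε
    rw [← hα ε, h5, mul_zero]
  refine ⟨Additive.ofMul u⁻¹, ?_⟩
  apply Additive.toMul.injective
  have h6 : ε.1.toMul * u = ε'.1.toMul * galUnits σ u := Units.ext h2
  rw [AddMonoidHom.sub_apply]
  change galUnits σ u⁻¹ / u⁻¹ = (ε.1.toMul)⁻¹ * ε'.1.toMul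
  rw [map_inv, inv_div_inv, div_eq_iff_eq_mul, mul_assoc, eq_inv_mul_iff_mul_eq]
  exact h6

end

end ZpTower

namespace ZpTower

open Module
open IsDedekindDomain NumberField

section Tame

variable {K M L : Type*} [Field K] [Field M] [Field L] [NumberField K] [NumberField M]
  [NumberField L] [Algebra K L]

/-- Away from the residue characteristic, an automorphism moves a uniformizer as much as possible
in a totally ramified extension of prime degree. -/
theorem IsTotRam.addVal_sub_eq_one [IsGalois K L] {p : ℕ} (hp : p.Prime)
    (hN : finrank K L = p) {Q : HeightOneSpectrum (𝓞 L)} (h : IsTotRam K Q)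
    (hpQ : (p : 𝓞 L) ∉ Q.asIdeal) {π : L} (hπ : addVal Q L π = 1) {g : Gal(L/K)} (hg : g ≠ 1) :
    addVal Q L (g π - π) = 1 := by
  classical
  have H := h.isTotallyRamified hπ
  obtain ⟨i, hi, h1⟩ := H.exists_map_sub_eq hg
  have : Fact p.Prime := ⟨hp⟩
  have hcard : Nat.card Gal(L/K) = p := by rw [IsGalois.card_aut_eq_finrank, hN]
  have hall : ∀ x : Gal(L/K), x ≠ 1 → addVal Q L (x π - π) = ((i - 1 + 1 : ℤ) : WithTop ℤ) := by
    intro x hx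
    obtain ⟨a, rfl⟩ := mem_powers_of_prime_card hcard hg (g' := x)
    obtain ⟨b, hb⟩ := mem_powers_of_prime_card hcard hx (g' := g)
    rw [sub_add_cancel, ← hi]
    refine le_antisymm ?_ (H.map_sub_le_map_pow_sub g a)
    conv_rhs => rw [← hb]
    exact H.map_sub_le_map_pow_sub _ b
  have hp0 : addVal Q L (p : L) = ((0 : ℤ) : WithTop ℤ) := by
    have := (addVal_algebraMap_eq_zero_iff Q (L := L) (r := (p : 𝓞 L))).2 hpQ
    rwa [map_natCast] at this
  have h2 := (H.sub_one_mul_le_of_prime hp hN (i - 1) hall hp0).1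
  have hp1 : (0 : ℤ) < p - 1 := by
    have := hp.one_lt
    omega
  have h3 : i - 1 ≤ 0 := by
    by_contra! hlt
    exact (mul_pos hp1 hlt).not_ge h2
  rw [hi]
  have : i = 1 := by omega
  rw [this]
  rfl

variable [Algebra K M] [Algebra M L] [IsScalarTower K M L]

/-- The degree of a cyclic extension of `p`-power degree which is totally ramified at a prime not
above `p` is bounded in terms of the norm of the prime. -/
theorem IsTotRam.pow_le_absNorm_sq [IsGalois K L] [IsCyclic Gal(L/K)] {p r : ℕ} [Fact p.Prime]
    (hN : finrank K L = p ^ r) (hM : finrank M L = p) {Q : HeightOneSpectrum (𝓞 L)}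
    (h : IsTotRam K Q) (h' : IsTotRam M Q) (hpQ : (p : 𝓞 L) ∉ Q.asIdeal) :
    p ^ r ≤ Ideal.absNorm Q.asIdeal ^ 2 := by
  have hp : p.Prime := Fact.out
  have : IsGalois M L := IsGalois.tower_top_of_isGalois K M L
  obtain ⟨π, hπ⟩ := exists_addVal_algebraMap_eq_one Q (L := L)
  have H := h.isTotallyRamified hπ
  have key : ∀ x : Gal(L/K), ((2 : ℤ) : WithTop ℤ) ≤
      addVal Q L (x (algebraMap (𝓞 L) L π) - algebraMap (𝓞 L) L π) → x = 1 := by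
    intro x hx
    by_contra hne
    have hcard : Nat.card Gal(L/K) = p ^ r := by rw [IsGalois.card_aut_eq_finrank, hN]
    obtain ⟨s, -, hs⟩ := (Nat.dvd_prime_pow hp).1 (hcard ▸ orderOf_dvd_natCard x)
    cases s with
    | zero => exact hne (orderOf_eq_one_iff.1 (by rw [hs, pow_zero]))
    | succ s =>
    have hord : orderOf (x ^ p ^ s) = p := by
      rw [orderOf_pow_of_dvd (pow_ne_zero _ hp.ne_zero) (hs ▸ pow_dvd_pow p s.le_succ), hs,
        Nat.pow_div s.le_succ hp.pos, Nat.succ_sub s.le_refl, Nat.sub_self, pow_one]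
    obtain ⟨g, hg⟩ := (range_restrictScalarsHom (F := M) (x ^ p ^ s)).2 (by
      rw [hM, ← orderOf_dvd_iff_pow_eq_one, hord])
    have hg1 : g ≠ 1 := by
      rintro rfl
      have : x ^ p ^ s = 1 := hg.symm
      rw [this, orderOf_one] at hord
      exact hp.one_lt.ne hord
    have h1 := h'.addVal_sub_eq_one hp hM hpQ hπ hg1
    have h2 := hx.trans (H.map_sub_le_map_pow_sub x (p ^ s))
    rw [← hg] at h2
    change _ ≤ addVal Q L (g (algebraMap (𝓞 L) L π) - algebraMap (𝓞 L) L π) at h2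
    rw [h1] at h2
    exact absurd (WithTop.coe_le_coe.1 h2) (by norm_num)
  have hinj : Function.Injective fun g : Gal(L/K) => Ideal.Quotient.mk (Q.asIdeal ^ 2) (g • π) := by
    intro g₁ g₂ hg
    have h1 := Ideal.Quotient.eq.1 hg
    rw [← le_addVal_algebraMap_iff Q (L := L), map_sub] at h1
    change _ ≤ addVal Q L (g₁ (algebraMap (𝓞 L) L π) - g₂ (algebraMap (𝓞 L) L π)) at h1
    rw [← h.addVal_gal g₂⁻¹, map_sub] at h1
    refine (inv_mul_eq_one.1 (key (g₂⁻¹ * g₁) ?_)).symm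
    have h2 : g₂⁻¹ (g₂ (algebraMap (𝓞 L) L π)) = algebraMap (𝓞 L) L π :=
      AlgEquiv.symm_apply_apply g₂ _
    rw [h2] at h1
    exact h1
  have hne : Q.asIdeal ^ 2 ≠ ⊥ := pow_ne_zero _ Q.ne_bot
  have : Finite (𝓞 L ⧸ Q.asIdeal ^ 2) := Ideal.finiteQuotientOfFreeOfNeBot _ hne
  calc p ^ r = Nat.card Gal(L/K) := by rw [IsGalois.card_aut_eq_finrank, hN]
    _ ≤ Nat.card (𝓞 L ⧸ Q.asIdeal ^ 2) := Nat.card_le_card_of_injective _ hinj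
    _ = Ideal.absNorm Q.asIdeal ^ 2 := by
      rw [← map_pow, Ideal.absNorm_apply, Submodule.cardQuot_apply]

end Tame

end ZpTower

namespace ZpTower

open Module
open IsDedekindDomain NumberField

variable {p : ℕ} [Fact p.Prime] {K : ℕ → IntermediateField ℚ (AlgebraicClosure ℚ)}
  [∀ n, NumberField (K n)] (T : IsZpTower p K)

include T

/-- Primes not above `p` are unramified in the tower. -/
theorem IsZpTower.ramificationIdx_eq_one {n : ℕ} (Q : HeightOneSpectrum (𝓞 (K n)))
    (hpQ : (p : 𝓞 (K n)) ∉ Q.asIdeal) :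
    letI := inclusionAlgebra (T.mono (Nat.zero_le n))
    Q.asIdeal.ramificationIdx (𝓞 (K 0)) = 1 := by
  letI := inclusionAlgebra (T.mono (Nat.zero_le n))
  by_contra hQ
  have hp : p.Prime := Fact.out
  set r := Ideal.absNorm Q.asIdeal ^ 2 with hr
  have h0r : 0 ≤ n + r := Nat.zero_le _
  have h0j : 0 ≤ n + (r + 1) := Nat.zero_le _
  have hnr : n ≤ n + r := Nat.le_add_right _ _
  have hnj : n ≤ n + (r + 1) := Nat.le_add_right _ _
  have hrj : n + r ≤ n + (r + 1) := by omega
  letI := inclusionAlgebra (T.mono h0r)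
  letI := inclusionAlgebra (T.mono h0j)
  letI := inclusionAlgebra (T.mono hnr)
  letI := inclusionAlgebra (T.mono hnj)
  letI := inclusionAlgebra (T.mono hrj)
  have := isScalarTower_inclusionAlgebra (T.mono (Nat.zero_le n)) (T.mono hnr)
  have := isScalarTower_inclusionAlgebra (T.mono (Nat.zero_le n)) (T.mono hnj)
  have := isScalarTower_inclusionAlgebra (T.mono h0r) (T.mono hrj)
  have := isScalarTower_inclusionAlgebra (T.mono hnr) (T.mono hrj)
  have := T.isGalois h0j
  have := T.isCyclic h0j
  have := T.isGalois hnj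
  have := T.isCyclic hnj
  obtain ⟨Q', hQ'⟩ := exists_heightOneSpectrum_liesOver (L := K (n + (r + 1))) Q
  obtain ⟨P, hQP, hPQ⟩ := liesOver_under T hnr hrj Q' Q hQ'
  have hP : P.asIdeal.ramificationIdx (𝓞 (K 0)) ≠ 1 := by
    rw [Ideal.ramificationIdx_tower (R := 𝓞 (K 0)) Q.asIdeal P.asIdeal]
    intro h
    exact hQ (Nat.eq_one_of_mul_eq_one_right h)
  have h1 := isTotRam_of_ramificationIdx_ne_one (T.finrank_eq h0j) (Q := Q') Q hQ
  have h2 := isTotRam_of_ramificationIdx_ne_one (T.finrank_eq h0j) (Q := Q') P hP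
  have hpQ' : (p : 𝓞 (K (n + (r + 1)))) ∉ Q'.asIdeal := by
    rw [hQ'.over] at hpQ
    rwa [Ideal.mem_comap, map_natCast] at hpQ
  have h3 := h1.pow_le_absNorm_sq (T.finrank_eq hnj)
    ((T.finrank_eq hrj).trans (by rw [show n + (r + 1) - (n + r) = 1 by omega, pow_one])) h2 hpQ'
  rw [h1.absNorm_eq Q, ← hr, Nat.add_sub_cancel_left] at h3
  have h4 := Nat.lt_pow_self hp.one_lt (n := r + 1)
  omega

theorem exists_isTotRamIn (hp2 : p ≠ 2)
    (hd : ∀ P : HeightOneSpectrum (𝓞 (K 0)), (p : 𝓞 (K 0)) ∈ P.asIdeal →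
      IsTotRamIn T P ∨ IsUnramifiedIn T P) :
    ∃ P : HeightOneSpectrum (𝓞 (K 0)), (p : 𝓞 (K 0)) ∈ P.asIdeal ∧ IsTotRamIn T P := by
  by_contra! hno
  have hp : p.Prime := Fact.out
  set n := Nat.card (ClassGroup (𝓞 (K 0))) * Nat.card (Units.torsion (K 0)) with hn
  letI := inclusionAlgebra (T.mono (Nat.zero_le n))
  have := T.isGalois (Nat.zero_le n)
  have := T.isCyclic (Nat.zero_le n)
  have hunr : ∀ Q : HeightOneSpectrum (𝓞 (K n)), Q.asIdeal.ramificationIdx (𝓞 (K 0)) = 1 := by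
    intro Q
    by_cases hpQ : (p : 𝓞 (K n)) ∈ Q.asIdeal
    · have hQ : Q.asIdeal.LiesOver (HeightOneSpectrum.under (𝓞 (K 0)) Q).asIdeal := ⟨rfl⟩
      have hpP : (p : 𝓞 (K 0)) ∈ (HeightOneSpectrum.under (𝓞 (K 0)) Q).asIdeal := by
        rw [hQ.over, Ideal.mem_comap, map_natCast]
        exact hpQ
      exact ((hd _ hpP).resolve_left (hno _ hpP)) 0 n (Nat.zero_le n) Q hQ
    · exact T.ramificationIdx_eq_one Q hpQ
  obtain ⟨σ, hσ⟩ := IsCyclic.exists_generator (α := Gal(K n/K 0))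
  have h1 := relIndex_le_card_classGroup hunr σ hσ
  have h2 := pow_le_relIndex_mul_torsion hp2 σ hσ (T.finrank_eq (Nat.zero_le n)) h1.1 h1.2
  rw [← hn] at h2
  have h3 := Nat.lt_pow_self hp.one_lt (n := n)
  rw [Nat.sub_zero] at h2
  omega

end ZpTower

namespace ZpTower

open Module
open IsDedekindDomain NumberField

variable {p : ℕ} [Fact p.Prime] {K : ℕ → IntermediateField ℚ (AlgebraicClosure ℚ)}
  [∀ n, NumberField (K n)] (T : IsZpTower p K)

include T

theorem IsZpTower.exists_padicValNat_discr_eq (hp2 : p ≠ 2) :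
    ∃ a b c : ℚ, 0 < a ∧ ∃ N : ℕ, ∀ n ≥ N,
      (padicValNat p (discr (K n)).natAbs : ℚ) = a * n * (p : ℚ) ^ n + b * (p : ℚ) ^ n + c := by
  have hp : p.Prime := Fact.out
  obtain ⟨m, hm⟩ := T.exists_isTotRam_or_unramified
  have hd : ∀ P : HeightOneSpectrum (𝓞 (K (m + 0))), (p : 𝓞 (K (m + 0))) ∈ P.asIdeal →
      IsTotRamIn (T.shift m) P ∨ IsUnramifiedIn (T.shift m) P := fun P hP =>
    (hm P hP).imp
      (fun h i j hij Q hQ => h (m + i) (m + j) (Nat.le_add_right m i) (by omega) Q hQ)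
      (fun h i j hij Q hQ => h (m + i) (m + j) (Nat.le_add_right m i) (by omega) Q hQ)
  obtain ⟨a, b, c, ha, N, h⟩ :=
    exists_padicValNat_discr (T.shift m) hd (exists_isTotRamIn (T.shift m) hp2 hd)
  have hp0 : (0 : ℚ) < p := by exact_mod_cast hp.pos
  refine ⟨a / p ^ m, (b - a * m) / p ^ m, c, by positivity, m + N, fun n hn => ?_⟩
  obtain ⟨n, rfl⟩ := Nat.exists_eq_add_of_le ((Nat.le_add_right m N).trans hn)
  rw [h n (by omega), pow_add]
  push_cast
  field_simp
  ring

end ZpTower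

/-- **Discriminant growth in a ℤ_p-tower of number fields.**
Let `p` be an odd prime and `K 0 ⊆ K 1 ⊆ K 2 ⊆ ⋯` a ℤ_p-tower of number fields inside a
fixed algebraic closure of `ℚ`, i.e. each `K n / K 0` is Galois with Galois group
isomorphic to `ℤ/pⁿℤ`.  Writing `d n` for the absolute value of the discriminant of `K n`,
there are rational constants `a, b, c` with `a > 0` such that for all sufficiently large `n`
one has `v_p(d n) = a·n·pⁿ + b·pⁿ + c`. -/
theorem discriminant_stability_in_Zp_tower
    (p : ℕ) [Fact p.Prime] (hp2 : p ≠ 2)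
    (K : ℕ → IntermediateField ℚ (AlgebraicClosure ℚ))
    (hnf : ∀ n, NumberField (K n))
    (hmono : Monotone K)
    (hgal : ∀ n : ℕ,
      letI : Algebra (K 0) (K n) :=
        ((IntermediateField.inclusion (hmono (Nat.zero_le n))).toRingHom).toAlgebra
      IsGalois (K 0) (K n))
    (hcyc : ∀ n : ℕ,
      letI : Algebra (K 0) (K n) :=
        ((IntermediateField.inclusion (hmono (Nat.zero_le n))).toRingHom).toAlgebra
      Nonempty ((K n ≃ₐ[K 0] K n) ≃* Multiplicative (ZMod (p ^ n)))) :
    ∃ a b c : ℚ, 0 < a ∧ ∃ N : ℕ, ∀ n ≥ N,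
      (padicValNat p (@NumberField.discr (K n) _ (hnf n)).natAbs : ℚ)
        = a * n * (p : ℚ) ^ n + b * (p : ℚ) ^ n + c :=
  (ZpTower.IsZpTower.of_zero hmono hgal hcyc).exists_padicValNat_discr_eq hp2
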